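/- arXiv:1904.10385 — 3 statements merged into one kernel-verified Lean document; each statement's English description precedes it below -/
import Mathlib

section
/- Let V : [0,∞) → L(X₀) be strongly continuous and let W : [0,∞) → L(X₀) be the unique strongly continuous solution of W = V + B(W). (a) If V is norm continuous on (0,∞), then so is W. (b) If V is norm continuous and compact on (0,∞), then so is W. (c) If V(0) = 0 and V is strongly continuously differentiable on [0,∞), then so is W. -/
open Set Filter MeasureTheory
open scoped Topology

noncomputable section

structure MRSetting (X : Type*) [NormedAddCommGroup X] [NormedSpace ℂ X] [CompleteSpace X]
    (X₀ : Submodule ℂ X) where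
  closed : IsClosed (X₀ : Set X)
  T : ℝ → (X₀ →L[ℂ] X₀)
  S : ℝ → (X →L[ℂ] X₀)
  T_zero : T 0 = 1
  T_add : ∀ t s : ℝ, 0 ≤ t → 0 ≤ s → T (t + s) = (T t).comp (T s)
  T_cont : ∀ x : X₀, ContinuousOn (fun t => T t x) (Ici 0)
  S_zero : S 0 = 0
  S_cont : ∀ x : X, ContinuousOn (fun t => S t x) (Ici 0)
  TS : ∀ t s : ℝ, 0 ≤ t → 0 ≤ s → ∀ x : X, T t (S s x) = S (t + s) x - S t x
  δ : ℝ → ℝ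
  δ_nonneg : ∀ t : ℝ, 0 ≤ t → 0 ≤ δ t
  δ_mono : MonotoneOn δ (Ici 0)
  δ_lim : Tendsto δ (𝓝[>] 0) (𝓝 0)
  SD : (ℝ → X) → ℝ → X₀
  SD_deriv : ∀ f : ℝ → X, ContinuousOn f (Ici 0) → ∀ t ∈ Ici (0:ℝ),
    HasDerivWithinAt (fun τ : ℝ => ∫ s in (0:ℝ)..τ, S (τ - s) (f s)) (SD f t) (Ici 0) t
  SD_cont : ∀ f : ℝ → X, ContinuousOn f (Ici 0) → ContinuousOn (SD f) (Ici 0)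
  SD_bound : ∀ f : ℝ → X, ContinuousOn f (Ici 0) → ∀ t ∈ Ici (0:ℝ),
    ‖SD f t‖ ≤ δ t * ⨆ s : Icc (0:ℝ) t, ‖f (s : ℝ)‖
  SDop : (ℝ → (X₀ →L[ℂ] X)) → ℝ → (X₀ →L[ℂ] X₀)
  SDop_apply : ∀ V : ℝ → (X₀ →L[ℂ] X), (∀ x : X₀, ContinuousOn (fun s => V s x) (Ici 0)) →
    ∀ t : ℝ, ∀ x : X₀, SDop V t x = SD (fun s => V s x) t

variable {X : Type*} [NormedAddCommGroup X] [NormedSpace ℂ X] [CompleteSpace X]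
  {X₀ : Submodule ℂ X}

/-- The perturbation operator `B(U) = S ⋄ (L ∘ U)`. -/
def MRSetting.Bop (M : MRSetting X X₀) (L : X₀ →L[ℂ] X) (U : ℝ → (X₀ →L[ℂ] X₀)) :
    ℝ → (X₀ →L[ℂ] X₀) :=
  M.SDop (fun s => L.comp (U s))


/-- `W` is strongly continuously differentiable on `J`: for every `x`, `t ↦ W t x` has a
continuous derivative on `J`. -/
def StronglyC1On (W : ℝ → (X₀ →L[ℂ] X₀)) (J : Set ℝ) : Prop :=
  ∀ x : X₀, ∃ g : ℝ → X₀, ContinuousOn g J ∧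
    ∀ t ∈ J, HasDerivWithinAt (fun s => W s x) (g t) J t

/-- The same setting with an abstract Banach space `Y` in place of the closed subspace. -/
structure GMR (X Y : Type*) [NormedAddCommGroup X] [NormedSpace ℂ X] [CompleteSpace X]
    [NormedAddCommGroup Y] [NormedSpace ℂ Y] where
  T : ℝ → (Y →L[ℂ] Y)
  S : ℝ → (X →L[ℂ] Y)
  T_zero : T 0 = 1
  T_add : ∀ t s : ℝ, 0 ≤ t → 0 ≤ s → T (t + s) = (T t).comp (T s)
  T_cont : ∀ x : Y, ContinuousOn (fun t => T t x) (Ici 0)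
  S_zero : S 0 = 0
  S_cont : ∀ x : X, ContinuousOn (fun t => S t x) (Ici 0)
  TS : ∀ t s : ℝ, 0 ≤ t → 0 ≤ s → ∀ x : X, T t (S s x) = S (t + s) x - S t x
  δ : ℝ → ℝ
  δ_nonneg : ∀ t : ℝ, 0 ≤ t → 0 ≤ δ t
  δ_mono : MonotoneOn δ (Ici 0)
  δ_lim : Tendsto δ (𝓝[>] 0) (𝓝 0)
  SD : (ℝ → X) → ℝ → Y
  SD_deriv : ∀ f : ℝ → X, ContinuousOn f (Ici 0) → ∀ t ∈ Ici (0:ℝ),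
    HasDerivWithinAt (fun τ : ℝ => ∫ s in (0:ℝ)..τ, S (τ - s) (f s)) (SD f t) (Ici 0) t
  SD_cont : ∀ f : ℝ → X, ContinuousOn f (Ici 0) → ContinuousOn (SD f) (Ici 0)
  SD_bound : ∀ f : ℝ → X, ContinuousOn f (Ici 0) → ∀ t ∈ Ici (0:ℝ),
    ‖SD f t‖ ≤ δ t * ⨆ s : Icc (0:ℝ) t, ‖f (s : ℝ)‖
  SDop : (ℝ → (Y →L[ℂ] X)) → ℝ → (Y →L[ℂ] Y)
  SDop_apply : ∀ V : ℝ → (Y →L[ℂ] X), (∀ x : Y, ContinuousOn (fun s => V s x) (Ici 0)) →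
    ∀ t : ℝ, ∀ x : Y, SDop V t x = SD (fun s => V s x) t

/-- every `MRSetting` is an abstract setting -/
def MRSetting.toGMR (M : MRSetting X X₀) : GMR X X₀ where
  T := M.T
  S := M.S
  T_zero := M.T_zero
  T_add := M.T_add
  T_cont := M.T_cont
  S_zero := M.S_zero
  S_cont := M.S_cont
  TS := M.TS
  δ := M.δ
  δ_nonneg := M.δ_nonneg
  δ_mono := M.δ_mono
  δ_lim := M.δ_lim
  SD := M.SD
  SD_deriv := M.SD_deriv
  SD_cont := M.SD_cont
  SD_bound := M.SD_bound
  SDop := M.SDop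
  SDop_apply := M.SDop_apply

section General

variable {E F : Type*} [NormedAddCommGroup E] [NormedSpace ℂ E] [NormedAddCommGroup F]
  [NormedSpace ℂ F]

theorem strong_bdd [CompleteSpace E] (G : ℝ → (E →L[ℂ] F))
    (hG : ∀ x, ContinuousOn (fun t => G t x) (Ici 0)) (b : ℝ) :
    ∃ C, 0 ≤ C ∧ ∀ t ∈ Icc (0:ℝ) b, ‖G t‖ ≤ C := by
  obtain ⟨C, hC⟩ := banach_steinhaus (g := fun t : Icc (0:ℝ) b => G t) (by
    intro x
    obtain ⟨C, hC⟩ := isCompact_Icc.exists_bound_of_continuousOn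
      ((hG x).mono (Icc_subset_Ici_self : Icc (0:ℝ) b ⊆ Ici 0))
    exact ⟨C, fun i => hC i i.2⟩)
  exact ⟨max C 0, le_max_right _ _, fun t ht => (hC ⟨t, ht⟩).trans (le_max_left _ _)⟩

theorem strong_joint [CompleteSpace E] (G : ℝ → (E →L[ℂ] F))
    (hG : ∀ x, ContinuousOn (fun t => G t x) (Ici 0)) (J : Set ℝ) (u : ℝ → ℝ) (f : ℝ → E)
    (hu : ContinuousOn u J) (hu0 : ∀ s ∈ J, 0 ≤ u s) (hf : ContinuousOn f J) :
    ContinuousOn (fun s => G (u s) (f s)) J := by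
  intro s hs
  obtain ⟨C, hC0, hC⟩ := strong_bdd G hG (u s + 1)
  have h1 : Tendsto (fun r => G (u r) (f s)) (𝓝[J] s) (𝓝 (G (u s) (f s))) :=
    ((hG (f s)).comp hu hu0) s hs
  have h2 : Tendsto (fun r => G (u r) (f r - f s)) (𝓝[J] s) (𝓝 0) := by
    have h3 : Tendsto (fun r => C * ‖f r - f s‖) (𝓝[J] s) (𝓝 0) := by
      have : Tendsto (fun r => f r - f s) (𝓝[J] s) (𝓝 (f s - f s)) := (hf s hs).sub_const _
      simpa using this.norm.const_mul C
    refine squeeze_zero_norm' ?_ h3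
    have h4 : ∀ᶠ r in 𝓝[J] s, u r < u s + 1 := (hu s hs).eventually_lt_const (by linarith)
    filter_upwards [h4, self_mem_nhdsWithin] with r hr hrJ
    exact (G (u r)).le_of_opNorm_le (hC _ ⟨hu0 r hrJ, hr.le⟩) _
  have := h1.add h2
  simp only [map_sub, add_zero, add_sub_cancel] at this
  exact this

end General

namespace GMR

variable {Y : Type*} [NormedAddCommGroup Y] [NormedSpace ℂ Y] [CompleteSpace Y] (M : GMR X Y)

/-- The perturbation operator. -/
def Bop (L : Y →L[ℂ] X) (U : ℝ → (Y →L[ℂ] Y)) : ℝ → (Y →L[ℂ] Y) :=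
  M.SDop (fun s => L.comp (U s))


/-- the convolution -/
def conv (f : ℝ → X) (τ : ℝ) : Y := ∫ s in (0:ℝ)..τ, M.S (τ - s) (f s)

theorem conv_cont {f : ℝ → X} (hf : ContinuousOn f (Ici 0)) {τ b : ℝ} (hb : b ≤ τ) :
    ContinuousOn (fun s => M.S (τ - s) (f s)) (Icc 0 b) :=
  strong_joint M.S M.S_cont _ (fun s => τ - s) f (by fun_prop)
    (fun s hs => by have := hs.2; linarith) (hf.mono Icc_subset_Ici_self)

theorem conv_int {f : ℝ → X} (hf : ContinuousOn f (Ici 0)) {τ b : ℝ} (h0 : 0 ≤ b) (hb : b ≤ τ) :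
    IntervalIntegrable (fun s => M.S (τ - s) (f s)) volume 0 b :=
  (M.conv_cont hf hb).intervalIntegrable_of_Icc h0

theorem SD_unique {f : ℝ → X} (hf : ContinuousOn f (Ici 0)) {t : ℝ} (ht : 0 ≤ t) {y : Y}
    (h : HasDerivWithinAt (M.conv f) y (Ici 0) t) : M.SD f t = y :=
  UniqueDiffWithinAt.eq_deriv _ (uniqueDiffOn_Ici (0:ℝ) t ht) (M.SD_deriv f hf t ht) h

theorem SD_add {f g : ℝ → X} (hf : ContinuousOn f (Ici 0)) (hg : ContinuousOn g (Ici 0))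
    {t : ℝ} (ht : 0 ≤ t) : M.SD (fun s => f s + g s) t = M.SD f t + M.SD g t := by
  apply M.SD_unique (hf.add hg) ht
  refine ((M.SD_deriv f hf t ht).add (M.SD_deriv g hg t ht)).congr_of_mem ?_ ht
  intro τ hτ
  simp only [conv, map_add, Pi.add_apply]
  exact intervalIntegral.integral_add (M.conv_int hf hτ le_rfl) (M.conv_int hg hτ le_rfl)

theorem SD_smul {f : ℝ → X} (hf : ContinuousOn f (Ici 0)) (c : ℂ)
    {t : ℝ} (ht : 0 ≤ t) : M.SD (fun s => c • f s) t = c • M.SD f t := by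
  apply M.SD_unique (hf.const_smul c) ht
  refine ((M.SD_deriv f hf t ht).const_smul c).congr_of_mem ?_ ht
  intro τ hτ
  simp only [conv, map_smul, Pi.smul_apply]
  exact intervalIntegral.integral_smul c _

theorem SD_sub {f g : ℝ → X} (hf : ContinuousOn f (Ici 0)) (hg : ContinuousOn g (Ici 0))
    {t : ℝ} (ht : 0 ≤ t) : M.SD (fun s => f s - g s) t = M.SD f t - M.SD g t := by
  have h := M.SD_add hf (g := fun s => (-1 : ℂ) • g s) (hg.const_smul (-1 : ℂ)) ht
  rw [M.SD_smul hg (-1) ht] at h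
  simp only [neg_smul, one_smul, ← sub_eq_add_neg] at h
  exact h

theorem SD_congr {f g : ℝ → X} (hf : ContinuousOn f (Ici 0))
    (hfg : ∀ s, 0 ≤ s → g s = f s) {t : ℝ} (ht : 0 ≤ t) : M.SD g t = M.SD f t := by
  apply M.SD_unique (hf.congr hfg) ht
  refine (M.SD_deriv f hf t ht).congr_of_mem ?_ ht
  intro τ hτ
  apply intervalIntegral.integral_congr
  intro s hs
  rw [uIcc_of_le hτ] at hs
  simp only [hfg s hs.1]

theorem SD_le {f : ℝ → X} (hf : ContinuousOn f (Ici 0)) {t : ℝ} (ht : 0 ≤ t) {c : ℝ}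
    (hc : ∀ s ∈ Icc 0 t, ‖f s‖ ≤ c) : ‖M.SD f t‖ ≤ M.δ t * c := by
  refine (M.SD_bound f hf t ht).trans ?_
  have : Nonempty (Icc (0:ℝ) t) := ⟨⟨0, le_rfl, ht⟩⟩
  exact mul_le_mul_of_nonneg_left (ciSup_le fun s => hc s s.2) (M.δ_nonneg t ht)

theorem δ_zero : M.δ 0 = 0 := by
  refine le_antisymm (ge_of_tendsto M.δ_lim ?_) (M.δ_nonneg 0 le_rfl)
  filter_upwards [self_mem_nhdsWithin] with t ht
  exact M.δ_mono (mem_Ici.2 le_rfl) (mem_Ici.2 (le_of_lt ht)) (le_of_lt ht)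

theorem δ_small {r : ℝ} (hr : 0 < r) : ∃ η, 0 < η ∧ ∀ s, 0 ≤ s → s ≤ η → M.δ s < r := by
  have h := M.δ_lim.eventually_lt_const hr
  obtain ⟨η, h1, h2⟩ := (h.and self_mem_nhdsWithin).exists
  exact ⟨η, h2, fun s h0 hs => (M.δ_mono h0 (le_of_lt h2) hs).trans_lt h1⟩

theorem SD_zero {f : ℝ → X} (hf : ContinuousOn f (Ici 0)) : M.SD f 0 = 0 := by
  have := M.SD_bound f hf 0 (mem_Ici.2 le_rfl)
  rw [M.δ_zero, zero_mul] at this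
  exact norm_le_zero_iff.1 this

theorem shift_cont {E : Type*} [TopologicalSpace E] {f : ℝ → E} (hf : ContinuousOn f (Ici 0))
    {t : ℝ} (ht : 0 ≤ t) :
    ContinuousOn (fun s => f (t + s)) (Ici 0) :=
  hf.comp (f := fun s => t + s) (by fun_prop) (fun s hs => add_nonneg ht hs)

theorem conv_shift {f : ℝ → X} (hf : ContinuousOn f (Ici 0)) {t k : ℝ} (ht : 0 ≤ t) (hk : 0 ≤ k) :
    M.conv f (t + k) = (M.T k (M.conv f t) + M.S k (∫ s in (0:ℝ)..t, f s))
      + M.conv (fun s => f (t + s)) k := by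
  have hI := (M.conv_cont hf (le_refl (t + k)))
  have i1 : IntervalIntegrable (fun s => M.S (t + k - s) (f s)) volume 0 t :=
    M.conv_int hf ht (by linarith)
  have i2 : IntervalIntegrable (fun s => M.S (t + k - s) (f s)) volume t (t + k) :=
    (hI.mono (Icc_subset_Icc_left ht)).intervalIntegrable_of_Icc (by linarith)
  have hfi : IntervalIntegrable f volume 0 t :=
    (hf.mono Icc_subset_Ici_self).intervalIntegrable_of_Icc ht
  have e2 : ∫ s in t..(t + k), M.S (t + k - s) (f s) = M.conv (fun s => f (t + s)) k := by
    have := intervalIntegral.integral_comp_add_left (a := 0) (b := k)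
      (fun s => M.S (t + k - s) (f s)) t
    rw [add_zero] at this
    rw [← this, conv]
    congr 1; ext s
    rw [show t + k - (t + s) = k - s by ring]
  have e1 : ∫ s in (0:ℝ)..t, M.S (t + k - s) (f s)
      = M.T k (M.conv f t) + M.S k (∫ s in (0:ℝ)..t, f s) := by
    have c1 := ContinuousLinearMap.intervalIntegral_comp_comm (M.T k) (M.conv_int hf ht le_rfl)
    have c2 := ContinuousLinearMap.intervalIntegral_comp_comm (M.S k) hfi
    rw [conv, ← c1, ← c2, ← intervalIntegral.integral_add]
    · apply intervalIntegral.integral_congr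
      intro s hs
      rw [uIcc_of_le ht] at hs
      simp only
      rw [M.TS k (t - s) hk (by linarith [hs.2])]
      rw [show t + k - s = k + (t - s) by ring]
      abel
    · exact ((M.T k).continuous.comp_continuousOn (M.conv_cont hf le_rfl)).intervalIntegrable_of_Icc
        ht
    · exact ((M.S k).continuous.comp_continuousOn
        (hf.mono Icc_subset_Ici_self)).intervalIntegrable_of_Icc ht
  rw [← e1, ← e2, intervalIntegral.integral_add_adjacent_intervals i1 i2]
  rfl

theorem deriv_shift {E : Type*} [NormedAddCommGroup E] [NormedSpace ℝ E] {φ : ℝ → E} {y : E} {t : ℝ} (ht : 0 ≤ t)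
    (h : HasDerivWithinAt φ y (Ici 0) t) : HasDerivWithinAt (fun k => φ (t + k)) y (Ici 0) 0 := by
  have h' : HasDerivWithinAt φ y (Ici 0) (t + 0) := by simpa using h
  have := h'.scomp (h := fun k => t + k) (h' := 1) (s := Ici 0) 0
    ((hasDerivAt_id (0:ℝ)).const_add t).hasDerivWithinAt (fun s hs => add_nonneg ht hs)
  simpa [Function.comp_def] using this

theorem SD_shift {f : ℝ → X} (hf : ContinuousOn f (Ici 0)) {t h : ℝ} (ht : 0 ≤ t) (hh : 0 ≤ h) :
    M.SD f (t + h) = M.T h (M.SD f t) + M.SD (fun s => f (t + s)) h := by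
  set y := ∫ s in (0:ℝ)..t, f s with hy
  have hft := shift_cont hf ht
  set H : ℝ → Y := fun k => M.T k (M.conv f t) + M.S k y with hH
  have hF : ∀ k, 0 ≤ k → M.conv f (t + k) = H k + M.conv (fun s => f (t + s)) k :=
    fun k hk => M.conv_shift hf ht hk
  have H0 : H 0 = M.conv f t := by simp [hH, M.T_zero, M.S_zero]
  have Hadd : ∀ k, 0 ≤ k → H (h + k) = H h + M.T h (H k - H 0) := by
    intro k hk
    rw [H0]
    simp only [hH, M.T_add h k hh hk, map_sub, map_add, M.TS h k hh hk,
      ContinuousLinearMap.comp_apply]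
    abel
  have d0 : HasDerivWithinAt H (M.SD f t) (Ici 0) 0 := by
    have a1 := deriv_shift ht (M.SD_deriv f hf t ht)
    have a2 := M.SD_deriv _ hft 0 (mem_Ici.2 le_rfl)
    rw [M.SD_zero hft] at a2
    have a3 := a1.sub a2
    rw [sub_zero] at a3
    refine a3.congr_of_mem ?_ (mem_Ici.2 le_rfl)
    intro k hk
    have := hF k hk
    simp only [conv] at this
    simp only [Pi.sub_apply, this, add_sub_cancel_right]
  have d1 : HasDerivWithinAt (fun k => H (h + k)) (M.T h (M.SD f t)) (Ici 0) 0 := by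
    have a1 := ((((M.T h).restrictScalars ℝ).hasFDerivAt (x := H 0 - H 0)).comp_hasDerivWithinAt
      (0:ℝ) (d0.sub_const (H 0))).const_add (H h)
    refine a1.congr_of_mem ?_ (mem_Ici.2 le_rfl)
    intro k hk
    simp [Hadd k hk]
  have d2 := deriv_shift (add_nonneg ht hh) (M.SD_deriv f hf _ (mem_Ici.2 (add_nonneg ht hh)))
  have d3 := d1.add (deriv_shift hh (M.SD_deriv _ hft h (mem_Ici.2 hh)))
  have d4 := d3.congr_of_mem (f₁ := fun k => ∫ s in (0:ℝ)..(t + h + k), M.S (t + h + k - s) (f s))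
    (by
      intro k hk
      have := hF (h + k) (add_nonneg hh hk)
      simp only [conv, ← add_assoc] at this
      simpa [add_assoc] using this) (mem_Ici.2 le_rfl)
  exact UniqueDiffWithinAt.eq_deriv _ (uniqueDiffOn_Ici (0:ℝ) 0 (mem_Ici.2 le_rfl)) d2 d4

/-- the weighted contraction estimate -/
theorem contraction (L : Y →L[ℂ] X) : ∃ lam : ℝ, 0 ≤ lam ∧ ∀ f : ℝ → Y,
    ContinuousOn f (Ici 0) → ∀ C : ℝ, 0 ≤ C → ∀ t : ℝ, 0 ≤ t →
    (∀ s ∈ Icc 0 t, ‖f s‖ ≤ C * Real.exp (lam * s)) →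
    ‖M.SD (fun s => L (f s)) t‖ ≤ C / 2 * Real.exp (lam * t) := by
  obtain ⟨η, hη, hδ⟩ := M.δ_small (r := 1 / (4 * (‖L‖ + 1))) (by positivity)
  have hδη : ∀ s, 0 ≤ s → s ≤ η → M.δ s * ‖L‖ ≤ 1 / 4 := by
    intro s h0 h1
    have h2 := (hδ s h0 h1).le
    have : 0 ≤ ‖L‖ := norm_nonneg L
    calc M.δ s * ‖L‖ ≤ 1 / (4 * (‖L‖ + 1)) * (‖L‖ + 1) := by
          gcongr
          linarith
      _ = 1 / 4 := by field_simp
  obtain ⟨lam, hlam0, hlam⟩ : ∃ lam : ℝ, 0 ≤ lam ∧ ‖M.T η‖ ≤ 1 / 2 * Real.exp (lam * η) := by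
    refine ⟨2 * ‖M.T η‖ / η, by positivity, ?_⟩
    have := Real.add_one_le_exp (2 * ‖M.T η‖ / η * η)
    have h2 : 2 * ‖M.T η‖ / η * η = 2 * ‖M.T η‖ := by field_simp
    rw [h2] at this ⊢
    linarith
  refine ⟨lam, hlam0, fun f hf C hC => ?_⟩
  have hLf : ContinuousOn (fun s => L (f s)) (Ici 0) := L.continuous.comp_continuousOn hf
  -- short intervals
  have short : ∀ a r, 0 ≤ a → 0 ≤ r → r ≤ η →
      (∀ s ∈ Icc 0 (a + r), ‖f s‖ ≤ C * Real.exp (lam * s)) →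
      ‖M.SD (fun s => L (f (a + s))) r‖ ≤ C / 4 * Real.exp (lam * (a + r)) := by
    intro a r ha hr hrη hb
    have h1 := M.SD_le (shift_cont hLf ha) hr (c := ‖L‖ * (C * Real.exp (lam * (a + r)))) (by
      intro s hs
      refine (L.le_opNorm _).trans ?_
      gcongr
      refine (hb (a + s) ⟨add_nonneg ha hs.1, by linarith [hs.2]⟩).trans ?_
      gcongr
      exact hs.2)
    refine h1.trans ?_
    have h2 := hδη r hr hrη
    have h3 : 0 ≤ C * Real.exp (lam * (a + r)) := by positivity
    nlinarith
  have key : ∀ n : ℕ, ∀ t, 0 ≤ t → t ≤ n * η →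
      (∀ s ∈ Icc 0 t, ‖f s‖ ≤ C * Real.exp (lam * s)) →
      ‖M.SD (fun s => L (f s)) t‖ ≤ C / 2 * Real.exp (lam * t) := by
    intro n
    induction n with
    | zero =>
      intro t h0 h1 _
      have : t = 0 := le_antisymm (by simpa using h1) h0
      subst this
      rw [M.SD_zero hLf, norm_zero]
      positivity
    | succ n ih =>
      intro t h0 h1 hb
      rcases le_total t η with h | h
      · have := short 0 t le_rfl h0 h (by simpa using hb)
        simp only [zero_add] at this
        refine this.trans ?_
        gcongr
        norm_num
      · have h2 := ih (t - η) (by linarith) (by push_cast at h1; linarith)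
          (fun s hs => hb s ⟨hs.1, by linarith [hs.2]⟩)
        have h3 := M.SD_shift hLf (t := t - η) (h := η) (by linarith) hη.le
        have h4 := short (t - η) η (by linarith) hη.le le_rfl (by simpa using hb)
        rw [sub_add_cancel] at h3 h4
        rw [h3]
        have h5 : Real.exp (lam * t) = Real.exp (lam * η) * Real.exp (lam * (t - η)) := by
          rw [← Real.exp_add]; ring_nf
        calc _ ≤ ‖M.T η (M.SD (fun s => L (f s)) (t - η))‖ + _ := norm_add_le _ _
          _ ≤ 1 / 2 * Real.exp (lam * η) * (C / 2 * Real.exp (lam * (t - η)))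
              + C / 4 * Real.exp (lam * t) := by
            gcongr
            exact (M.T η).le_of_opNorm_le_of_le hlam h2
          _ = _ := by rw [h5]; ring
  intro t ht hb
  obtain ⟨n, hn⟩ := exists_nat_ge (t / η)
  exact key n t ht ((div_le_iff₀ hη).1 hn) hb

set_option linter.unusedSectionVars false

theorem Bop_apply (L : Y →L[ℂ] X) {U : ℝ → (Y →L[ℂ] Y)}
    (hU : ∀ x : Y, ContinuousOn (fun t => U t x) (Ici 0)) (t : ℝ) (x : Y) :
    M.Bop L U t x = M.SD (fun s => L (U s x)) t :=
  M.SDop_apply (fun s => L.comp (U s)) (fun x => by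
    have h : ContinuousOn (fun s => L (U s x)) (Ici 0) := L.continuous.comp_continuousOn (hU x)
    exact h) t x

theorem Bop_strong (L : Y →L[ℂ] X) {U : ℝ → (Y →L[ℂ] Y)}
    (hU : ∀ x : Y, ContinuousOn (fun t => U t x) (Ici 0)) (x : Y) :
    ContinuousOn (fun t => M.Bop L U t x) (Ici 0) := by
  simp only [M.Bop_apply L hU]
  exact M.SD_cont _ (L.continuous.comp_continuousOn (hU x))

theorem Bop_normcont (L : Y →L[ℂ] X) {U : ℝ → (Y →L[ℂ] Y)}
    (hU : ∀ x : Y, ContinuousOn (fun t => U t x) (Ici 0)) (hn : ContinuousOn U (Ioi 0)) :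
    ContinuousOn (M.Bop L U) (Ioi 0) := by
  intro t₀ ht₀
  have ht₀' : 0 < t₀ := ht₀
  set b := t₀ + 1 with hb
  obtain ⟨C, hC0, hC⟩ := strong_bdd U hU b
  obtain ⟨K, hK0, hK⟩ := strong_bdd M.T M.T_cont b
  rw [Metric.continuousWithinAt_iff]
  intro r hr
  obtain ⟨ε₁, hε₁, hδ₁⟩ := M.δ_small (r := r / (8 * (K + 1) * (‖L‖ * (2 * C) + 1)))
    (by positivity)
  have small : ∀ s, 0 ≤ s → s ≤ ε₁ → K * (M.δ s * (‖L‖ * (2 * C))) ≤ r / 8 := by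
    intro s h0 h1
    have h2 := (hδ₁ s h0 h1).le
    calc K * (M.δ s * (‖L‖ * (2 * C)))
        ≤ (K + 1) * (r / (8 * (K + 1) * (‖L‖ * (2 * C) + 1)) * (‖L‖ * (2 * C) + 1)) := by
          have := M.δ_nonneg s h0
          gcongr <;> linarith
      _ = r / 8 := by field_simp
  set ε := min ε₁ (t₀ / 2) with hε
  have hε0 : 0 < ε := lt_min hε₁ (by linarith)
  have hεt : ε ≤ t₀ / 2 := min_le_right _ _
  have hδb := M.δ_nonneg b (by linarith)
  have huc : UniformContinuousOn U (Icc ε b) :=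
    isCompact_Icc.uniformContinuousOn_of_continuous
      (hn.mono fun s hs => lt_of_lt_of_le hε0 hs.1)
  rw [Metric.uniformContinuousOn_iff] at huc
  obtain ⟨ρ, hρ, hu⟩ := huc (r / (8 * (M.δ b * ‖L‖ + 1))) (by positivity)
  have key : ∀ s t, ε ≤ s → s ≤ t → t ≤ b → t - s < ρ → t - s ≤ ε →
      ‖M.Bop L U t - M.Bop L U s‖ ≤ r / 2 := by
    intro s t hs hst ht h1 h2
    apply ContinuousLinearMap.opNorm_le_bound _ (by positivity)
    intro x
    set h := t - s with hh
    have hh0 : 0 ≤ h := by linarith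
    have hs0 : 0 ≤ s := by linarith
    set f : ℝ → X := fun s => L (U s x) with hf
    have hfc : ContinuousOn f (Ici 0) := L.continuous.comp_continuousOn (hU x)
    have hfh := shift_cont hfc hh0
    set g : ℝ → X := fun s => f (h + s) - f s with hg
    have hgc : ContinuousOn g (Ici 0) := hfh.sub hfc
    have fb : ∀ s ∈ Icc 0 b, ‖f s‖ ≤ ‖L‖ * C * ‖x‖ := by
      intro s hs
      calc ‖f s‖ ≤ ‖L‖ * (‖U s‖ * ‖x‖) :=
            (L.le_opNorm _).trans (by gcongr; exact (U s).le_opNorm x)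
        _ ≤ ‖L‖ * (C * ‖x‖) := by gcongr; exact hC s hs
        _ = _ := by ring
    have e1 := M.SD_shift hfc hh0 hs0
    have e2 := M.SD_sub hfh hfc hs0
    have e3 := M.SD_shift hgc hε0.le (h := s - ε) (by linarith)
    rw [add_sub_cancel] at e3
    have e4 : M.SD f t - M.SD f s = M.T s (M.SD f h) + (M.T (s - ε) (M.SD g ε)
        + M.SD (fun s => g (ε + s)) (s - ε)) := by
      rw [← e3, hg, e2, show t = h + s by rw [hh]; ring, e1]
      abel
    have b1 : ‖M.SD f h‖ ≤ M.δ h * (‖L‖ * (2 * C)) * ‖x‖ := by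
      refine (M.SD_le hfc hh0 (c := ‖L‖ * (2 * C) * ‖x‖) fun s hs =>
        (fb s ⟨hs.1, by linarith [hs.2]⟩).trans ?_).trans (le_of_eq (by ring))
      gcongr
      linarith
    have b2 : ‖M.SD g ε‖ ≤ M.δ ε * (‖L‖ * (2 * C)) * ‖x‖ := by
      refine (M.SD_le hgc hε0.le (c := ‖L‖ * (2 * C) * ‖x‖) fun u hu => ?_).trans
        (le_of_eq (by ring))
      refine (norm_sub_le _ _).trans ?_
      have a1 := fb (h + u) ⟨add_nonneg hh0 hu.1, by linarith [hu.2]⟩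
      have a2 := fb u ⟨hu.1, by linarith [hu.2]⟩
      linarith
    have b3 : ‖M.SD (fun s => g (ε + s)) (s - ε)‖ ≤ r / 8 * ‖x‖ := by
      have a1 := M.SD_le (shift_cont hgc hε0.le) (t := s - ε) (by linarith)
        (c := ‖L‖ * (r / (8 * (M.δ b * ‖L‖ + 1))) * ‖x‖) (by
          intro u hu'
          have a2 := (hu (h + (ε + u)) ⟨by linarith [hu'.1], by linarith [hu'.2]⟩ (ε + u)
            ⟨by linarith [hu'.1], by linarith [hu'.2]⟩ (by
              rw [Real.dist_eq, add_sub_cancel_right, abs_of_nonneg hh0]; exact h1)).le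
          rw [dist_eq_norm] at a2
          simp only [hg, hf, ← map_sub]
          rw [← sub_apply, mul_assoc]
          exact (L.le_opNorm _).trans (by
            gcongr
            exact ContinuousLinearMap.le_of_opNorm_le _ a2 _))
      refine a1.trans ?_
      have a3 : M.δ (s - ε) ≤ M.δ b :=
        M.δ_mono (mem_Ici.2 (by linarith)) (mem_Ici.2 (by linarith)) (by linarith)
      calc _ ≤ M.δ b * (‖L‖ * (r / (8 * (M.δ b * ‖L‖ + 1))) * ‖x‖) := by gcongr
        _ = (M.δ b * ‖L‖) * (r / (8 * (M.δ b * ‖L‖ + 1))) * ‖x‖ := by ring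
        _ ≤ (M.δ b * ‖L‖ + 1) * (r / (8 * (M.δ b * ‖L‖ + 1))) * ‖x‖ := by
          gcongr; linarith
        _ = _ := by field_simp
    rw [sub_apply, M.Bop_apply L hU, M.Bop_apply L hU]
    change ‖M.SD f t - M.SD f s‖ ≤ _
    rw [e4]
    have c1 : ‖M.T s (M.SD f h)‖ ≤ r / 8 * ‖x‖ := by
      refine ((M.T s).le_of_opNorm_le_of_le (hK s ⟨hs0, by linarith⟩) b1).trans ?_
      rw [← mul_assoc]
      gcongr
      exact small h hh0 (h2.trans (min_le_left _ _))
    have c2 : ‖M.T (s - ε) (M.SD g ε)‖ ≤ r / 8 * ‖x‖ := by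
      refine ((M.T _).le_of_opNorm_le_of_le (hK _ ⟨by linarith, by linarith⟩) b2).trans ?_
      rw [← mul_assoc]
      gcongr
      exact small ε hε0.le (min_le_left _ _)
    have n1 := norm_add_le (M.T s (M.SD f h)) (M.T (s - ε) (M.SD g ε)
        + M.SD (fun s => g (ε + s)) (s - ε))
    have n2 := norm_add_le (M.T (s - ε) (M.SD g ε)) (M.SD (fun s => g (ε + s)) (s - ε))
    have : 0 ≤ r * ‖x‖ := by positivity
    linarith
  refine ⟨min (min ρ ε) (min (t₀ / 2) 1), by positivity, ?_⟩
  intro t _ hd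
  rw [Real.dist_eq] at hd
  obtain ⟨hd1, hd2⟩ := lt_min_iff.1 hd
  obtain ⟨hd3, hd4⟩ := lt_min_iff.1 hd1
  obtain ⟨hd5, hd6⟩ := lt_min_iff.1 hd2
  have l1 := le_abs_self (t - t₀)
  have l2 := neg_abs_le (t - t₀)
  rw [dist_eq_norm]
  refine lt_of_le_of_lt ?_ (half_lt_self hr)
  rcases le_total t₀ t with h | h
  · exact key t₀ t (by linarith) h (by linarith) (by linarith) (by linarith)
  · rw [norm_sub_rev]
    exact key t t₀ (by linarith) h (by linarith) (by linarith) (by linarith)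

/-- for a scalar function `φ`, the operator `y ↦ (S ⋄ φ y)(t)` -/
theorem exists_scalar {φ : ℝ → ℝ} (hφ : Continuous φ) {t : ℝ} (ht : 0 ≤ t) :
    ∃ Q : X →L[ℂ] Y, ∀ y, Q y = M.SD (fun s => φ s • y) t := by
  obtain ⟨c, hc⟩ := (isCompact_Icc (a := 0) (b := t)).exists_bound_of_continuousOn hφ.continuousOn
  have hcont : ∀ y : X, ContinuousOn (fun s => φ s • y) (Ici 0) := fun y => by fun_prop
  refine ⟨LinearMap.mkContinuous
    { toFun := fun y => M.SD (fun s => φ s • y) t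
      map_add' := fun y z => by
        rw [← M.SD_add (hcont y) (hcont z) ht]
        simp only [smul_add]
      map_smul' := fun a y => by
        rw [RingHom.id_apply, ← M.SD_smul (hcont y) a ht]
        congr 1
        ext s
        exact smul_comm _ _ _ } (M.δ t * c) ?_, fun y => rfl⟩
  intro y
  refine (M.SD_le (hcont y) ht (c := c * ‖y‖) ?_).trans (by rw [mul_assoc])
  intro s hs
  rw [norm_smul]
  gcongr
  exact hc s hs

theorem SD_sum {ι : Type*} (A : Finset ι) (f : ι → ℝ → X) (hf : ∀ i, ContinuousOn (f i) (Ici 0))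
    {t : ℝ} (ht : 0 ≤ t) : M.SD (fun s => ∑ i ∈ A, f i s) t = ∑ i ∈ A, M.SD (f i) t := by
  classical
  induction A using Finset.induction_on with
  | empty =>
    have := M.SD_smul (f := fun _ => 0) continuousOn_const 0 ht
    simpa using this
  | insert a A ha ih =>
    simp only [Finset.sum_insert ha]
    rw [M.SD_add (hf a) (continuousOn_finsetSum A fun i _ => hf i) ht, ih]

theorem SDop_compact {Z : ℝ → (Y →L[ℂ] X)} (hZ : ContinuousOn Z (Ici 0))
    (hc : ∀ s, 0 ≤ s → IsCompactOperator ⇑(Z s)) {c : ℝ} (hc0 : 0 < c) :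
    IsCompactOperator ⇑(M.SDop Z c) := by
  have hZs : ∀ x, ContinuousOn (fun s => Z s x) (Ici 0) := fun x =>
    hZ.clm_apply continuousOn_const
  let Zt : C(unitInterval, Y →L[ℂ] X) :=
    ⟨fun s => Z (c * s), hZ.comp_continuous (by fun_prop) (fun s => mul_nonneg hc0.le s.2.1)⟩
  let p : ℝ → unitInterval := fun s => projIcc 0 1 zero_le_one (s / c)
  have hp : Continuous p := continuous_projIcc.comp (by fun_prop)
  let A : ℕ → ℝ → (Y →L[ℂ] X) := fun n s => bernsteinApproximation n Zt (p s)
  have hA : ∀ n, Continuous (A n) := fun n => (map_continuous _).comp hp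
  have hAs : ∀ n x, ContinuousOn (fun s => A n s x) (Ici 0) := fun n x =>
    ((hA n).clm_apply continuous_const).continuousOn
  have hAc : ∀ n, IsCompactOperator ⇑(M.SDop (A n) c) := by
    intro n
    have h1 : ∀ k : Fin (n + 1), ∃ Q : X →L[ℂ] Y, ∀ y, Q y =
        M.SD (fun s => bernstein n k (p s) • y) c := fun k =>
      M.exists_scalar ((map_continuous _).comp hp) hc0.le
    choose Q hQ using h1
    have h2 : M.SDop (A n) c = ∑ k : Fin (n + 1), (Q k).comp (Zt (bernstein.z k)) := by
      ext1 x
      rw [M.SDop_apply _ (hAs n)]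
      simp only [A, bernsteinApproximation.apply, sum_apply,
        ContinuousLinearMap.comp_apply, hQ, smul_apply]
      rw [M.SD_sum Finset.univ (fun (k : Fin (n + 1)) s => bernstein n k (p s) • (Zt (bernstein.z k)) x) _ hc0.le]
      intro k
      have : Continuous fun s => bernstein n k (p s) := (map_continuous _).comp hp
      fun_prop
    rw [h2]
    have h3 : ∑ k : Fin (n + 1), (Q k).comp (Zt (bernstein.z k))
        ∈ compactOperator (RingHom.id ℂ) Y Y := by
      refine Submodule.sum_mem _ fun k _ => ?_
      exact (hc _ (mul_nonneg hc0.le (bernstein.z k).2.1)).clm_comp (Q k)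
    exact h3
  refine isCompactOperator_of_tendsto (l := atTop) (F := fun n => M.SDop (A n) c) ?_
    (Eventually.of_forall hAc)
  have hconv : Tendsto (fun n => ‖bernsteinApproximation n Zt - Zt‖) atTop (𝓝 0) := by
    have h := ContinuousMap.tendsto_iff_tendstoUniformly.1 (bernsteinApproximation_uniform Zt)
    rw [Metric.tendstoUniformly_iff] at h
    rw [Metric.tendsto_nhds]
    intro ε hε
    filter_upwards [h ε hε] with n hn
    have h0 : 0 ≤ ‖bernsteinApproximation n Zt - Zt‖ :=
      (norm_nonneg _).trans ((bernsteinApproximation n Zt - Zt).norm_coe_le_norm 0)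
    rw [dist_zero_right, Real.norm_eq_abs, abs_of_nonneg h0]
    refine (ContinuousMap.norm_lt_iff (bernsteinApproximation n Zt - Zt) hε).2 fun x => ?_
    have := hn x
    rw [dist_comm, dist_eq_norm] at this
    exact this
  rw [tendsto_iff_norm_sub_tendsto_zero]
  have h4 := hconv.const_mul (M.δ c)
  rw [mul_zero] at h4
  refine squeeze_zero (fun _ => norm_nonneg _) (fun n => ?_) h4
  have hδ := M.δ_nonneg c hc0.le
  refine ContinuousLinearMap.opNorm_le_bound _ (by positivity) fun x => ?_
  rw [sub_apply, M.SDop_apply _ hZs, M.SDop_apply _ (hAs n),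
    ← M.SD_sub (hAs n x) (hZs x) hc0.le, mul_assoc]
  refine M.SD_le ((hAs n x).sub (hZs x)) hc0.le fun s hs => ?_
  have h5 : Z s = Zt (p s) := by
    have : s / c ∈ Icc (0:ℝ) 1 := ⟨div_nonneg hs.1 hc0.le, (div_le_one hc0).2 hs.2⟩
    simp only [Zt, p, projIcc_of_mem _ this, ContinuousMap.coe_mk]
    congr 1
    field_simp
  change ‖A n s x - Z s x‖ ≤ _
  rw [← sub_apply, h5]
  exact ContinuousLinearMap.le_of_opNorm_le _
    ((bernsteinApproximation n Zt - Zt).norm_coe_le_norm (p s)) x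

theorem Bop_compact (L : Y →L[ℂ] X) {U : ℝ → (Y →L[ℂ] Y)}
    (hU : ∀ x : Y, ContinuousOn (fun t => U t x) (Ici 0)) (hn : ContinuousOn U (Ioi 0))
    (hc : ∀ t, 0 < t → IsCompactOperator ⇑(U t)) {t : ℝ} (ht : 0 < t) :
    IsCompactOperator ⇑(M.Bop L U t) := by
  obtain ⟨C, hC0, hC⟩ := strong_bdd U hU t
  obtain ⟨K, hK0, hK⟩ := strong_bdd M.T M.T_cont t
  let R : ℝ → (Y →L[ℂ] Y) := fun ε => M.SDop (fun s => L.comp (U (ε + s))) (t - ε)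
  refine isCompactOperator_of_tendsto (l := 𝓝[>] (0:ℝ)) (F := R) ?_ ?_
  · rw [tendsto_iff_norm_sub_tendsto_zero]
    have h4 := (M.δ_lim.const_mul K).mul_const (‖L‖ * C)
    rw [mul_zero, zero_mul] at h4
    refine squeeze_zero' (Eventually.of_forall fun _ => norm_nonneg _) ?_ h4
    filter_upwards [Ioo_mem_nhdsGT ht] with ε hε
    have hδ := M.δ_nonneg ε hε.1.le
    refine ContinuousLinearMap.opNorm_le_bound _ (by positivity) fun x => ?_
    have hfc : ContinuousOn (fun s => L (U s x)) (Ici 0) := L.continuous.comp_continuousOn (hU x)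
    have e3 := M.SD_shift hfc hε.1.le (h := t - ε) (by linarith [hε.2])
    rw [add_sub_cancel] at e3
    rw [sub_apply, M.Bop_apply L hU, M.SDop_apply, e3]
    · simp only [ContinuousLinearMap.comp_apply]
      rw [sub_add_cancel_right, norm_neg]
      have b1 := M.SD_le hfc hε.1.le (c := ‖L‖ * (C * ‖x‖)) fun s hs =>
        (L.le_opNorm _).trans (by
          gcongr
          exact (U s).le_of_opNorm_le (hC s ⟨hs.1, hs.2.trans hε.2.le⟩) x)
      refine ((M.T _).le_of_opNorm_le_of_le (hK _ ⟨by linarith [hε.2], by linarith [hε.1]⟩)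
        b1).trans (le_of_eq (by ring))
    · exact fun y => shift_cont (L.continuous.comp_continuousOn (hU y)) hε.1.le
  · filter_upwards [Ioo_mem_nhdsGT ht] with ε hε
    refine M.SDop_compact ?_ ?_ (by linarith [hε.2])
    · have : ContinuousOn (fun s => U (ε + s)) (Ici 0) :=
        hn.comp (f := fun s => ε + s) (by fun_prop) (fun s hs => add_pos_of_pos_of_nonneg hε.1 hs)
      exact continuousOn_const.clm_comp this
    · intro s hs
      exact (hc _ (add_pos_of_pos_of_nonneg hε.1 hs)).clm_comp L

/-- the Picard iteration -/
def iter (L : Y →L[ℂ] X) (V : ℝ → (Y →L[ℂ] Y)) : ℕ → ℝ → (Y →L[ℂ] Y)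
  | 0 => fun _ => 0
  | n + 1 => fun t => V t + M.Bop L (iter L V n) t

theorem iter_strong (L : Y →L[ℂ] X) {V : ℝ → (Y →L[ℂ] Y)}
    (hV : ∀ x : Y, ContinuousOn (fun t => V t x) (Ici 0)) (n : ℕ) :
    ∀ x : Y, ContinuousOn (fun t => M.iter L V n t x) (Ici 0) := by
  induction n with
  | zero => intro x; exact continuousOn_const
  | succ n ih => intro x; exact (hV x).add (M.Bop_strong L ih x)

theorem iter_close (L : Y →L[ℂ] X) {V W : ℝ → (Y →L[ℂ] Y)}
    (hV : ∀ x : Y, ContinuousOn (fun t => V t x) (Ici 0))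
    (hW : ∀ x : Y, ContinuousOn (fun t => W t x) (Ici 0))
    (hfix : ∀ t ∈ Ici (0:ℝ), W t = V t + M.Bop L W t) (b : ℝ) :
    ∃ C, 0 ≤ C ∧ ∀ n, ∀ t ∈ Icc 0 b, ‖M.iter L V n t - W t‖ ≤ C * (1 / 2) ^ n := by
  obtain ⟨lam, hl, hcon⟩ := M.contraction L
  obtain ⟨C, hC0, hC⟩ := strong_bdd W hW b
  have key : ∀ n, ∀ t ∈ Icc 0 b,
      ‖M.iter L V n t - W t‖ ≤ C * (1 / 2) ^ n * Real.exp (lam * t) := by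
    intro n
    induction n with
    | zero =>
      intro t ht
      have h1 : 1 ≤ Real.exp (lam * t) := Real.one_le_exp (mul_nonneg hl ht.1)
      simp only [iter, zero_sub, norm_neg, pow_zero, mul_one]
      exact (hC t ht).trans (le_mul_of_one_le_right hC0 h1)
    | succ n ih =>
      intro t ht
      refine ContinuousLinearMap.opNorm_le_bound _ (by positivity) fun x => ?_
      have hit := M.iter_strong L hV n
      have c1 : ContinuousOn (fun s => L (M.iter L V n s x)) (Ici 0) :=
        L.continuous.comp_continuousOn (hit x)
      have c2 : ContinuousOn (fun s => L (W s x)) (Ici 0) := L.continuous.comp_continuousOn (hW x)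
      have e : (M.iter L V (n + 1) t - W t) x
          = M.SD (fun s => L (M.iter L V n s x - W s x)) t := by
        rw [hfix t ht.1]
        simp only [iter, map_sub]
        rw [M.SD_sub c1 c2 ht.1, ← M.Bop_apply L hit, ← M.Bop_apply L hW]
        simp
      rw [e]
      have := hcon (fun s => M.iter L V n s x - W s x) ((hit x).sub (hW x))
        (C * (1 / 2) ^ n * ‖x‖) (by positivity) t ht.1 (by
          intro s hs
          rw [← sub_apply]
          refine (ContinuousLinearMap.le_of_opNorm_le _
            (ih s ⟨hs.1, hs.2.trans ht.2⟩) x).trans (le_of_eq (by ring)))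
      refine this.trans (le_of_eq ?_)
      rw [pow_succ]
      ring
  refine ⟨C * Real.exp (lam * b), by positivity, fun n t ht => (key n t ht).trans ?_⟩
  calc C * (1 / 2) ^ n * Real.exp (lam * t) ≤ C * (1 / 2) ^ n * Real.exp (lam * b) := by
        gcongr
        exact ht.2
    _ = _ := by ring

theorem tendsto_geom (C : ℝ) : Tendsto (fun n : ℕ => C * (1 / 2 : ℝ) ^ n) atTop (𝓝 0) := by
  simpa using (tendsto_pow_atTop_nhds_zero_of_lt_one (r := (1 / 2 : ℝ)) (by norm_num)
    (by norm_num)).const_mul C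

theorem partA (L : Y →L[ℂ] X) {V W : ℝ → (Y →L[ℂ] Y)}
    (hV : ∀ x : Y, ContinuousOn (fun t => V t x) (Ici 0))
    (hW : ∀ x : Y, ContinuousOn (fun t => W t x) (Ici 0))
    (hfix : ∀ t ∈ Ici (0:ℝ), W t = V t + M.Bop L W t)
    (hVn : ContinuousOn V (Ioi 0)) : ContinuousOn W (Ioi 0) ∧
      ∀ n, ContinuousOn (M.iter L V n) (Ioi 0) := by
  have hit : ∀ n, ContinuousOn (M.iter L V n) (Ioi 0) := by
    intro n
    induction n with
    | zero => exact continuousOn_const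
    | succ n ih => exact hVn.add (M.Bop_normcont L (M.iter_strong L hV n) ih)
  refine ⟨?_, hit⟩
  have hl : TendstoLocallyUniformlyOn (M.iter L V) W atTop (Ioi 0) := by
    rw [Metric.tendstoLocallyUniformlyOn_iff]
    intro ε hε t ht
    obtain ⟨C, hC0, hC⟩ := M.iter_close L hV hW hfix (t + 1)
    refine ⟨Ioo 0 (t + 1), mem_nhdsWithin_of_mem_nhds
      (Ioo_mem_nhds ht (by linarith)), ?_⟩
    filter_upwards [(tendsto_geom C).eventually_lt_const hε] with n hn s hs
    rw [dist_comm, dist_eq_norm]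
    exact (hC n s ⟨hs.1.le, hs.2.le⟩).trans_lt hn
  exact hl.continuousOn (Frequently.of_forall hit)

theorem partB (L : Y →L[ℂ] X) {V W : ℝ → (Y →L[ℂ] Y)}
    (hV : ∀ x : Y, ContinuousOn (fun t => V t x) (Ici 0))
    (hW : ∀ x : Y, ContinuousOn (fun t => W t x) (Ici 0))
    (hfix : ∀ t ∈ Ici (0:ℝ), W t = V t + M.Bop L W t)
    (hVn : ContinuousOn V (Ioi 0)) (hVc : ∀ t : ℝ, 0 < t → IsCompactOperator ⇑(V t)) :
    ∀ t : ℝ, 0 < t → IsCompactOperator ⇑(W t) := by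
  have hit : ∀ n, ∀ t, 0 < t → IsCompactOperator ⇑(M.iter L V n t) := by
    intro n
    induction n with
    | zero => intro t _; exact isCompactOperator_zero
    | succ n ih =>
      intro t ht
      exact (hVc t ht).add (M.Bop_compact L (M.iter_strong L hV n)
        ((M.partA L hV hW hfix hVn).2 n) ih ht)
  intro t ht
  obtain ⟨C, hC0, hC⟩ := M.iter_close L hV hW hfix t
  refine isCompactOperator_of_tendsto (l := atTop) (F := fun n => M.iter L V n t) ?_
    (Eventually.of_forall fun n => hit n t ht)
  rw [tendsto_iff_norm_sub_tendsto_zero]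
  exact squeeze_zero (fun _ => norm_nonneg _) (fun n => hC n t ⟨ht.le, le_rfl⟩) (tendsto_geom C)

/-- right derivative of `S ⋄ f` for `f` a primitive -/
theorem SD_rderiv {z : ℝ → X} (hz : Continuous z) {t : ℝ} (ht : 0 ≤ t) :
    HasDerivWithinAt (M.SD (fun t => ∫ s in (0:ℝ)..t, z s)) (M.SD z t) (Ioi t) t := by
  set f : ℝ → X := fun t => ∫ s in (0:ℝ)..t, z s with hf
  have hii : ∀ a b, IntervalIntegrable z volume a b := fun a b => hz.intervalIntegrable a b
  have hfc : Continuous f := intervalIntegral.continuous_primitive hii 0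
  obtain ⟨C, hC⟩ := (isCompact_Icc (a := 0) (b := (1:ℝ))).exists_bound_of_continuousOn
    hz.continuousOn
  have hC0 : 0 ≤ C := (norm_nonneg _).trans (hC 0 (by simp))
  have huc : UniformContinuousOn z (Icc 0 (t + 1)) :=
    isCompact_Icc.uniformContinuousOn_of_continuous hz.continuousOn
  rw [Metric.uniformContinuousOn_iff] at huc
  rw [hasDerivWithinAt_iff_isLittleO, Asymptotics.isLittleO_iff]
  intro r hr
  have hδt := M.δ_nonneg t ht
  obtain ⟨η, hη, hδ⟩ := M.δ_small (r := r / (2 * ((‖M.T t‖ + 1) * (C + 1)))) (by positivity)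
  obtain ⟨ρ, hρ, hu⟩ := huc (r / (2 * (M.δ t + 1))) (by positivity)
  have hpos : 0 < min (min η ρ) 1 := by positivity
  filter_upwards [Ioo_mem_nhdsGT (show t < t + min (min η ρ) 1 by linarith)] with t' ht'
  obtain ⟨h, rfl⟩ : ∃ h, t' = h + t := ⟨t' - t, by ring⟩
  have hh : 0 < h := by linarith [ht'.1]
  have hlt : h < min (min η ρ) 1 := by linarith [ht'.2]
  obtain ⟨hlt1, h1⟩ := lt_min_iff.1 hlt
  obtain ⟨hη', hρ'⟩ := lt_min_iff.1 hlt1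
  have fsub : ∀ a b, f b - f a = ∫ s in a..b, z s := fun a b =>
    intervalIntegral.integral_interval_sub_left (hii _ _) (hii _ _)
  have hfh := shift_cont hfc.continuousOn hh.le
  have hsm : ContinuousOn (fun s => (h : ℂ) • z s) (Ici 0) := by fun_prop
  have e1 := M.SD_shift hfc.continuousOn hh.le ht
  have e2 := M.SD_sub hfh hfc.continuousOn ht
  have e3 := M.SD_sub (f := fun s => f (h + s) - f s) (g := fun s => (h : ℂ) • z s) (hfh.sub hfc.continuousOn) hsm ht
  have e4 := M.SD_smul hz.continuousOn (h : ℂ) ht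
  have e5 : M.SD f (h + t) - M.SD f t - (h + t - t) • M.SD z t
      = M.T t (M.SD f h) + M.SD (fun s => f (h + s) - f s - (h : ℂ) • z s) t := by
    rw [e3, e2, e4, e1, add_sub_cancel_right, Complex.coe_smul]
    abel
  rw [e5, add_sub_cancel_right, Real.norm_eq_abs, abs_of_pos hh]
  have b1 : ‖M.SD f h‖ ≤ M.δ h * (C * h) := M.SD_le hfc.continuousOn hh.le fun s hs => by
    have : ‖f s‖ ≤ C * |s - 0| := intervalIntegral.norm_integral_le_of_norm_le_const (by
      intro u hu
      rw [uIoc_of_le hs.1] at hu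
      exact hC u ⟨hu.1.le, by linarith [hu.2, hs.2]⟩)
    refine this.trans ?_
    rw [sub_zero, abs_of_nonneg hs.1]
    gcongr
    exact hs.2
  have b2 : ‖M.SD (fun s => f (h + s) - f s - (h : ℂ) • z s) t‖
      ≤ M.δ t * (r / (2 * (M.δ t + 1)) * h) :=
    M.SD_le ((hfh.sub hfc.continuousOn).sub hsm) ht fun s hs => by
      have a1 : f (h + s) - f s - (h : ℂ) • z s = ∫ u in s..(h + s), (z u - z s) := by
        rw [intervalIntegral.integral_sub (hii _ _) (by simp), ← fsub,
          intervalIntegral.integral_const, add_sub_cancel_right, Complex.coe_smul]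
      change ‖f (h + s) - f s - (h : ℂ) • z s‖ ≤ _
      rw [a1]
      have a2 : ‖∫ u in s..(h + s), (z u - z s)‖ ≤ r / (2 * (M.δ t + 1)) * |h + s - s| :=
        intervalIntegral.norm_integral_le_of_norm_le_const (by
          intro u hu'
          rw [uIoc_of_le (by linarith)] at hu'
          have := hu u ⟨by linarith [hs.1, hu'.1], by linarith [hs.2, hu'.2]⟩ s
            ⟨hs.1, by linarith [hs.2]⟩ (by
              rw [Real.dist_eq, abs_of_nonneg (by linarith [hu'.1])]; linarith [hu'.2])
          rw [dist_eq_norm] at this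
          exact this.le)
      rwa [add_sub_cancel_right, abs_of_pos hh] at a2
  have c1 : ‖M.T t (M.SD f h)‖ ≤ r / 2 * h := by
    have hd := (hδ h hh.le hη'.le).le
    have hd0 := M.δ_nonneg h hh.le
    calc _ ≤ ‖M.T t‖ * (M.δ h * (C * h)) := (M.T t).le_of_opNorm_le_of_le le_rfl b1
      _ ≤ (‖M.T t‖ + 1) * (r / (2 * ((‖M.T t‖ + 1) * (C + 1))) * ((C + 1) * h)) := by
        gcongr <;> linarith
      _ = _ := by field_simp
  have c2 : M.δ t * (r / (2 * (M.δ t + 1)) * h) ≤ r / 2 * h := by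
    calc _ ≤ (M.δ t + 1) * (r / (2 * (M.δ t + 1)) * h) := by gcongr; linarith
      _ = _ := by field_simp
  have := norm_add_le (M.T t (M.SD f h)) (M.SD (fun s => f (h + s) - f s - (h : ℂ) • z s) t)
  linarith

theorem SD_primitive {z : ℝ → X} (hz : Continuous z) {t : ℝ} (ht : 0 ≤ t) :
    ∫ s in (0:ℝ)..t, M.SD z s = M.SD (fun t => ∫ s in (0:ℝ)..t, z s) t := by
  have hfc : Continuous (fun t => ∫ s in (0:ℝ)..t, z s) :=
    intervalIntegral.continuous_primitive (fun a b => hz.intervalIntegrable a b) 0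
  rw [intervalIntegral.integral_eq_sub_of_hasDeriv_right_of_le ht
    ((M.SD_cont _ hfc.continuousOn).mono Icc_subset_Ici_self)
    (fun x hx => M.SD_rderiv hz hx.1.le)
    (((M.SD_cont _ hz.continuousOn).mono Icc_subset_Ici_self).intervalIntegrable_of_Icc ht),
    M.SD_zero hfc.continuousOn, sub_zero]

/-- iteration for the derivative -/
def ziter (L : Y →L[ℂ] X) (g : ℝ → Y) : ℕ → ℝ → Y
  | 0 => fun _ => 0
  | n + 1 => fun t => g (max t 0) + M.SD (fun s => L (ziter L g n s)) (max t 0)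

theorem ext_cont {E : Type*} [TopologicalSpace E] {f : ℝ → E} (hf : ContinuousOn f (Ici 0)) :
    Continuous (fun t => f (max t 0)) :=
  hf.comp_continuous (by fun_prop) (fun t => mem_Ici.2 (le_max_right _ _))

theorem ziter_cont (L : Y →L[ℂ] X) {g : ℝ → Y} (hg : ContinuousOn g (Ici 0)) (n : ℕ) :
    Continuous (M.ziter L g n) := by
  induction n with
  | zero => exact continuous_const
  | succ n ih => exact (ext_cont hg).add (ext_cont (M.SD_cont _ (L.continuous.comp ih).continuousOn))

theorem ziter_max (L : Y →L[ℂ] X) (g : ℝ → Y) (n : ℕ) (t : ℝ) :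
    M.ziter L g n (max t 0) = M.ziter L g n t := by
  cases n with
  | zero => rfl
  | succ n => simp [ziter]

theorem partC (L : Y →L[ℂ] X) {v w g : ℝ → Y} (hw : ContinuousOn w (Ici 0))
    (hg : ContinuousOn g (Ici 0)) (hv : ∀ t ∈ Ici (0:ℝ), HasDerivWithinAt v (g t) (Ici 0) t)
    (hv0 : v 0 = 0) (hfix : ∀ t, 0 ≤ t → w t = v t + M.SD (fun s => L (w s)) t) :
    ∃ z : ℝ → Y, Continuous z ∧ ∀ t ∈ Ici (0:ℝ), HasDerivWithinAt w (z t) (Ici 0) t := by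
  obtain ⟨lam, hl, hcon⟩ := M.contraction L
  set zn := M.ziter L g with hzn
  have hzc : ∀ n, Continuous (zn n) := M.ziter_cont L hg
  have hLz : ∀ n, Continuous (fun s => L (zn n s)) := fun n => L.continuous.comp (hzc n)
  set wn : ℕ → ℝ → Y := fun n t => ∫ s in (0:ℝ)..t, zn n s with hwn
  have hwc : ∀ n, Continuous (wn n) := fun n =>
    intervalIntegral.continuous_primitive (fun a b => (hzc n).intervalIntegrable a b) 0
  have hrec : ∀ n t, 0 ≤ t → wn (n + 1) t = v t + M.SD (fun s => L (wn n s)) t := by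
    intro n t ht
    have e1 : wn (n + 1) t = ∫ s in (0:ℝ)..t, (g s + M.SD (fun s => L (zn n s)) s) := by
      apply intervalIntegral.integral_congr
      intro s hs
      rw [uIcc_of_le ht] at hs
      simp only [hzn, ziter, max_eq_left hs.1]
    have hgi : IntervalIntegrable g volume 0 t :=
      (hg.mono Icc_subset_Ici_self).intervalIntegrable_of_Icc ht
    rw [e1, intervalIntegral.integral_add hgi
      (((M.SD_cont _ (hLz n).continuousOn).mono Icc_subset_Ici_self).intervalIntegrable_of_Icc ht),
      M.SD_primitive (hLz n) ht]
    congr 1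
    · rw [intervalIntegral.integral_eq_sub_of_hasDeriv_right_of_le ht (f := v) _ _ hgi, hv0,
        sub_zero]
      · exact fun s hs => ((hv s hs.1).continuousWithinAt).mono Icc_subset_Ici_self
      · exact fun s hs => (hv s hs.1.le).mono fun u hu => hs.1.le.trans (le_of_lt hu)
    · congr 1
      ext s
      exact ContinuousLinearMap.intervalIntegral_comp_comm L ((hzc n).intervalIntegrable 0 s)
  -- convergence of `wn`
  have wclose : ∀ b, ∃ C, ∀ n, ∀ t ∈ Icc 0 b, ‖wn n t - w t‖ ≤ C * (1 / 2) ^ n := by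
    intro b
    obtain ⟨C, hC⟩ := (isCompact_Icc (a := 0) (b := b)).exists_bound_of_continuousOn
      (hw.mono Icc_subset_Ici_self)
    have hC' : ∀ t ∈ Icc 0 b, ‖w t‖ ≤ max C 0 := fun t ht => (hC t ht).trans (le_max_left _ _)
    have hC0 : 0 ≤ max C 0 := le_max_right _ _
    generalize max C 0 = D at hC' hC0
    have key : ∀ n, ∀ t ∈ Icc 0 b, ‖wn n t - w t‖ ≤ D * (1 / 2) ^ n * Real.exp (lam * t) := by
      intro n
      induction n with
      | zero =>
        intro t ht
        have h1 : 1 ≤ Real.exp (lam * t) := Real.one_le_exp (mul_nonneg hl ht.1)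
        simp only [hwn, hzn, ziter, intervalIntegral.integral_zero, zero_sub, norm_neg, pow_zero,
          mul_one]
        exact (hC' t ht).trans (le_mul_of_one_le_right hC0 h1)
      | succ n ih =>
        intro t ht
        have c1 : ContinuousOn (fun s => L (wn n s)) (Ici 0) :=
          (L.continuous.comp (hwc n)).continuousOn
        have c2 : ContinuousOn (fun s => L (w s)) (Ici 0) := L.continuous.comp_continuousOn hw
        have e : wn (n + 1) t - w t = M.SD (fun s => L (wn n s - w s)) t := by
          simp only [map_sub]
          rw [hrec n t ht.1, hfix t ht.1, M.SD_sub c1 c2 ht.1, add_sub_add_left_eq_sub]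
        rw [e]
        refine (hcon (fun s => wn n s - w s) ((hwc n).continuousOn.sub hw) (D * (1 / 2) ^ n)
          (by positivity) t ht.1 (fun s hs => ih s ⟨hs.1, hs.2.trans ht.2⟩)).trans (le_of_eq ?_)
        rw [pow_succ]
        ring
    refine ⟨D * Real.exp (lam * b), fun n t ht => (key n t ht).trans ?_⟩
    calc D * (1 / 2) ^ n * Real.exp (lam * t) ≤ D * (1 / 2) ^ n * Real.exp (lam * b) := by
          gcongr
          exact ht.2
      _ = _ := by ring
  -- `zn` is Cauchy
  have zclose : ∀ b, ∃ C, ∀ n, ∀ t ≤ b, dist (zn n t) (zn (n + 1) t) ≤ C * (1 / 2) ^ n := by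
    intro b
    obtain ⟨C, hC⟩ := (isCompact_Icc (a := 0) (b := max b 0)).exists_bound_of_continuousOn
      (hzc 1).continuousOn
    have hC' : ∀ t ∈ Icc 0 (max b 0), ‖zn 1 t‖ ≤ max C 0 :=
      fun t ht => (hC t ht).trans (le_max_left _ _)
    have hC0 : 0 ≤ max C 0 := le_max_right _ _
    generalize max C 0 = D at hC' hC0
    have key : ∀ n, ∀ t ∈ Icc 0 (max b 0), ‖zn (n + 1) t - zn n t‖
        ≤ D * (1 / 2) ^ n * Real.exp (lam * t) := by
      intro n
      induction n with
      | zero =>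
        intro t ht
        have h1 : 1 ≤ Real.exp (lam * t) := Real.one_le_exp (mul_nonneg hl ht.1)
        have h0 : zn 0 t = 0 := rfl
        rw [h0, sub_zero, pow_zero, mul_one]
        exact (hC' t ht).trans (le_mul_of_one_le_right hC0 h1)
      | succ n ih =>
        intro t ht
        have e : zn (n + 1 + 1) t - zn (n + 1) t
            = M.SD (fun s => L (zn (n + 1) s - zn n s)) t := by
          simp only [map_sub]
          rw [M.SD_sub (hLz _).continuousOn (hLz _).continuousOn ht.1]
          change (g (max t 0) + M.SD (fun s => L (zn (n + 1) s)) (max t 0))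
            - (g (max t 0) + M.SD (fun s => L (zn n s)) (max t 0)) = _
          rw [max_eq_left ht.1, add_sub_add_left_eq_sub]
        rw [e]
        refine (hcon (fun s => zn (n + 1) s - zn n s) ((hzc _).sub (hzc _)).continuousOn
          (D * (1 / 2) ^ n)
          (by positivity) t ht.1 (fun s hs => ih s ⟨hs.1, hs.2.trans ht.2⟩)).trans (le_of_eq ?_)
        rw [pow_succ]
        ring
    refine ⟨D * Real.exp (lam * max b 0), fun n t ht => ?_⟩
    have hm : max t 0 ∈ Icc 0 (max b 0) := ⟨le_max_right _ _, max_le_max_right _ ht⟩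
    rw [dist_comm, dist_eq_norm, hzn, ← M.ziter_max L g n t, ← M.ziter_max L g (n + 1) t]
    refine (key n _ hm).trans ?_
    calc _ ≤ D * (1 / 2) ^ n * Real.exp (lam * max b 0) := by
          gcongr
      _ = _ := by ring
  have hlim : ∀ t, ∃ y, Tendsto (fun n => zn n t) atTop (𝓝 y) := by
    intro t
    obtain ⟨C, hC⟩ := zclose t
    exact cauchySeq_tendsto_of_complete
      (cauchySeq_of_le_geometric (1 / 2) C (by norm_num) fun n => hC n t le_rfl)
  choose z hz using hlim
  have zunif : ∀ b, ∃ C, ∀ n, ∀ t ≤ b, dist (zn n t) (z t) ≤ C * (1 / 2) ^ n := by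
    intro b
    obtain ⟨C, hC⟩ := zclose b
    refine ⟨C * 2, fun n t ht => ?_⟩
    refine (dist_le_of_le_geometric_of_tendsto (1 / 2) C (by norm_num) (fun n => hC n t ht)
      (hz t) n).trans (le_of_eq ?_)
    ring
  have hzcont : Continuous z := by
    have hlu : TendstoLocallyUniformly zn z atTop := by
      rw [Metric.tendstoLocallyUniformly_iff]
      intro ε hε t
      obtain ⟨C, hC⟩ := zunif (t + 1)
      refine ⟨Iio (t + 1), Iio_mem_nhds (by linarith), ?_⟩
      filter_upwards [(tendsto_geom C).eventually_lt_const hε] with n hn s hs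
      rw [dist_comm]
      exact (hC n s (le_of_lt hs)).trans_lt hn
    exact hlu.continuous (Frequently.of_forall hzc)
  have hwz : ∀ t, 0 ≤ t → w t = ∫ s in (0:ℝ)..t, z s := by
    intro t ht
    obtain ⟨C, hC⟩ := wclose t
    obtain ⟨D, hD⟩ := zunif t
    have l1 : Tendsto (fun n => wn n t) atTop (𝓝 (w t)) := by
      rw [tendsto_iff_norm_sub_tendsto_zero]
      exact squeeze_zero (fun _ => norm_nonneg _) (fun n => hC n t ⟨ht, le_rfl⟩) (tendsto_geom C)
    have l2 : Tendsto (fun n => wn n t) atTop (𝓝 (∫ s in (0:ℝ)..t, z s)) := by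
      rw [tendsto_iff_norm_sub_tendsto_zero]
      refine squeeze_zero (fun _ => norm_nonneg _) (fun n => ?_) (tendsto_geom (D * t))
      rw [hwn, ← intervalIntegral.integral_sub ((hzc n).intervalIntegrable _ _)
        (hzcont.intervalIntegrable _ _)]
      have : ‖∫ s in (0:ℝ)..t, (zn n s - z s)‖ ≤ D * (1 / 2) ^ n * |t - 0| :=
        intervalIntegral.norm_integral_le_of_norm_le_const (by
          intro u hu
          rw [uIoc_of_le ht] at hu
          rw [← dist_eq_norm]
          exact hD n u hu.2)
      rw [sub_zero, abs_of_nonneg ht] at this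
      refine this.trans (le_of_eq (by ring))
    exact tendsto_nhds_unique l1 l2
  refine ⟨z, hzcont, fun t ht => ?_⟩
  have hd : HasDerivAt (fun t => ∫ s in (0:ℝ)..t, z s) (z t) t :=
    intervalIntegral.integral_hasDerivAt_right (hzcont.intervalIntegrable _ _)
      (hzcont.stronglyMeasurableAtFilter _ _) hzcont.continuousAt
  exact hd.hasDerivWithinAt.congr_of_mem (fun s hs => hwz s hs) ht

end GMR
/-- the solution of `W = V + B(W)` inherits the regularity of `V`. -/
theorem fixed_point_regularity (M : MRSetting X X₀) (L : X₀ →L[ℂ] X)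
    (V W : ℝ → (X₀ →L[ℂ] X₀))
    (hV : ∀ x : X₀, ContinuousOn (fun t => V t x) (Ici 0))
    (hW : ∀ x : X₀, ContinuousOn (fun t => W t x) (Ici 0))
    (hfix : ∀ t ∈ Ici (0:ℝ), W t = V t + M.Bop L W t) :
    (ContinuousOn V (Ioi 0) → ContinuousOn W (Ioi 0)) ∧
    (ContinuousOn V (Ioi 0) → (∀ t : ℝ, 0 < t → IsCompactOperator ⇑(V t)) →
      ContinuousOn W (Ioi 0) ∧ ∀ t : ℝ, 0 < t → IsCompactOperator ⇑(W t)) ∧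
    (V 0 = 0 → StronglyC1On V (Ici 0) → StronglyC1On W (Ici 0)) := by
  have hc : CompleteSpace X₀ := M.closed.completeSpace_coe
  refine ⟨fun hVn => (M.toGMR.partA L hV hW hfix hVn).1,
    fun hVn hVc => ⟨(M.toGMR.partA L hV hW hfix hVn).1, M.toGMR.partB L hV hW hfix hVn hVc⟩, ?_⟩
  intro hV0 hVd x
  obtain ⟨g, hg, hgd⟩ := hVd x
  have h1 : ∀ t, 0 ≤ t → W t x = V t x + M.toGMR.SD (fun s => L (W s x)) t := by
    intro t ht
    have h2 := M.toGMR.Bop_apply L hW t x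
    rw [← h2]
    exact congrArg (fun A : X₀ →L[ℂ] X₀ => A x) (hfix t ht)
  obtain ⟨z, hz, hd⟩ := M.toGMR.partC L (v := fun t => V t x) (w := fun t => W t x) (hW x) hg hgd
    (by simp [hV0]) h1
  exact ⟨z, hz.continuousOn, hd⟩

end
end

section
/- Let n ≥ 0 and let P denote one of the properties 'norm continuous on (0,∞)' or 'compact on (0,∞)'; if n ≥ 1, P may also denote 'strongly continuously differentiable on [0,∞)'. Then the following are equivalent: (a) Sₙ has property P; (b) Sₖ has property P for every k ≥ n; (c) Rₙ has property P; (d) Rₖ has property P for every k ≥ n. -/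
open Set Filter MeasureTheory
open scoped Topology

noncomputable section

variable {X : Type*} [NormedAddCommGroup X] [NormedSpace ℂ X] [CompleteSpace X]
  {X₀ : Submodule ℂ X}

section helpers

theorem aux_bound {E F : Type*} [NormedAddCommGroup E] [NormedSpace ℂ E] [CompleteSpace E]
    [NormedAddCommGroup F] [NormedSpace ℂ F] {W : ℝ → (E →L[ℂ] F)}
    (hW : ∀ x, ContinuousOn (fun t => W t x) (Ici 0)) (b : ℝ) :
    ∃ C : ℝ, 0 ≤ C ∧ ∀ t ∈ Icc 0 b, ‖W t‖ ≤ C := by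
  obtain ⟨C, hC⟩ := banach_steinhaus (g := fun t : Icc (0:ℝ) b => W t) (by
    intro x
    obtain ⟨C, hC⟩ := (isCompact_Icc (a := (0:ℝ)) (b := b)).exists_bound_of_continuousOn
      ((hW x).mono Icc_subset_Ici_self)
    exact ⟨C, fun i => hC i i.2⟩)
  exact ⟨max C 0, le_max_right _ _, fun t ht => (hC ⟨t, ht⟩).trans (le_max_left _ _)⟩

theorem aux_joint {E F : Type*} [NormedAddCommGroup E] [NormedSpace ℂ E] [CompleteSpace E]
    [NormedAddCommGroup F] [NormedSpace ℂ F] {W : ℝ → (E →L[ℂ] F)}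
    (hW : ∀ x, ContinuousOn (fun t => W t x) (Ici 0)) {Y : Type*} [TopologicalSpace Y]
    {s : Set Y} {u : Y → ℝ} {f : Y → E} (hu : ContinuousOn u s) (hu0 : ∀ y ∈ s, 0 ≤ u y)
    (hf : ContinuousOn f s) : ContinuousOn (fun y => W (u y) (f y)) s := by
  intro y hy
  obtain ⟨C, hC0, hC⟩ := aux_bound hW (u y + 1)
  have h1 : Tendsto (fun z => W (u z) (f y)) (𝓝[s] y) (𝓝 (W (u y) (f y))) := by
    have := (hW (f y)) (u y) (hu0 y hy)
    exact this.tendsto.comp (tendsto_nhdsWithin_iff.2 ⟨hu y hy,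
      eventually_mem_nhdsWithin.mono fun z hz => hu0 z hz⟩)
  have h2 : Tendsto (fun z => W (u z) (f z - f y)) (𝓝[s] y) (𝓝 0) := by
    have h3 : Tendsto (fun z => C * ‖f z - f y‖) (𝓝[s] y) (𝓝 0) := by
      have : Tendsto (fun z => C * ‖f z - f y‖) (𝓝[s] y) (𝓝 (C * ‖f y - f y‖)) :=
        (((hf y hy).tendsto.sub_const (f y)).norm).const_mul C
      simpa using this
    refine squeeze_zero_norm' ?_ h3
    have h4 : ∀ᶠ z in 𝓝[s] y, u z < u y + 1 :=
      (hu y hy).tendsto.eventually (gt_mem_nhds (by linarith))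
    filter_upwards [h4, eventually_mem_nhdsWithin] with z hz hzs
    exact (W (u z)).le_of_opNorm_le (hC _ ⟨hu0 z hzs, hz.le⟩) _
  have := h1.add h2
  simp only [map_sub, add_sub_cancel, add_zero] at this
  exact this

end helpers

namespace MRSetting

section basics

variable (M : MRSetting X X₀)

theorem complete (M : MRSetting X X₀) : CompleteSpace X₀ := M.closed.completeSpace_coe

theorem δ_zero : M.δ 0 = 0 := by
  refine le_antisymm ?_ (M.δ_nonneg 0 le_rfl)
  refine ge_of_tendsto M.δ_lim ?_
  filter_upwards [eventually_mem_nhdsWithin] with t ht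
  exact M.δ_mono (by simp) (le_of_lt ht : (0:ℝ) ≤ t) (le_of_lt ht)

theorem SD_le {f : ℝ → X} (hf : ContinuousOn f (Ici 0)) {t C : ℝ} (ht : 0 ≤ t)
    (hC : ∀ s ∈ Icc 0 t, ‖f s‖ ≤ C) : ‖M.SD f t‖ ≤ M.δ t * C := by
  refine (M.SD_bound f hf t ht).trans (mul_le_mul_of_nonneg_left ?_ (M.δ_nonneg t ht))
  have : Nonempty (Icc (0:ℝ) t) := ⟨⟨0, by simp [ht]⟩⟩
  exact ciSup_le fun s => hC s s.2

theorem SD_zero_time {f : ℝ → X} (hf : ContinuousOn f (Ici 0)) : M.SD f 0 = 0 := by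
  have := M.SD_bound f hf 0 (by simp)
  rw [M.δ_zero, zero_mul] at this
  exact norm_le_zero_iff.1 this

theorem integrand_cont {f : ℝ → X} (hf : ContinuousOn f (Ici 0)) (t : ℝ) :
    ContinuousOn (fun s => M.S (t - s) (f s)) (Icc 0 t) :=
  aux_joint M.S_cont (by fun_prop) (fun y hy => by linarith [hy.2])
    (hf.mono Icc_subset_Ici_self)

theorem integrand_ii {f : ℝ → X} (hf : ContinuousOn f (Ici 0)) {t a b : ℝ} (ha : a ∈ Icc 0 t)
    (hb : b ∈ Icc 0 t) : IntervalIntegrable (fun s => M.S (t - s) (f s)) volume a b :=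
  ((M.integrand_cont hf t).mono (ordConnected_Icc.uIcc_subset ha hb)).intervalIntegrable

theorem SD_unique {f : ℝ → X} (hf : ContinuousOn f (Ici 0)) {t : ℝ} (ht : 0 ≤ t) {v : X₀}
    (h : HasDerivWithinAt (fun τ : ℝ => ∫ s in (0:ℝ)..τ, M.S (τ - s) (f s)) v (Ici 0) t) :
    M.SD f t = v :=
  (uniqueDiffOn_Ici (0:ℝ) t ht).eq_deriv _ (M.SD_deriv f hf t ht) h

theorem SD_add {f g : ℝ → X} (hf : ContinuousOn f (Ici 0)) (hg : ContinuousOn g (Ici 0))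
    {t : ℝ} (ht : 0 ≤ t) : M.SD (fun s => f s + g s) t = M.SD f t + M.SD g t := by
  refine M.SD_unique (hf.add hg) ht ?_
  refine ((M.SD_deriv f hf t ht).add (M.SD_deriv g hg t ht)).congr_of_mem ?_ ht
  intro τ hτ
  simp only [map_add, Pi.add_apply]
  exact intervalIntegral.integral_add (M.integrand_ii hf ⟨le_rfl, hτ⟩ ⟨hτ, le_rfl⟩)
    (M.integrand_ii hg ⟨le_rfl, hτ⟩ ⟨hτ, le_rfl⟩)

theorem SD_smul {f : ℝ → X} (hf : ContinuousOn f (Ici 0)) (c : ℂ)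
    {t : ℝ} (ht : 0 ≤ t) : M.SD (fun s => c • f s) t = c • M.SD f t := by
  refine M.SD_unique (hf.const_smul c) ht ?_
  refine ((M.SD_deriv f hf t ht).const_smul c).congr_of_mem ?_ ht
  intro τ hτ
  simp only [map_smul, Pi.smul_apply]
  exact intervalIntegral.integral_smul _ _

theorem SD_sub {f g : ℝ → X} (hf : ContinuousOn f (Ici 0)) (hg : ContinuousOn g (Ici 0))
    {t : ℝ} (ht : 0 ≤ t) : M.SD (fun s => f s - g s) t = M.SD f t - M.SD g t := by
  have := M.SD_add (hf.sub hg) hg ht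
  simp only [Pi.sub_apply, sub_add_cancel] at this
  rw [this]
  exact (add_sub_cancel_right _ _).symm

theorem SD_congr {f g : ℝ → X} (hf : ContinuousOn f (Ici 0)) (hg : ContinuousOn g (Ici 0))
    {t : ℝ} (ht : 0 ≤ t) (h : ∀ s ∈ Icc 0 t, f s = g s) : M.SD f t = M.SD g t := by
  have h1 := M.SD_le (C := 0) (hf.sub hg) ht (fun s hs => by simp [h s hs])
  have h2 := M.SD_sub hf hg ht
  rw [mul_zero] at h1
  rw [← sub_eq_zero, ← h2, ← norm_le_zero_iff]
  exact h1

theorem shift_cont {f : ℝ → X} (hf : ContinuousOn f (Ici 0)) {h : ℝ} (hh : 0 ≤ h) :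
    ContinuousOn (fun s => f (s + h)) (Ici 0) :=
  hf.comp (by fun_prop) (fun s (hs : 0 ≤ s) => show 0 ≤ s + h by positivity)

theorem SD_shift {f : ℝ → X} (hf : ContinuousOn f (Ici 0)) {t h : ℝ} (ht : 0 ≤ t) (hh : 0 ≤ h) :
    M.SD f (t + h) = M.T t (M.SD f h) + M.SD (fun s => f (s + h)) t := by
  have hfh := shift_cont hf hh
  set P : ℝ → X₀ := fun t => (∫ s in (0:ℝ)..(t+h), M.S (t + h - s) (f s)) -
    ∫ s in (0:ℝ)..t, M.S (t - s) (f (s + h)) with hP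
  have hPd : ∀ t, 0 ≤ t → HasDerivWithinAt P
      (M.SD f (t + h) - M.SD (fun s => f (s + h)) t) (Ici 0) t := by
    intro t ht
    refine HasDerivWithinAt.sub ?_ (M.SD_deriv _ hfh t ht)
    have h1 := M.SD_deriv f hf (t + h) (show 0 ≤ t + h by positivity)
    have h2 : HasDerivWithinAt (fun τ : ℝ => τ + h) 1 (Ici 0) t :=
      ((hasDerivAt_id t).add_const h).hasDerivWithinAt
    have := h1.scomp t h2 (fun s (hs : 0 ≤ s) => show 0 ≤ s + h by positivity)
    simpa [Function.comp_def] using this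
  have hPe : ∀ t, 0 ≤ t → P t = ∫ s in (0:ℝ)..h, M.S (t + h - s) (f s) := by
    intro t ht
    have h1 := intervalIntegral.integral_comp_add_right (a := 0) (b := t)
      (fun s => M.S (t + h - s) (f s)) h
    simp only [add_sub_add_right_eq_sub, zero_add] at h1
    simp only [hP, h1]
    rw [sub_eq_iff_eq_add]
    exact (intervalIntegral.integral_add_adjacent_intervals
      (M.integrand_ii hf ⟨le_rfl, by positivity⟩ ⟨hh, by linarith⟩)
      (M.integrand_ii hf ⟨hh, by linarith⟩ ⟨by positivity, le_rfl⟩)).symm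
  have hi : ∀ t, 0 ≤ t → IntervalIntegrable (fun s => M.S (t + h - s) (f s)) volume 0 h :=
    fun t ht => M.integrand_ii hf ⟨le_rfl, by positivity⟩ ⟨hh, by linarith⟩
  have : CompleteSpace X₀ := M.complete
  have key : ∀ η, 0 ≤ η → P (t + η) = P t + M.T t (P η - P 0) := by
    intro η hη
    rw [← sub_eq_iff_eq_add', hPe _ (by positivity), hPe _ ht, hPe _ hη, hPe _ le_rfl,
      ← intervalIntegral.integral_sub (hi _ (by positivity)) (hi _ ht),
      ← intervalIntegral.integral_sub (hi _ hη) (hi _ le_rfl),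
      ← (M.T t).intervalIntegral_comp_comm ((hi _ hη).sub (hi _ le_rfl))]
    refine intervalIntegral.integral_congr ?_
    intro s hs
    rw [uIcc_of_le hh] at hs
    simp only [map_sub]
    rw [M.TS t _ ht (by linarith [hs.2]), M.TS t _ ht (by linarith [hs.2])]
    simp only [sub_sub_sub_cancel_right]
    congr 3 <;> ring_nf
  have d1 : HasDerivWithinAt (fun η => P (t + η))
      (M.SD f (t + h) - M.SD (fun s => f (s + h)) t) (Ici 0) 0 := by
    have h1 := hPd t ht
    have h2 : HasDerivWithinAt (fun τ : ℝ => t + τ) 1 (Ici 0) 0 :=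
      ((hasDerivAt_id (0:ℝ)).const_add t).hasDerivWithinAt
    have h3 : HasDerivWithinAt P
      (M.SD f (t + h) - M.SD (fun s => f (s + h)) t) (Ici 0) (t + 0) := by simpa using h1
    have := h3.scomp (0:ℝ) h2 (fun s (hs : 0 ≤ s) => show 0 ≤ t + s by positivity)
    simpa [Function.comp_def] using this
  have d2 : HasDerivWithinAt (fun η => P (t + η)) (M.T t (M.SD f h)) (Ici 0) 0 := by
    have h1 := hPd 0 le_rfl
    rw [M.SD_zero_time hfh, sub_zero, zero_add] at h1
    have h2 := (((M.T t).restrictScalars ℝ).hasFDerivAt.comp_hasDerivWithinAt (0:ℝ)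
      (h1.sub_const (P 0))).const_add (P t)
    exact h2.congr_of_mem (fun η hη => key η hη) (by simp)
  have := (uniqueDiffOn_Ici (0:ℝ) 0 (by simp)).eq_deriv _ d1 d2
  rw [← this, sub_add_cancel]

end basics

end MRSetting

theorem aux_prim {E : Type*} [NormedAddCommGroup E] [NormedSpace ℝ E] [CompleteSpace E]
    {k : ℝ → E} (hk : ContinuousOn k (Ici 0)) :
    ∃ H : ℝ → E, H 0 = 0 ∧ ∀ t, 0 ≤ t → HasDerivWithinAt H (k t) (Ici 0) t := by
  have hc : Continuous (fun s => k (max s 0)) := by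
    refine hk.comp_continuous (by fun_prop) (fun s => ?_)
    exact le_max_right s 0
  refine ⟨fun t => ∫ s in (0:ℝ)..t, k (max s 0), by simp, fun t ht => ?_⟩
  have := (intervalIntegral.integral_hasDerivAt_right (hc.intervalIntegrable 0 t)
    (hc.stronglyMeasurableAtFilter _ _) hc.continuousAt)
  simp only [max_eq_left ht] at this
  exact this.hasDerivWithinAt

theorem aux_eq {E : Type*} [NormedAddCommGroup E] [NormedSpace ℝ E]
    {f g k : ℝ → E} (hfc : ContinuousOn f (Ici 0)) (hgc : ContinuousOn g (Ici 0))
    (hf : ∀ t, 0 ≤ t → HasDerivWithinAt f (k t) (Ici t) t)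
    (hg : ∀ t, 0 ≤ t → HasDerivWithinAt g (k t) (Ici t) t) (h0 : f 0 = g 0) :
    ∀ t, 0 ≤ t → f t = g t := fun t ht =>
  eq_of_has_deriv_right_eq (a := 0) (b := t) (fun x hx => hf x hx.1) (fun x hx => hg x hx.1)
    (hfc.mono Icc_subset_Ici_self) (hgc.mono Icc_subset_Ici_self) h0 t ⟨ht, le_rfl⟩

namespace MRSetting

section vector

variable (M : MRSetting X X₀)

theorem SD_rsmul {f : ℝ → X} (hf : ContinuousOn f (Ici 0)) (c : ℝ)
    {t : ℝ} (ht : 0 ≤ t) : M.SD (fun s => c • f s) t = c • M.SD f t := by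
  have := M.SD_smul hf (c : ℂ) ht
  simpa only [Complex.coe_smul] using this

theorem SD_C1 {f g : ℝ → X} (hf : ContinuousOn f (Ici 0)) (hg : ContinuousOn g (Ici 0))
    (hd : ∀ t, 0 ≤ t → HasDerivWithinAt f (g t) (Ici 0) t) (h0 : f 0 = 0) :
    ∀ t, 0 ≤ t → HasDerivWithinAt (M.SD f) (M.SD g t) (Ici 0) t := by
  have : CompleteSpace X₀ := M.complete
  have right : ∀ t, 0 ≤ t → HasDerivWithinAt (M.SD f) (M.SD g t) (Ici t) t := by
    intro t ht
    rw [hasDerivWithinAt_iff_isLittleO, Asymptotics.isLittleO_iff]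
    intro c hc
    have hcpt : IsCompact (Icc (0:ℝ) (t + 1)) := isCompact_Icc
    have hgc := hg.mono (Icc_subset_Ici_self : Icc 0 (t + 1) ⊆ Ici 0)
    obtain ⟨G, hG⟩ := hcpt.exists_bound_of_continuousOn hgc
    have hG0 : 0 ≤ G := (norm_nonneg _).trans (hG 0 ⟨le_rfl, by positivity⟩)
    have huc := hcpt.uniformContinuousOn_of_continuous hgc
    obtain ⟨ε, hε, hεc⟩ : ∃ ε > 0, M.δ t * ε ≤ c / 2 := by
      refine ⟨c / 2 / (M.δ t + 1), ?_, ?_⟩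
      · have := M.δ_nonneg t ht
        positivity
      · have := M.δ_nonneg t ht
        rw [← mul_div_assoc, div_le_iff₀ (by positivity)]
        nlinarith
    obtain ⟨η, hη, hosc⟩ := Metric.uniformContinuousOn_iff.1 huc ε hε
    have hδ : Tendsto (fun r => ‖M.T t‖ * (M.δ r * G)) (𝓝[>] 0) (𝓝 0) := by
      simpa using (M.δ_lim.mul_const G).const_mul ‖M.T t‖
    have hδ1 : ∀ᶠ r in 𝓝[>] (0:ℝ), ‖M.T t‖ * (M.δ r * G) < c / 2 :=
      hδ.eventually (gt_mem_nhds (by positivity))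
    obtain ⟨r, hr, hr2⟩ := mem_nhdsGT_iff_exists_Ioo_subset.1 hδ1
    have hr0 : 0 < r := hr
    have hnb : ∀ᶠ t' in 𝓝[Ici t] t, t' < t + min r (min η 1) :=
      eventually_nhdsWithin_of_eventually_nhds (gt_mem_nhds (by
        have : 0 < min r (min η 1) := by positivity
        linarith))
    filter_upwards [hnb, eventually_mem_nhdsWithin] with t' ht' htt'
    obtain ⟨τ, rfl⟩ : ∃ τ, t' = t + τ := ⟨t' - t, by ring⟩
    have hτ0 : 0 ≤ τ := by simpa using htt'
    have hτm : τ < min r (min η 1) := by linarith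
    have hτr : τ < r := hτm.trans_le (min_le_left _ _)
    have hτη : τ < η := hτm.trans_le ((min_le_right _ _).trans (min_le_left _ _))
    have hτ1 : τ < 1 := hτm.trans_le ((min_le_right _ _).trans (min_le_right _ _))
    rcases hτ0.eq_or_lt with rfl | hτpos
    · simp
    have hfτ := shift_cont hf hτ0
    have hgs : ContinuousOn (fun s => τ • g s) (Ici 0) := hg.const_smul τ
    have e1 : M.SD f (t + τ) - M.SD f t - (t + τ - t) • M.SD g t =
        M.T t (M.SD f τ) + M.SD (fun s => f (s + τ) - f s - τ • g s) t := by
      rw [M.SD_shift hf ht hτ0, M.SD_sub (f := fun s => f (s + τ) - f s) (hfτ.sub hf) hgs ht, M.SD_sub hfτ hf ht,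
        M.SD_rsmul hg τ ht]
      simp only [add_sub_cancel_left]
      abel
    rw [e1, add_sub_cancel_left, Real.norm_of_nonneg hτ0]
    -- mean value estimates
    have mv : ∀ s, 0 ≤ s → s ≤ t → ‖f (s + τ) - f s - τ • g s‖ ≤ ε * τ := by
      intro s hs hst
      have hd1 : ∀ σ ∈ Icc 0 τ, HasDerivWithinAt (fun σ => f (s + σ) - σ • g s)
          (g (s + σ) - g s) (Icc 0 τ) σ := by
        intro σ hσ
        have h1 := (hd (s + σ) (add_nonneg hs hσ.1)).scomp σ
          (((hasDerivAt_id σ).const_add s).hasDerivWithinAt (s := Icc 0 τ))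
          (fun y hy => show 0 ≤ s + y from add_nonneg hs hy.1)
        have h2 := ((hasDerivAt_id σ).smul_const (g s)).hasDerivWithinAt (s := Icc 0 τ)
        have h3 := h1.sub h2
        simp only [one_smul] at h3
        exact h3
      have := norm_image_sub_le_of_norm_deriv_le_segment' hd1 (C := ε) (by
        intro σ hσ
        have := hosc (s + σ) ⟨add_nonneg hs hσ.1, by linarith [hσ.2]⟩ s ⟨hs, by linarith⟩
          (by rw [Real.dist_eq, add_sub_cancel_left, abs_of_nonneg hσ.1]; linarith [hσ.2])
        rw [dist_eq_norm] at this
        exact this.le) τ ⟨hτ0, le_rfl⟩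
      simp only [add_zero, zero_smul, sub_zero] at this
      rwa [sub_right_comm] at this
    have mv0 : ∀ s ∈ Icc 0 τ, ‖f s‖ ≤ G * τ := by
      intro s hs
      have := norm_image_sub_le_of_norm_deriv_le_segment' (f := f) (a := 0) (b := τ) (C := G)
        (fun σ hσ => (hd σ hσ.1).mono Icc_subset_Ici_self)
        (fun σ hσ => hG σ ⟨hσ.1, by linarith [hσ.2]⟩) s hs
      rw [h0, sub_zero, sub_zero] at this
      exact this.trans (mul_le_mul_of_nonneg_left hs.2 hG0)
    have b1 : ‖M.T t (M.SD f τ)‖ ≤ ‖M.T t‖ * (M.δ τ * (G * τ)) :=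
      (M.T t).le_opNorm_of_le (M.SD_le hf hτ0 mv0)
    have b2 := M.SD_le ((hfτ.sub hf).sub hgs) ht (fun s hs => mv s hs.1 hs.2)
    have b3 : ‖M.T t‖ * (M.δ τ * G) < c / 2 := hr2 ⟨hτpos, hτr⟩
    refine (norm_add_le _ _).trans ((add_le_add b1 b2).trans ?_)
    nlinarith
  obtain ⟨H, H0, hH⟩ := aux_prim (M.SD_cont g hg)
  have heq := aux_eq (M.SD_cont f hf) (fun t ht => (hH t ht).continuousWithinAt) right
    (fun t ht => (hH t ht).mono (Ici_subset_Ici.2 ht)) (by rw [H0, M.SD_zero_time hf])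
  exact fun t ht => (hH t ht).congr_of_mem heq ht

variable (L : X₀ →L[ℂ] X)

/-- vector version of the perturbation operator -/
def bv (u : ℝ → X₀) : ℝ → X₀ := M.SD (fun s => L (u s))

theorem L_cont {u : ℝ → X₀} (hu : ContinuousOn u (Ici 0)) :
    ContinuousOn (fun s => L (u s)) (Ici 0) := L.continuous.comp_continuousOn hu

theorem bv_cont {u : ℝ → X₀} (hu : ContinuousOn u (Ici 0)) :
    ContinuousOn (M.bv L u) (Ici 0) := M.SD_cont _ (L_cont L hu)

theorem bv_iter_cont {u : ℝ → X₀} (hu : ContinuousOn u (Ici 0)) (m : ℕ) :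
    ContinuousOn ((M.bv L)^[m] u) (Ici 0) := by
  induction m with
  | zero => exact hu
  | succ m ih => rw [Function.iterate_succ_apply']; exact M.bv_cont L ih

theorem bv_le {u : ℝ → X₀} (hu : ContinuousOn u (Ici 0)) {t C : ℝ} (ht : 0 ≤ t)
    (hC : ∀ s ∈ Icc 0 t, ‖u s‖ ≤ C) : ‖M.bv L u t‖ ≤ M.δ t * (‖L‖ * C) :=
  M.SD_le (L_cont L hu) ht fun s hs => L.le_opNorm_of_le (hC s hs)

theorem bv_zero_time {u : ℝ → X₀} (hu : ContinuousOn u (Ici 0)) : M.bv L u 0 = 0 :=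
  M.SD_zero_time (L_cont L hu)

theorem bv_add {u v : ℝ → X₀} (hu : ContinuousOn u (Ici 0)) (hv : ContinuousOn v (Ici 0))
    {t : ℝ} (ht : 0 ≤ t) : M.bv L (fun s => u s + v s) t = M.bv L u t + M.bv L v t := by
  simp only [bv, map_add]
  exact M.SD_add (L_cont L hu) (L_cont L hv) ht

theorem bv_sub {u v : ℝ → X₀} (hu : ContinuousOn u (Ici 0)) (hv : ContinuousOn v (Ici 0))
    {t : ℝ} (ht : 0 ≤ t) : M.bv L (fun s => u s - v s) t = M.bv L u t - M.bv L v t := by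
  simp only [bv, map_sub]
  exact M.SD_sub (L_cont L hu) (L_cont L hv) ht

theorem bv_congr {u v : ℝ → X₀} (hu : ContinuousOn u (Ici 0)) (hv : ContinuousOn v (Ici 0))
    {t : ℝ} (ht : 0 ≤ t) (h : ∀ s ∈ Icc 0 t, u s = v s) : M.bv L u t = M.bv L v t :=
  M.SD_congr (L_cont L hu) (L_cont L hv) ht fun s hs => by rw [h s hs]

theorem bv_shift {u : ℝ → X₀} (hu : ContinuousOn u (Ici 0)) {t h : ℝ} (ht : 0 ≤ t)
    (hh : 0 ≤ h) :
    M.bv L u (t + h) = M.T t (M.bv L u h) + M.bv L (fun s => u (s + h)) t :=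
  M.SD_shift (L_cont L hu) ht hh

theorem bv_C1 {f g : ℝ → X₀} (hf : ContinuousOn f (Ici 0)) (hg : ContinuousOn g (Ici 0))
    (hd : ∀ t, 0 ≤ t → HasDerivWithinAt f (g t) (Ici 0) t) (h0 : f 0 = 0) :
    ∀ t, 0 ≤ t → HasDerivWithinAt (M.bv L f) (M.bv L g t) (Ici 0) t :=
  M.SD_C1 (L_cont L hf) (L_cont L hg) (fun t ht =>
    (L.restrictScalars ℝ).hasFDerivAt.comp_hasDerivWithinAt t (hd t ht)) (by simp [h0])

theorem ushift_cont {u : ℝ → X₀} (hf : ContinuousOn u (Ici 0)) {h : ℝ} (hh : 0 ≤ h) :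
    ContinuousOn (fun s => u (s + h)) (Ici 0) :=
  hf.comp (by fun_prop) (fun s (hs : 0 ≤ s) => show 0 ≤ s + h by positivity)

theorem bv_decay (b : ℝ) : ∃ C : ℝ, 0 ≤ C ∧ ∀ u : ℝ → X₀, ContinuousOn u (Ici 0) →
    ∀ K : ℝ, 0 ≤ K → (∀ t ∈ Icc 0 b, ‖u t‖ ≤ K) → ∀ m : ℕ, ∀ t ∈ Icc 0 b,
      ‖(M.bv L)^[m] u t‖ ≤ C * (1 / 2) ^ m * K := by
  have : CompleteSpace X₀ := M.complete
  obtain ⟨h0, hh0, hδ⟩ : ∃ h0 : ℝ, 0 < h0 ∧ M.δ h0 * ‖L‖ ≤ 1 / 4 := by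
    have h1 : Tendsto (fun r => M.δ r * ‖L‖) (𝓝[>] 0) (𝓝 0) := by
      simpa using M.δ_lim.mul_const ‖L‖
    have h2 : ∀ᶠ r in 𝓝[>] (0:ℝ), M.δ r * ‖L‖ < 1 / 4 :=
      h1.eventually (gt_mem_nhds (by norm_num))
    obtain ⟨r, hr, hr2⟩ := (h2.and eventually_mem_nhdsWithin).exists
    exact ⟨r, hr2, hr.le⟩
  have small : ∀ (v : ℝ → X₀), ContinuousOn v (Ici 0) → ∀ t, 0 ≤ t → t ≤ h0 → ∀ C, 0 ≤ C →
      (∀ s ∈ Icc 0 t, ‖v s‖ ≤ C) → ‖M.bv L v t‖ ≤ C / 4 := by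
    intro v hv t ht hth C hC hvC
    have h1 := M.bv_le L hv ht hvC
    have h2 : M.δ t ≤ M.δ h0 := M.δ_mono ht hh0.le hth
    have h3 : M.δ t * ‖L‖ ≤ 1 / 4 :=
      (mul_le_mul_of_nonneg_right h2 (norm_nonneg L)).trans hδ
    nlinarith
  have Q : ∀ N : ℕ, ∃ C : ℝ, 0 ≤ C ∧ ∀ u : ℝ → X₀, ContinuousOn u (Ici 0) →
    ∀ K : ℝ, 0 ≤ K → (∀ t ∈ Icc 0 b, ‖u t‖ ≤ K) → ∀ m : ℕ, ∀ t ∈ Icc 0 b, t ≤ N * h0 →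
      ‖(M.bv L)^[m] u t‖ ≤ C * (1 / 2) ^ m * K := by
    intro N
    induction N with
    | zero =>
      refine ⟨1, zero_le_one, fun u hu K hK huK m t ht htN => ?_⟩
      have ht0 : t = 0 := le_antisymm (by simpa using htN) ht.1
      subst ht0
      cases m with
      | zero => simpa using huK 0 ht
      | succ m =>
        rw [Function.iterate_succ_apply', M.bv_zero_time L (M.bv_iter_cont L hu m), norm_zero]
        positivity
    | succ N ih =>
      obtain ⟨C, hC, hN⟩ := ih
      refine ⟨max (2 * ‖M.T h0‖ * C) 1, by positivity, fun u hu K hK huK m => ?_⟩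
      set C' := max (2 * ‖M.T h0‖ * C) 1 with hC'
      have hC1 : 1 ≤ C' := le_max_right _ _
      have hC2 : 2 * ‖M.T h0‖ * C ≤ C' := le_max_left _ _
      induction m with
      | zero =>
        intro t ht htN
        simp only [Function.iterate_zero, id, pow_zero, mul_one]
        exact (huK t ht).trans (by nlinarith)
      | succ m ihm =>
        intro t ht htN
        have hv := M.bv_iter_cont L hu m
        have hp : 0 ≤ (1 / 2 : ℝ) ^ m * K := by positivity
        rw [Function.iterate_succ_apply']
        by_cases hth : t ≤ h0
        · have := small _ hv t ht.1 hth (C' * (1 / 2) ^ m * K) (by positivity) (fun s hs =>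
            ihm s ⟨hs.1, hs.2.trans ht.2⟩ (hs.2.trans htN))
          refine this.trans ?_
          rw [pow_succ]
          nlinarith
        · push Not at hth
          have e : t = h0 + (t - h0) := by ring
          have hr : 0 ≤ t - h0 := by linarith
          have h1 := hN u hu K hK huK (m + 1) (t - h0) ⟨hr, by linarith [ht.2]⟩ (by
            push_cast at htN; linarith)
          rw [Function.iterate_succ_apply'] at h1
          have h2 := (M.T h0).le_opNorm_of_le h1
          have h3 := small _ (ushift_cont hv hr) h0 hh0.le le_rfl (C' * (1 / 2) ^ m * K)
            (by positivity) (fun s hs => ihm _ ⟨by linarith [hs.1], by linarith [hs.2, ht.2]⟩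
              (by linarith [hs.2]))
          rw [e, M.bv_shift L hv hh0.le hr]
          refine (norm_add_le _ _).trans ((add_le_add h2 h3).trans ?_)
          rw [pow_succ]
          nlinarith
  obtain ⟨N, hN⟩ := exists_nat_ge (b / h0)
  obtain ⟨C, hC, h⟩ := Q N
  refine ⟨C, hC, fun u hu K hK huK m t ht => h u hu K hK huK m t ht (ht.2.trans ?_)⟩
  rwa [div_le_iff₀ hh0] at hN

theorem bv_fix_zero {u : ℝ → X₀} (hu : ContinuousOn u (Ici 0))
    (h : ∀ t, 0 ≤ t → u t = M.bv L u t) : ∀ t, 0 ≤ t → u t = 0 := by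
  intro t ht
  have hit : ∀ m : ℕ, ∀ t, 0 ≤ t → u t = (M.bv L)^[m] u t := by
    intro m
    induction m with
    | zero => intro t _; rfl
    | succ m ih =>
      intro t ht
      rw [Function.iterate_succ_apply', h t ht]
      exact M.bv_congr L hu (M.bv_iter_cont L hu m) ht fun s hs => ih s hs.1
  obtain ⟨C, hC, hdec⟩ := M.bv_decay L t
  obtain ⟨K, hK⟩ := (isCompact_Icc (a := (0:ℝ)) (b := t)).exists_bound_of_continuousOn
    (hu.mono Icc_subset_Ici_self)
  have hK0 : 0 ≤ K := (norm_nonneg _).trans (hK 0 ⟨le_rfl, ht⟩)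
  have hlim : Tendsto (fun m : ℕ => C * (1 / 2 : ℝ) ^ m * K) atTop (𝓝 0) := by
    simpa using ((tendsto_pow_atTop_nhds_zero_of_lt_one (r := (1/2:ℝ)) (by norm_num)
      (by norm_num)).const_mul C).mul_const K
  have : ‖u t‖ ≤ 0 := ge_of_tendsto' hlim fun m => by
    conv_lhs => rw [hit m t ht]
    exact hdec u hu K hK0 hK m t ⟨ht, le_rfl⟩
  exact norm_le_zero_iff.1 this

theorem bv_sum {g : ℝ → X₀} (hg : ContinuousOn g (Ici 0)) (N : ℕ) {t : ℝ} (ht : 0 ≤ t) :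
    g t + M.bv L (fun s => ∑ m ∈ Finset.range N, (M.bv L)^[m] g s) t =
      ∑ m ∈ Finset.range (N + 1), (M.bv L)^[m] g t := by
  induction N with
  | zero =>
    have h := M.bv_le L (u := fun _ => (0 : X₀)) (C := 0) continuousOn_const ht (by simp)
    simp only [mul_zero] at h
    simpa using h
  | succ N ih =>
    have hc : ContinuousOn (fun s => ∑ m ∈ Finset.range N, (M.bv L)^[m] g s) (Ici 0) :=
      continuousOn_finsetSum _ fun m _ => M.bv_iter_cont L hg m
    simp only [Finset.sum_range_succ _ N]
    rw [M.bv_add L hc (M.bv_iter_cont L hg N) ht, ← add_assoc, ih,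
      Finset.sum_range_succ _ (N + 1), Function.iterate_succ_apply']

theorem bv_solve {g : ℝ → X₀} (hg : ContinuousOn g (Ici 0)) :
    ∃ z : ℝ → X₀, ContinuousOn z (Ici 0) ∧ ∀ t, 0 ≤ t → z t = g t + M.bv L z t := by
  have : CompleteSpace X₀ := M.complete
  set z : ℝ → X₀ := fun t => ∑' m : ℕ, (M.bv L)^[m] g t with hz
  have hu : ∀ b, 0 ≤ b → TendstoUniformlyOn
      (fun N t => ∑ m ∈ Finset.range N, (M.bv L)^[m] g t) z atTop (Icc 0 b) := by
    intro b hb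
    obtain ⟨C, hC, hdec⟩ := M.bv_decay L b
    obtain ⟨K, hK⟩ := (isCompact_Icc (a := (0:ℝ)) (b := b)).exists_bound_of_continuousOn
      (hg.mono Icc_subset_Ici_self)
    have hK0 : 0 ≤ K := (norm_nonneg _).trans (hK 0 ⟨le_rfl, hb⟩)
    refine tendstoUniformlyOn_tsum_nat (u := fun m => C * (1 / 2) ^ m * K) ?_
      (fun m t ht => hdec g hg K hK0 hK m t ht)
    exact ((summable_geometric_of_lt_one (by norm_num) (by norm_num)).mul_left C).mul_right K
  have hsc : ∀ N : ℕ, ContinuousOn (fun s => ∑ m ∈ Finset.range N, (M.bv L)^[m] g s) (Ici 0) :=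
    fun N => continuousOn_finsetSum _ fun m _ => M.bv_iter_cont L hg m
  have hzc : ContinuousOn z (Ici 0) := by
    intro t ht
    have ht0 : 0 ≤ t := ht
    have h1 : ContinuousOn z (Icc 0 (t + 1)) := (hu (t + 1) (by positivity)).continuousOn
      (Eventually.of_forall fun N => (hsc N).mono Icc_subset_Ici_self).frequently
    refine (h1 t ⟨ht, by linarith⟩).mono_of_mem_nhdsWithin ?_
    rw [← Ici_inter_Iic]
    exact inter_mem self_mem_nhdsWithin (mem_nhdsWithin_of_mem_nhds (Iic_mem_nhds (by linarith)))
  refine ⟨z, hzc, fun t ht => ?_⟩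
  have l1 : Tendsto (fun N => ∑ m ∈ Finset.range (N + 1), (M.bv L)^[m] g t) atTop (𝓝 (z t)) :=
    ((hu t ht).tendsto_at ⟨ht, le_rfl⟩).comp (tendsto_add_atTop_nat 1)
  have l2 : Tendsto (fun N => M.bv L (fun s => ∑ m ∈ Finset.range N, (M.bv L)^[m] g s) t) atTop
      (𝓝 (M.bv L z t)) := by
    rw [Metric.tendsto_nhds]
    intro ε hε
    have hd := M.δ_nonneg t ht
    have hpos : 0 < M.δ t * ‖L‖ + 1 := by positivity
    have := Metric.tendstoUniformlyOn_iff.1 (hu t ht) (ε / (M.δ t * ‖L‖ + 1)) (by positivity)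
    filter_upwards [this] with N hN
    rw [dist_comm, dist_eq_norm, ← M.bv_sub L hzc (hsc N) ht]
    refine (M.bv_le L (hzc.sub (hsc N)) ht (C := ε / (M.δ t * ‖L‖ + 1)) fun s hs => ?_).trans_lt ?_
    · have := (hN s hs).le
      rwa [dist_eq_norm] at this
    · rw [← mul_assoc, ← mul_div_assoc, div_lt_iff₀ hpos]
      nlinarith
  refine tendsto_nhds_unique l1 ?_
  refine (l2.const_add (g t)).congr fun N => M.bv_sum L hg N ht

theorem bv_fix_C1 {y a g : ℝ → X₀} (hy : ContinuousOn y (Ici 0)) (hg : ContinuousOn g (Ici 0))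
    (hya : ∀ t, 0 ≤ t → y t = a t + M.bv L y t)
    (hd : ∀ t, 0 ≤ t → HasDerivWithinAt a (g t) (Ici 0) t) (h0 : a 0 = 0) :
    ∃ z : ℝ → X₀, ContinuousOn z (Ici 0) ∧
      ∀ t, 0 ≤ t → HasDerivWithinAt y (z t) (Ici 0) t := by
  have : CompleteSpace X₀ := M.complete
  obtain ⟨z, hz, hze⟩ := M.bv_solve L hg
  obtain ⟨w, w0, hw⟩ := aux_prim hz
  have hwc : ContinuousOn w (Ici 0) := fun t ht => (hw t ht).continuousWithinAt
  have hac : ContinuousOn a (Ici 0) := fun t ht => (hd t ht).continuousWithinAt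
  have hbw := M.bv_C1 L hwc hz hw w0
  have e1 : ∀ t, 0 ≤ t → w t = a t + M.bv L w t := by
    refine aux_eq (k := z) hwc (hac.add (M.bv_cont L hwc))
      (fun t ht => (hw t ht).mono (Ici_subset_Ici.2 ht)) (fun t ht => ?_) ?_
    · rw [hze t ht]
      exact ((hd t ht).add (hbw t ht)).mono (Ici_subset_Ici.2 ht)
    · rw [w0, h0, M.bv_zero_time L hwc, add_zero]
  have e2 := M.bv_fix_zero L (hy.sub hwc) (fun t ht => by
    have := M.bv_sub L hy hwc ht
    rw [show y - w = fun s => y s - w s from rfl, this]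
    show y t - w t = _
    rw [hya t ht, e1 t ht]
    abel)
  refine ⟨z, hz, fun t ht => (hw t ht).congr_of_mem (fun s hs => sub_eq_zero.1 (e2 s hs)) ht⟩

end vector

end MRSetting

theorem clm_tendsto_of {E F ι : Type*} [NormedAddCommGroup E] [NormedSpace ℂ E]
    [NormedAddCommGroup F] [NormedSpace ℂ F] {l : Filter ι} {f : ι → (E →L[ℂ] F)} {A : E →L[ℂ] F}
    (h : ∀ ε > 0, ∀ᶠ a in l, ‖f a - A‖ < ε) : Tendsto f l (𝓝 A) := by
  rw [Metric.tendsto_nhds]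
  intro ε hε
  filter_upwards [h ε hε] with a ha
  rwa [dist_eq_norm]

theorem clm_tuo_of {E F ι : Type*} [NormedAddCommGroup E] [NormedSpace ℂ E]
    [NormedAddCommGroup F] [NormedSpace ℂ F] {l : Filter ι} {f : ι → ℝ → (E →L[ℂ] F)}
    {g : ℝ → (E →L[ℂ] F)} {s : Set ℝ}
    (h : ∀ ε > 0, ∀ᶠ a in l, ∀ t ∈ s, ‖g t - f a t‖ < ε) : TendstoUniformlyOn f g l s := by
  rw [Metric.tendstoUniformlyOn_iff]
  intro ε hε
  filter_upwards [h ε hε] with a ha t ht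
  rw [dist_eq_norm]
  exact ha t ht

theorem clm_uc {E F : Type*} [NormedAddCommGroup E] [NormedSpace ℂ E]
    [NormedAddCommGroup F] [NormedSpace ℂ F] {V : ℝ → (E →L[ℂ] F)} {b : ℝ}
    (hV : ContinuousOn V (Icc 0 b)) {e : ℝ} (he : 0 < e) :
    ∃ η > 0, ∀ s ∈ Icc 0 b, ∀ t ∈ Icc 0 b, dist s t < η → ‖V s - V t‖ < e := by
  have hcpt : IsCompact (Icc (0:ℝ) b) := isCompact_Icc
  have huc := hcpt.uniformContinuousOn_of_continuous hV
  obtain ⟨η, hη, h⟩ := Metric.uniformContinuousOn_iff.1 huc e he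
  refine ⟨η, hη, fun s hs t ht hst => ?_⟩
  rw [← dist_eq_norm]
  exact h s hs t ht hst

theorem gen_bernstein {H : Type*} [NormedAddCommGroup H] [NormedSpace ℝ H]
    {V : ℝ → H} (hV : Continuous V)
    {t : ℝ} (ht : 0 < t) {e : ℝ} (he : 0 < e) :
    ∃ (n : ℕ) (p : Fin (n + 1) → ℝ → ℝ) (z : Fin (n + 1) → ℝ), (∀ k, Continuous (p k)) ∧
      (∀ k, 0 ≤ z k) ∧
      ∀ s ∈ Icc 0 t, ‖V s - ∑ k, p k s • V (z k)‖ ≤ e := by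
  set G : C(unitInterval, H) := ⟨fun s => V (t * s), by fun_prop⟩ with hG
  obtain ⟨n, hn⟩ := (Metric.tendsto_nhds.1 (bernsteinApproximation_uniform G) e he).exists
  refine ⟨n, fun k s => bernstein n k (projIcc 0 1 zero_le_one (s / t)),
    fun k => t * (bernstein.z k : unitInterval), fun k =>
    (bernstein n k).continuous.comp (continuous_projIcc.comp (by fun_prop)),
    fun k => mul_nonneg ht.le (bernstein.z k).2.1, fun s hs => ?_⟩
  have hst : s / t ∈ Icc (0:ℝ) 1 := ⟨div_nonneg hs.1 ht.le, (div_le_one ht).2 hs.2⟩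
  have h1 := (ContinuousMap.dist_apply_le_dist
    (projIcc (0:ℝ) 1 zero_le_one (s / t))).trans hn.le
  rw [dist_comm, dist_eq_norm, bernsteinApproximation.apply] at h1
  have h3 : G (projIcc (0:ℝ) 1 zero_le_one (s / t)) = V s := by
    rw [projIcc_of_mem _ hst]
    show V (t * (s / t)) = V s
    rw [mul_div_cancel₀ _ ht.ne']
  rw [h3] at h1
  exact h1

theorem clm_bernstein {E F : Type*} [NormedAddCommGroup E] [NormedSpace ℂ E]
    [NormedAddCommGroup F] [NormedSpace ℂ F] {V : ℝ → (E →L[ℂ] F)} (hV : Continuous V)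
    {t : ℝ} (ht : 0 < t) {e : ℝ} (he : 0 < e) :
    ∃ (n : ℕ) (p : Fin (n + 1) → ℝ → ℝ) (z : Fin (n + 1) → ℝ), (∀ k, Continuous (p k)) ∧
      (∀ k, 0 ≤ z k) ∧
      ∀ s ∈ Icc 0 t, ∀ x, ‖V s x - ∑ k, p k s • V (z k) x‖ ≤ e * ‖x‖ := by
  obtain ⟨n, p, z, hp, hz, h⟩ := gen_bernstein hV ht he
  refine ⟨n, p, z, hp, hz, fun s hs x => ?_⟩
  have h2 := ContinuousLinearMap.le_of_opNorm_le _ (h s hs) x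
  rw [ContinuousLinearMap.sub_apply, ContinuousLinearMap.sum_apply] at h2
  exact h2

theorem clm_norm_sub_rev {E F : Type*} [NormedAddCommGroup E] [NormedSpace ℂ E]
    [NormedAddCommGroup F] [NormedSpace ℂ F] (A B : E →L[ℂ] F) : ‖A - B‖ = ‖B - A‖ :=
  norm_sub_rev A B

theorem aux_compact_comp {E F G : Type*} [NormedAddCommGroup E] [NormedSpace ℂ E] [CompleteSpace E]
    [NormedAddCommGroup F] [NormedSpace ℂ F] [NormedAddCommGroup G] [NormedSpace ℂ G]
    {W : ℝ → (E →L[ℂ] F)}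
    (hW : ∀ x, ContinuousOn (fun t => W t x) (Ici 0)) (K : G →L[ℂ] E) (hK : IsCompactOperator K) :
    ContinuousOn (fun t => (W t).comp K) (Ici 0) := by
  intro t ht
  have ht0 : 0 ≤ t := ht
  obtain ⟨C, hC0, hC⟩ := aux_bound hW (t + 1)
  obtain ⟨Q, hQ, hKQ⟩ := (hK : IsCompactOperator
    (K : G →ₗ[ℂ] E)).image_closedBall_subset_compact (σ₁₂ := RingHom.id ℂ) 1
  rw [ContinuousWithinAt, Metric.tendsto_nhds]
  intro ε hε
  set e := ε / (2 * (2 * C + 1)) with he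
  have he0 : 0 < e := by positivity
  obtain ⟨Y, hYf, hY⟩ := Metric.totallyBounded_iff.1 hQ.totallyBounded e he0
  have ev1 : ∀ᶠ τ in 𝓝[Ici 0] t, ∀ y ∈ Y, ‖W τ y - W t y‖ < e := by
    rw [eventually_all_finite hYf]
    intro y _
    have := Metric.tendsto_nhds.1 (hW y t ht).tendsto e he0
    simpa only [dist_eq_norm] using this
  have ev2 : ∀ᶠ τ in 𝓝[Ici 0] t, τ < t + 1 :=
    eventually_nhdsWithin_of_eventually_nhds (gt_mem_nhds (by linarith))
  filter_upwards [ev1, ev2, eventually_mem_nhdsWithin] with τ h1 h2 h3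
  rw [dist_eq_norm]
  have hτ0 : 0 ≤ τ := h3
  have hb : ‖(W τ).comp K - (W t).comp K‖ ≤ (2 * C + 1) * e := by
    refine ContinuousLinearMap.opNorm_le_of_unit_norm (by positivity) fun x hx => ?_
    have hKx : K x ∈ Q := hKQ ⟨x, by simp [hx], rfl⟩
    obtain ⟨y, hyY, hxy⟩ := mem_iUnion₂.1 (hY hKx)
    rw [Metric.mem_ball, dist_eq_norm] at hxy
    have a1 := (W τ).le_of_opNorm_le_of_le (hC τ ⟨hτ0, h2.le⟩) hxy.le
    have a2 := (W t).le_of_opNorm_le_of_le (hC t ⟨ht0, by linarith⟩) hxy.le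
    have a3 := h1 y hyY
    have a4 : ((W τ).comp K - (W t).comp K) x =
        W τ (K x - y) + (W τ y - W t y) - W t (K x - y) := by
      simp
    rw [a4]
    have a5 := norm_sub_le (W τ (K x - y) + (W τ y - W t y)) (W t (K x - y))
    have a6 := norm_add_le (W τ (K x - y)) (W τ y - W t y)
    linarith
  refine hb.trans_lt ?_
  rw [he]
  field_simp
  linarith

namespace MRSetting

section op

variable (M : MRSetting X X₀) (L : X₀ →L[ℂ] X)

theorem Bop_apply {U : ℝ → (X₀ →L[ℂ] X₀)} (hU : ∀ x, ContinuousOn (fun t => U t x) (Ici 0))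
    (t : ℝ) (x : X₀) : M.Bop L U t x = M.bv L (fun s => U s x) t :=
  M.SDop_apply (fun s => L.comp (U s)) (fun x => L_cont L (hU x)) t x

theorem Bop_sc {U : ℝ → (X₀ →L[ℂ] X₀)} (hU : ∀ x, ContinuousOn (fun t => U t x) (Ici 0)) :
    ∀ x, ContinuousOn (fun t => M.Bop L U t x) (Ici 0) := by
  intro x
  simp only [M.Bop_apply L hU]
  exact M.bv_cont L (hU x)

theorem iter_sc {U : ℝ → (X₀ →L[ℂ] X₀)} (hU : ∀ x, ContinuousOn (fun t => U t x) (Ici 0))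
    (m : ℕ) : ∀ x, ContinuousOn (fun t => (M.Bop L)^[m] U t x) (Ici 0) := by
  induction m with
  | zero => exact hU
  | succ m ih => rw [Function.iterate_succ_apply']; exact M.Bop_sc L ih

theorem iter_apply {U : ℝ → (X₀ →L[ℂ] X₀)} (hU : ∀ x, ContinuousOn (fun t => U t x) (Ici 0))
    (m : ℕ) (t : ℝ) (x : X₀) :
    (M.Bop L)^[m] U t x = (M.bv L)^[m] (fun s => U s x) t := by
  induction m generalizing t with
  | zero => rfl
  | succ m ih =>
    rw [Function.iterate_succ_apply', Function.iterate_succ_apply',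
      M.Bop_apply L (M.iter_sc L hU m)]
    simp only [ih]

theorem Bop_sub {U V : ℝ → (X₀ →L[ℂ] X₀)} (hU : ∀ x, ContinuousOn (fun t => U t x) (Ici 0))
    (hV : ∀ x, ContinuousOn (fun t => V t x) (Ici 0)) {t : ℝ} (ht : 0 ≤ t) (x : X₀) :
    (M.Bop L U t - M.Bop L V t) x = M.bv L (fun s => U s x - V s x) t := by
  rw [ContinuousLinearMap.sub_apply, M.Bop_apply L hU, M.Bop_apply L hV,
    M.bv_sub L (hU x) (hV x) ht]

theorem Bop_congr_add {U V W : ℝ → (X₀ →L[ℂ] X₀)}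
    (hU : ∀ x, ContinuousOn (fun t => U t x) (Ici 0))
    (hV : ∀ x, ContinuousOn (fun t => V t x) (Ici 0))
    (hW : ∀ x, ContinuousOn (fun t => W t x) (Ici 0))
    (h : ∀ t, 0 ≤ t → U t = V t + W t) :
    ∀ t, 0 ≤ t → M.Bop L U t = M.Bop L V t + M.Bop L W t := by
  intro t ht
  ext1 x
  rw [ContinuousLinearMap.add_apply, M.Bop_apply L hU, M.Bop_apply L hV, M.Bop_apply L hW,
    ← M.bv_add L (hV x) (hW x) ht]
  refine M.bv_congr L (hU x) ((hV x).add (hW x)) ht fun s hs => ?_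
  rw [h s hs.1]; rfl

theorem fix_iter {G U : ℝ → (X₀ →L[ℂ] X₀)}
    (hG : ∀ x, ContinuousOn (fun t => G t x) (Ici 0))
    (hU : ∀ x, ContinuousOn (fun t => U t x) (Ici 0))
    (h : ∀ t, 0 ≤ t → U t = G t + M.Bop L U t) (n : ℕ) :
    ∀ t, 0 ≤ t → (M.Bop L)^[n] U t = (M.Bop L)^[n] G t + (M.Bop L)^[n + 1] U t := by
  induction n with
  | zero => exact h
  | succ n ih =>
    have := M.Bop_congr_add L (M.iter_sc L hU n) (M.iter_sc L hG n) (M.iter_sc L hU (n + 1)) ih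
    intro t ht
    rw [Function.iterate_succ_apply' _ n U, Function.iterate_succ_apply' _ n G,
      Function.iterate_succ_apply' _ (n + 1) U]
    exact this t ht

theorem fix_sum {G U : ℝ → (X₀ →L[ℂ] X₀)}
    (hG : ∀ x, ContinuousOn (fun t => G t x) (Ici 0))
    (hU : ∀ x, ContinuousOn (fun t => U t x) (Ici 0))
    (h : ∀ t, 0 ≤ t → U t = G t + M.Bop L U t) (n : ℕ) :
    ∀ t, 0 ≤ t → U t = ∑ k ∈ Finset.range n, (M.Bop L)^[k] G t + (M.Bop L)^[n] U t := by
  induction n with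
  | zero => intro t _; simp
  | succ n ih =>
    intro t ht
    rw [Finset.sum_range_succ, add_assoc, ← M.fix_iter L hG hU h n t ht]
    exact ih t ht

theorem op_decay {U : ℝ → (X₀ →L[ℂ] X₀)} (hU : ∀ x, ContinuousOn (fun t => U t x) (Ici 0))
    (b : ℝ) : ∃ C : ℝ, ∀ m : ℕ, ∀ t ∈ Icc 0 b, ‖(M.Bop L)^[m] U t‖ ≤ C * (1 / 2) ^ m := by
  have : CompleteSpace X₀ := M.complete
  obtain ⟨C, hC, hdec⟩ := M.bv_decay L b
  obtain ⟨K, hK0, hK⟩ := aux_bound hU b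
  refine ⟨C * K, fun m t ht => ContinuousLinearMap.opNorm_le_bound _ (by positivity) fun x => ?_⟩
  rw [M.iter_apply L hU]
  refine (hdec _ (hU x) (K * ‖x‖) (by positivity)
    (fun s hs => (U s).le_of_opNorm_le (hK s hs) x) m t ht).trans (le_of_eq (by ring))

theorem fix_tendsto {G U : ℝ → (X₀ →L[ℂ] X₀)}
    (hG : ∀ x, ContinuousOn (fun t => G t x) (Ici 0))
    (hU : ∀ x, ContinuousOn (fun t => U t x) (Ici 0))
    (h : ∀ t, 0 ≤ t → U t = G t + M.Bop L U t) (b : ℝ) :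
    TendstoUniformlyOn (fun n t => ∑ k ∈ Finset.range n, (M.Bop L)^[k] G t) U atTop (Icc 0 b) := by
  obtain ⟨C, hC⟩ := M.op_decay L hU b
  have hlim : Tendsto (fun m : ℕ => C * (1 / 2 : ℝ) ^ m) atTop (𝓝 0) := by
    simpa using (tendsto_pow_atTop_nhds_zero_of_lt_one (r := (1/2:ℝ)) (by norm_num)
      (by norm_num)).const_mul C
  refine clm_tuo_of fun ε hε => ?_
  filter_upwards [hlim.eventually (gt_mem_nhds hε)] with n hn t ht
  refine lt_of_le_of_lt ?_ hn
  have := M.fix_sum L hG hU h n t ht.1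
  rw [← sub_eq_iff_eq_add'] at this
  rw [this]
  exact hC n t ht

theorem continuousOn_Ioi_of_Ioo {E : Type*} [TopologicalSpace E] {f : ℝ → E}
    (h : ∀ a b, 0 < a → ContinuousOn f (Ioo a b)) : ContinuousOn f (Ioi 0) := by
  intro t ht
  have ht0 : (0:ℝ) < t := ht
  exact ((h (t / 2) (t + 1) (by positivity)).continuousAt
    (Ioo_mem_nhds (by linarith) (by linarith))).continuousWithinAt

theorem series_normcont {G U : ℝ → (X₀ →L[ℂ] X₀)}
    (hG : ∀ x, ContinuousOn (fun t => G t x) (Ici 0))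
    (hU : ∀ x, ContinuousOn (fun t => U t x) (Ici 0))
    (h : ∀ t, 0 ≤ t → U t = G t + M.Bop L U t)
    (hk : ∀ k, ContinuousOn ((M.Bop L)^[k] G) (Ioi 0)) : ContinuousOn U (Ioi 0) := by
  refine continuousOn_Ioi_of_Ioo fun a b ha => ?_
  refine ((M.fix_tendsto L hG hU h b).mono (fun t ht => ⟨ha.le.trans ht.1.le, ht.2.le⟩)).continuousOn
    (Eventually.of_forall fun n => ?_).frequently
  exact continuousOn_finsetSum _ fun k _ => (hk k).mono fun t ht => ha.trans ht.1

theorem series_compact {G U : ℝ → (X₀ →L[ℂ] X₀)}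
    (hG : ∀ x, ContinuousOn (fun t => G t x) (Ici 0))
    (hU : ∀ x, ContinuousOn (fun t => U t x) (Ici 0))
    (h : ∀ t, 0 ≤ t → U t = G t + M.Bop L U t)
    (hk : ∀ k, ∀ t : ℝ, 0 < t → IsCompactOperator ⇑((M.Bop L)^[k] G t)) :
    ∀ t : ℝ, 0 < t → IsCompactOperator ⇑(U t) := by
  intro t ht
  have : CompleteSpace X₀ := M.complete
  have hl := (M.fix_tendsto L hG hU h t).tendsto_at ⟨ht.le, le_rfl⟩
  refine isClosed_setOfPred_isCompactOperator.mem_of_tendsto hl (Eventually.of_forall fun n => ?_)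
  exact (compactOperator (RingHom.id ℂ) X₀ X₀).sum_mem fun k _ => hk k t ht

/-- truncation away from zero -/
theorem trunc_sc {U : ℝ → (X₀ →L[ℂ] X₀)} (hU : ∀ x, ContinuousOn (fun t => U t x) (Ici 0))
    (ε : ℝ) : ∀ x, ContinuousOn (fun t => U (max t ε) x) (Ici 0) := fun x =>
  (hU x).comp (by fun_prop) fun t (ht : 0 ≤ t) => show 0 ≤ max t ε from le_max_of_le_left ht

theorem trunc_le {U : ℝ → (X₀ →L[ℂ] X₀)} (hU : ∀ x, ContinuousOn (fun t => U t x) (Ici 0))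
    (b : ℝ) : ∃ C : ℝ, ∀ ε t, 0 < ε → ε ≤ t → t ≤ b →
      ‖M.Bop L U t - M.Bop L (fun s => U (max s ε)) t‖ ≤ C * M.δ ε := by
  have : CompleteSpace X₀ := M.complete
  obtain ⟨K, hK0, hK⟩ := aux_bound hU b
  obtain ⟨C, hC0, hC⟩ := aux_bound M.T_cont b
  refine ⟨C * (‖L‖ * (2 * K)), fun ε t hε hεt htb => ?_⟩
  have hd := M.δ_nonneg ε hε.le
  refine ContinuousLinearMap.opNorm_le_bound _ (by positivity) fun x => ?_
  have hUε := trunc_sc hU ε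
  have hD : ContinuousOn (fun s => U s x - U (max s ε) x) (Ici 0) := (hU x).sub (hUε x)
  have hr : 0 ≤ t - ε := by linarith
  rw [M.Bop_sub L hU hUε (by linarith) x]
  have e : t = (t - ε) + ε := by ring
  rw [e, M.bv_shift L hD hr hε.le]
  have h1 := M.bv_le L (ushift_cont hD hε.le) hr (C := 0) (fun s hs => by
    rw [max_eq_left (by linarith [hs.1]), sub_self, norm_zero])
  rw [mul_zero, mul_zero] at h1
  rw [norm_le_zero_iff.1 h1, add_zero]
  have h2 := M.bv_le L hD hε.le (C := 2 * K * ‖x‖) (fun s hs => by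
    refine (norm_sub_le _ _).trans ?_
    have a1 := (U s).le_of_opNorm_le (hK s ⟨hs.1, by linarith [hs.2]⟩) x
    have a2 := (U (max s ε)).le_of_opNorm_le (hK (max s ε) ⟨le_max_of_le_left hs.1,
      max_le (by linarith [hs.2]) (by linarith)⟩) x
    linarith)
  have h3 := (M.T (t - ε)).le_of_opNorm_le_of_le (hC _ ⟨hr, by linarith⟩) h2
  exact h3.trans (le_of_eq (by ring))

theorem normcont_closed {V : ℝ → (X₀ →L[ℂ] X₀)} (hVn : ContinuousOn V (Ici 0)) :
    ContinuousOn (M.Bop L V) (Ici 0) := by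
  have : CompleteSpace X₀ := M.complete
  have hV : ∀ x, ContinuousOn (fun t => V t x) (Ici 0) := fun x =>
    hVn.clm_apply continuousOn_const
  have key : ∀ b, 0 ≤ b → ∀ ε > 0, ∃ η > 0, ∀ t h, 0 ≤ t → 0 ≤ h → t + h ≤ b → h < η →
      ‖M.Bop L V (t + h) - M.Bop L V t‖ < ε := by
    intro b hb ε hε
    obtain ⟨C, hC0, hC⟩ := aux_bound M.T_cont b
    obtain ⟨K, hK0, hK⟩ := aux_bound hV b
    have hdb := M.δ_nonneg b hb
    obtain ⟨e, he, hec⟩ : ∃ e > 0, M.δ b * (‖L‖ * e) ≤ ε / 3 := by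
      refine ⟨ε / 3 / (M.δ b * ‖L‖ + 1), by positivity, ?_⟩
      rw [← mul_assoc, ← mul_div_assoc, div_le_iff₀ (by positivity)]
      nlinarith
    obtain ⟨η, hη, hosc⟩ := clm_uc (b := b) (hVn.mono Icc_subset_Ici_self) he
    have hδ : Tendsto (fun r => C * (M.δ r * (‖L‖ * K))) (𝓝[>] 0) (𝓝 0) := by
      simpa using (M.δ_lim.mul_const (‖L‖ * K)).const_mul C
    have hδ1 : ∀ᶠ r in 𝓝[>] (0:ℝ), C * (M.δ r * (‖L‖ * K)) < ε / 3 :=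
      hδ.eventually (gt_mem_nhds (by positivity))
    obtain ⟨r, hr, hr2⟩ := mem_nhdsGT_iff_exists_Ioo_subset.1 hδ1
    have hr0 : 0 < r := hr
    refine ⟨min r η, by positivity, fun t h ht hh hthb hhη => ?_⟩
    have hδh : C * (M.δ h * (‖L‖ * K)) ≤ ε / 3 := by
      rcases hh.eq_or_lt with rfl | hpos
      · rw [M.δ_zero]; simp; positivity
      · exact le_of_lt (hr2 ⟨hpos, hhη.trans_le (min_le_left _ _)⟩)
    have hbd : ‖M.Bop L V (t + h) - M.Bop L V t‖ ≤ ε / 3 + ε / 3 := by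
      refine ContinuousLinearMap.opNorm_le_bound _ (by positivity) fun x => ?_
      have hsh := ushift_cont (hV x) hh
      rw [ContinuousLinearMap.sub_apply, M.Bop_apply L hV, M.Bop_apply L hV,
        M.bv_shift L (hV x) ht hh, add_sub_assoc, ← M.bv_sub L hsh (hV x) ht]
      have h1 := M.bv_le L (hV x) hh (C := K * ‖x‖) (fun s hs =>
        (V s).le_of_opNorm_le (hK s ⟨hs.1, by linarith [hs.2]⟩) x)
      have h2 := (M.T t).le_of_opNorm_le_of_le (hC _ ⟨ht, by linarith⟩) h1
      have h3 := M.bv_le L (hsh.sub (hV x)) ht (C := e * ‖x‖) (fun s hs => by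
        have := hosc (s + h) ⟨by linarith [hs.1], by linarith [hs.2]⟩ s
          ⟨hs.1, by linarith [hs.2]⟩ (by
            rw [Real.dist_eq, add_sub_cancel_left, abs_of_nonneg hh]
            exact hhη.trans_le (min_le_right _ _))
        exact (V (s + h) - V s).le_of_opNorm_le this.le x)
      have h4 : M.δ t * (‖L‖ * (e * ‖x‖)) ≤ M.δ b * (‖L‖ * (e * ‖x‖)) :=
        mul_le_mul_of_nonneg_right (M.δ_mono ht hb (by linarith)) (by positivity)
      refine (norm_add_le _ _).trans ((add_le_add h2 (h3.trans h4)).trans ?_)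
      have h5 := mul_le_mul_of_nonneg_right hδh (norm_nonneg x)
      have h6 := mul_le_mul_of_nonneg_right hec (norm_nonneg x)
      nlinarith
    linarith
  intro t ht
  have ht0 : 0 ≤ t := ht
  refine clm_tendsto_of fun ε hε => ?_
  obtain ⟨η, hη, hk⟩ := key (t + 1) (by positivity) ε hε
  have ev : ∀ᶠ τ in 𝓝[Ici 0] t, dist τ t < min η 1 :=
    eventually_nhdsWithin_of_eventually_nhds (Metric.ball_mem_nhds t (by positivity))
  filter_upwards [ev, eventually_mem_nhdsWithin] with τ h1 h2
  have hτ0 : 0 ≤ τ := h2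
  rw [Real.dist_eq, lt_min_iff] at h1
  rcases le_total t τ with hle | hle
  · rw [abs_of_nonneg (by linarith)] at h1
    have := hk t (τ - t) ht0 (by linarith) (by linarith [h1.2]) h1.1
    rwa [add_sub_cancel] at this
  · rw [abs_of_nonpos (by linarith)] at h1
    have := hk τ (t - τ) hτ0 (by linarith) (by linarith [h1.2]) (by linarith [h1.1])
    rwa [add_sub_cancel, clm_norm_sub_rev] at this

theorem trunc_normcont {U : ℝ → (X₀ →L[ℂ] X₀)} (hU : ContinuousOn U (Ioi 0)) {ε : ℝ}
    (hε : 0 < ε) : Continuous (fun s => U (max s ε)) :=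
  hU.comp_continuous (by fun_prop) fun s => hε.trans_le (le_max_right _ _)

theorem Bop_normcont {U : ℝ → (X₀ →L[ℂ] X₀)} (hU : ∀ x, ContinuousOn (fun t => U t x) (Ici 0))
    (hUn : ContinuousOn U (Ioi 0)) : ContinuousOn (M.Bop L U) (Ioi 0) := by
  refine continuousOn_Ioi_of_Ioo fun a b ha => ?_
  obtain ⟨C, hC⟩ := M.trunc_le L hU b
  have hlim : Tendsto (fun r => C * M.δ r) (𝓝[>] 0) (𝓝 0) := by
    simpa using M.δ_lim.const_mul C
  have hu : TendstoUniformlyOn (fun ε t => M.Bop L (fun s => U (max s ε)) t) (M.Bop L U)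
      (𝓝[>] (0:ℝ)) (Ioo a b) := by
    refine clm_tuo_of fun e he => ?_
    have ev : ∀ᶠ ε in 𝓝[>] (0:ℝ), ε < a := eventually_nhdsWithin_of_eventually_nhds
      (gt_mem_nhds ha)
    filter_upwards [hlim.eventually (gt_mem_nhds he), ev, eventually_mem_nhdsWithin]
      with ε h1 h2 h3 t ht
    exact (hC ε t h3 (h2.le.trans ht.1.le) ht.2.le).trans_lt h1
  refine hu.continuousOn (Eventually.frequently ?_)
  filter_upwards [eventually_mem_nhdsWithin] with ε hε
  exact (M.normcont_closed L (trunc_normcont hUn hε).continuousOn).mono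
    fun t ht => ha.le.trans ht.1.le

theorem SD_sum {ι : Type*} (s : Finset ι) {f : ι → ℝ → X}
    (hf : ∀ i, ContinuousOn (f i) (Ici 0)) {t : ℝ} (ht : 0 ≤ t) :
    M.SD (fun τ => ∑ i ∈ s, f i τ) t = ∑ i ∈ s, M.SD (f i) t := by
  classical
  induction s using Finset.induction_on with
  | empty =>
    have h := M.SD_le (f := fun _ => (0 : X)) (C := 0) continuousOn_const ht (by simp)
    simp only [mul_zero] at h
    simpa using h
  | insert a s ha ih =>
    simp only [Finset.sum_insert ha]
    rw [M.SD_add (hf a) (continuousOn_finsetSum _ fun i _ => hf i) ht, ih]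

theorem compact_of_approx (M : MRSetting X X₀) {A : X₀ →L[ℂ] X₀} (h : ∀ ε > 0, ∃ K : X₀ →L[ℂ] X₀,
    IsCompactOperator ⇑K ∧ ‖K - A‖ < ε) : IsCompactOperator ⇑A := by
  have : CompleteSpace X₀ := M.complete
  choose! K hK using h
  have hlim : Tendsto K (𝓝[>] (0:ℝ)) (𝓝 A) := by
    refine clm_tendsto_of fun ε hε => ?_
    filter_upwards [Ioo_mem_nhdsGT hε] with e he
    exact (hK e he.1).2.trans he.2
  refine isClosed_setOfPred_isCompactOperator.mem_of_tendsto hlim ?_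
  filter_upwards [eventually_mem_nhdsWithin] with e he
  exact (hK e he).1

theorem normcont_compact {V : ℝ → (X₀ →L[ℂ] X₀)} (hVn : Continuous V)
    {t : ℝ} (ht : 0 < t) (hc : ∀ s, 0 ≤ s → IsCompactOperator ⇑(V s)) :
    IsCompactOperator ⇑(M.Bop L V t) := by
  have hV : ∀ x, ContinuousOn (fun t => V t x) (Ici 0) := fun x =>
    hVn.continuousOn.clm_apply continuousOn_const
  refine M.compact_of_approx fun ε hε => ?_
  have hdb := M.δ_nonneg t ht.le
  obtain ⟨e, he, hec⟩ : ∃ e > 0, M.δ t * (‖L‖ * e) ≤ ε / 2 := by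
    refine ⟨ε / 2 / (M.δ t * ‖L‖ + 1), by positivity, ?_⟩
    rw [← mul_assoc, ← mul_div_assoc, div_le_iff₀ (by positivity)]
    nlinarith
  obtain ⟨n, p, z, hpc, hz, happ⟩ := clm_bernstein hVn ht he
  have hJ : ∀ k, ∃ J : X →L[ℂ] X₀, ∀ y, J y = M.SD (fun s => p k s • y) t := by
    intro k
    have hcy : ∀ y : X, ContinuousOn (fun s => p k s • y) (Ici 0) := fun y =>
      ((hpc k).smul continuous_const).continuousOn
    obtain ⟨K, hK⟩ := (isCompact_Icc (a := (0:ℝ)) (b := t)).exists_bound_of_continuousOn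
      (hpc k).continuousOn
    refine ⟨LinearMap.mkContinuous
      { toFun := fun y => M.SD (fun s => p k s • y) t
        map_add' := fun y z => by
          simp only [smul_add]
          exact M.SD_add (hcy y) (hcy z) ht.le
        map_smul' := fun c y => by
          simp only [smul_comm _ c, RingHom.id_apply]
          exact M.SD_smul (hcy y) c ht.le } (M.δ t * K) ?_, fun y => rfl⟩
    intro y
    refine (M.SD_le (hcy y) ht.le (C := K * ‖y‖) fun s hs => ?_).trans (le_of_eq (by ring))
    rw [norm_smul]
    exact mul_le_mul_of_nonneg_right (hK s hs) (norm_nonneg _)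
  choose J hJ using hJ
  refine ⟨∑ k, (J k).comp (L.comp (V (z k))),
    (compactOperator (RingHom.id ℂ) X₀ X₀).sum_mem fun k _ =>
      ((hc _ (hz k)).clm_comp L).clm_comp (J k), ?_⟩
  rw [clm_norm_sub_rev]
  refine lt_of_le_of_lt (b := ε / 2) ?_ (by linarith)
  refine ContinuousLinearMap.opNorm_le_bound _ (by positivity) fun x => ?_
  have hq : ∀ k, ContinuousOn (fun s => p k s • V (z k) x) (Ici 0) := fun k =>
    ((hpc k).smul continuous_const).continuousOn
  have hsum : ContinuousOn (fun s => ∑ k, p k s • V (z k) x) (Ici 0) :=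
    continuousOn_finsetSum _ fun k _ => hq k
  have e1 : (∑ k, (J k).comp (L.comp (V (z k)))) x =
      M.bv L (fun s => ∑ k, p k s • V (z k) x) t := by
    have hLr : ∀ (r : ℝ) (v : X₀), L (r • v) = r • L v := fun r v =>
      (L.restrictScalars ℝ).map_smul r v
    simp only [bv, map_sum, hLr]
    rw [M.SD_sum Finset.univ (f := fun k s => p k s • L (V (z k) x))
      (fun k => ((hpc k).smul continuous_const).continuousOn) ht.le,
      ContinuousLinearMap.sum_apply]
    exact Finset.sum_congr rfl fun k _ => hJ k _
  rw [ContinuousLinearMap.sub_apply, e1, M.Bop_apply L hV, ← M.bv_sub L (hV x) hsum ht.le]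
  refine (M.bv_le L ((hV x).sub hsum) ht.le (C := e * ‖x‖)
    fun s hs => happ s hs x).trans ?_
  have := mul_le_mul_of_nonneg_right hec (norm_nonneg x)
  linarith

end op

end MRSetting

theorem clm_norm_tri {E F : Type*} [NormedAddCommGroup E] [NormedSpace ℂ E]
    [NormedAddCommGroup F] [NormedSpace ℂ F] {A B C D : E →L[ℂ] F} {a b c : ℝ}
    (h1 : ‖A - B‖ ≤ a) (h2 : ‖B - C‖ ≤ b) (h3 : ‖D - C‖ ≤ c) : ‖A - D‖ ≤ a + b + c := by
  have e : A - D = (A - B) + (B - C) - (D - C) := by abel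
  rw [e]
  refine (norm_sub_le _ _).trans (add_le_add ((norm_add_le _ _).trans (add_le_add h1 h2)) h3)

theorem clm_eventually {E F ι : Type*} [NormedAddCommGroup E] [NormedSpace ℂ E]
    [NormedAddCommGroup F] [NormedSpace ℂ F] {l : Filter ι} {f : ι → (E →L[ℂ] F)} {A : E →L[ℂ] F}
    (h : Tendsto f l (𝓝 A)) {ε : ℝ} (hε : 0 < ε) : ∀ᶠ a in l, ‖f a - A‖ < ε := by
  filter_upwards [Metric.tendsto_nhds.1 h ε hε] with a ha
  rwa [← dist_eq_norm]

namespace MRSetting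

section good

variable (M : MRSetting X X₀) (L : X₀ →L[ℂ] X)

def Good (U : ℝ → (X₀ →L[ℂ] X₀)) : Prop :=
  ∀ b : ℝ, ∃ C : ℝ, 0 ≤ C ∧ ∀ t h, 0 ≤ t → 0 ≤ h → t + h ≤ b →
    ‖U (t + h) - (M.T h).comp (U t)‖ ≤ C * M.δ h

theorem good_T : M.Good M.T := by
  intro b
  refine ⟨0, le_rfl, fun t h ht hh _ => ?_⟩
  rw [add_comm, M.T_add h t hh ht, sub_self, zero_mul]
  exact ContinuousLinearMap.opNorm_zero.le

theorem good_Bop {V : ℝ → (X₀ →L[ℂ] X₀)} (hV : ∀ x, ContinuousOn (fun t => V t x) (Ici 0)) :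
    M.Good (M.Bop L V) := by
  intro b
  have : CompleteSpace X₀ := M.complete
  obtain ⟨K, hK0, hK⟩ := aux_bound hV b
  refine ⟨‖L‖ * K, by positivity, fun t h ht hh hb => ?_⟩
  have hd := M.δ_nonneg h hh
  refine ContinuousLinearMap.opNorm_le_bound _ (by positivity) fun x => ?_
  rw [ContinuousLinearMap.sub_apply, ContinuousLinearMap.comp_apply, M.Bop_apply L hV,
    M.Bop_apply L hV, add_comm t h, M.bv_shift L (hV x) hh ht, add_sub_cancel_left]
  refine (M.bv_le L (ushift_cont (hV x) ht) hh (C := K * ‖x‖) fun s hs =>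
    (V (s + t)).le_of_opNorm_le (hK _ ⟨by linarith [hs.1], by linarith [hs.2]⟩) x).trans
    (le_of_eq (by ring))

theorem good_R {R : ℝ → (X₀ →L[ℂ] X₀)} (hR : ∀ x, ContinuousOn (fun t => R t x) (Ici 0))
    (hfix : ∀ t, 0 ≤ t → R t = M.T t + M.Bop L R t) : M.Good R := by
  intro b
  obtain ⟨C, hC0, hC⟩ := M.good_Bop L hR b
  refine ⟨C, hC0, fun t h ht hh hb => ?_⟩
  have e : R (t + h) - (M.T h).comp (R t) =
      M.Bop L R (t + h) - (M.T h).comp (M.Bop L R t) := by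
    rw [hfix (t + h) (by positivity), hfix t ht, ContinuousLinearMap.comp_add,
      add_comm t h, M.T_add h t hh ht]
    abel
  rw [e]
  exact hC t h ht hh hb

theorem good_iter {U : ℝ → (X₀ →L[ℂ] X₀)} (hU : ∀ x, ContinuousOn (fun t => U t x) (Ici 0))
    (hg : M.Good U) (n : ℕ) : M.Good ((M.Bop L)^[n] U) := by
  cases n with
  | zero => exact hg
  | succ n => rw [Function.iterate_succ_apply']; exact M.good_Bop L (M.iter_sc L hU n)

theorem good_compact_normcont {U : ℝ → (X₀ →L[ℂ] X₀)} (hg : M.Good U)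
    (hc : ∀ t : ℝ, 0 < t → IsCompactOperator ⇑(U t)) : ContinuousOn U (Ioi 0) := by
  intro t0 ht0
  have h0 : 0 < t0 := ht0
  have : CompleteSpace X₀ := M.complete
  obtain ⟨C, hC0, hC⟩ := hg (2 * t0)
  refine clm_tendsto_of fun ε hε => ?_
  have hlim : Tendsto (fun r => C * M.δ r) (𝓝[>] 0) (𝓝 0) := by
    simpa using M.δ_lim.const_mul C
  obtain ⟨r, hr1, hr2⟩ := ((hlim.eventually (gt_mem_nhds (show 0 < ε / 4 by positivity))).and
    (Ioo_mem_nhdsGT h0)).exists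
  set η := r / 2 with hη
  have hr0 : 0 < r := hr2.1
  have hη0 : 0 < η := by positivity
  have hrt : r < t0 := hr2.2
  have hrη : r = 2 * η := by rw [hη]; ring
  set s0 := t0 - η with hs0
  have hs00 : 0 < s0 := by linarith
  have bd : ∀ t, s0 ≤ t → t ≤ t0 + η → ‖U t - (M.T (t - s0)).comp (U s0)‖ ≤ ε / 4 := by
    intro t h1 h2
    have := hC s0 (t - s0) hs00.le (by linarith) (by linarith)
    rw [add_sub_cancel] at this
    refine this.trans (le_trans ?_ hr1.le)
    exact mul_le_mul_of_nonneg_left (M.δ_mono (show 0 ≤ t - s0 by linarith) hr0.le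
      (by linarith)) hC0
  have hcont := (aux_compact_comp M.T_cont (U s0) (hc s0 hs00)).comp
    (f := fun t => t - s0) (s := Ici s0) (by fun_prop)
    (fun t (ht : s0 ≤ t) => show 0 ≤ t - s0 by linarith)
  have hat : ContinuousAt (fun t => (M.T (t - s0)).comp (U s0)) t0 :=
    hcont.continuousAt (Ici_mem_nhds (by linarith))
  have ev := clm_eventually hat (ε := ε / 4) (by positivity)
  refine eventually_nhdsWithin_of_eventually_nhds ?_
  filter_upwards [ev, Ioo_mem_nhds (show s0 < t0 by linarith) (show t0 < t0 + η by linarith)]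
    with t h1 h2
  have := clm_norm_tri (bd t h2.1.le h2.2.le) h1.le (bd t0 (by linarith) (by linarith))
  linarith

theorem Bop_compact {U : ℝ → (X₀ →L[ℂ] X₀)} (hU : ∀ x, ContinuousOn (fun t => U t x) (Ici 0))
    (hUn : ContinuousOn U (Ioi 0)) (hc : ∀ t : ℝ, 0 < t → IsCompactOperator ⇑(U t)) :
    ∀ t : ℝ, 0 < t → IsCompactOperator ⇑(M.Bop L U t) := by
  intro t ht
  obtain ⟨C, hC⟩ := M.trunc_le L hU t
  have hlim : Tendsto (fun r => C * M.δ r) (𝓝[>] 0) (𝓝 0) := by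
    simpa using M.δ_lim.const_mul C
  refine M.compact_of_approx fun ε hε => ?_
  obtain ⟨r, hr1, hr2⟩ := ((hlim.eventually (gt_mem_nhds hε)).and (Ioo_mem_nhdsGT ht)).exists
  refine ⟨M.Bop L (fun s => U (max s r)) t, ?_, ?_⟩
  · exact M.normcont_compact L (trunc_normcont hUn hr2.1) ht fun s _ =>
      hc _ (hr2.1.trans_le (le_max_right _ _))
  · rw [clm_norm_sub_rev]
    exact (hC r t hr2.1 hr2.2.le le_rfl).trans_lt hr1

theorem zero_iter {U : ℝ → (X₀ →L[ℂ] X₀)} (hU : ∀ x, ContinuousOn (fun t => U t x) (Ici 0))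
    {n : ℕ} (hn : 1 ≤ n) (x : X₀) : (M.Bop L)^[n] U 0 x = 0 := by
  obtain ⟨m, rfl⟩ := Nat.exists_eq_add_of_le' hn
  rw [Function.iterate_succ_apply', M.Bop_apply L (M.iter_sc L hU m)]
  exact M.bv_zero_time L (M.iter_sc L hU m x)

theorem C1_succ {U : ℝ → (X₀ →L[ℂ] X₀)} (hU : ∀ x, ContinuousOn (fun t => U t x) (Ici 0))
    (h0 : ∀ x, U 0 x = 0) (h : StronglyC1On U (Ici 0)) : StronglyC1On (M.Bop L U) (Ici 0) := by
  intro x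
  obtain ⟨g, hg, hd⟩ := h x
  refine ⟨M.bv L g, M.bv_cont L hg, fun t ht => ?_⟩
  simp only [M.Bop_apply L hU]
  exact M.bv_C1 L (hU x) hg hd (h0 x) t ht

theorem C1_sub {U V W : ℝ → (X₀ →L[ℂ] X₀)} (hU : StronglyC1On U (Ici 0))
    (hV : StronglyC1On V (Ici 0)) (h : ∀ t, 0 ≤ t → U t = W t + V t) :
    StronglyC1On W (Ici 0) := by
  intro x
  obtain ⟨g, hg, hd⟩ := hU x
  obtain ⟨g', hg', hd'⟩ := hV x
  refine ⟨fun t => g t - g' t, hg.sub hg', fun t ht => ?_⟩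
  refine ((hd t ht).sub (hd' t ht)).congr_of_mem (fun s hs => ?_) ht
  rw [Pi.sub_apply, h s hs, ContinuousLinearMap.add_apply, add_sub_cancel_right]

theorem C1_fix {U G : ℝ → (X₀ →L[ℂ] X₀)} (hU : ∀ x, ContinuousOn (fun t => U t x) (Ici 0))
    (h0 : ∀ x, G 0 x = 0) (hG : StronglyC1On G (Ici 0))
    (h : ∀ t, 0 ≤ t → U t = G t + M.Bop L U t) : StronglyC1On U (Ici 0) := by
  intro x
  obtain ⟨g, hg, hd⟩ := hG x
  refine M.bv_fix_C1 L (hU x) hg (a := fun t => G t x) (fun t ht => ?_) hd (h0 x)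
  rw [h t ht, ContinuousLinearMap.add_apply, M.Bop_apply L hU]

end good

end MRSetting

theorem aux_logic {pS pR : ℕ → Prop} {m n : ℕ} (hmn : m ≤ n)
    (hS : ∀ k, m ≤ k → pS k → pS (k + 1)) (hR : ∀ k, m ≤ k → pR k → pR (k + 1))
    (h1 : ∀ k, m ≤ k → (∀ j, pS (j + k)) → pR k)
    (h2 : ∀ k, m ≤ k → pR k → pR (k + 1) → pS k) :
    (pS n ↔ ∀ k, n ≤ k → pS k) ∧ (pS n ↔ pR n) ∧ (pS n ↔ ∀ k, n ≤ k → pR k) := by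
  have iS : pS n → ∀ k, n ≤ k → pS k := fun h k hk =>
    Nat.le_induction h (fun k hk => hS k (hmn.trans hk)) k hk
  have iR : pR n → ∀ k, n ≤ k → pR k := fun h k hk =>
    Nat.le_induction h (fun k hk => hR k (hmn.trans hk)) k hk
  have e : pS n ↔ pR n := ⟨fun h => h1 n hmn fun j => iS h _ (Nat.le_add_left _ _),
    fun h => h2 n hmn h (hR n hmn h)⟩
  exact ⟨⟨iS, fun h => h n le_rfl⟩, e, fun h => iR (e.1 h), fun h => e.2 (h n le_rfl)⟩

/-- for each regularity property `P`, the terms `Sₙ`, `Sₖ (k ≥ n)`, `Rₙ`,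
`Rₖ (k ≥ n)` all share property `P` simultaneously. -/
theorem Sn_Rn_equivalence (M : MRSetting X X₀) (L : X₀ →L[ℂ] X)
    (R : ℝ → (X₀ →L[ℂ] X₀))
    (hRsc : ∀ x : X₀, ContinuousOn (fun t => R t x) (Ici 0))
    (hRfix : ∀ t ∈ Ici (0:ℝ), R t = M.T t + M.Bop L R t)
    (n : ℕ) :
    -- `P` = norm continuity on `(0,∞)`
    ((ContinuousOn ((M.Bop L)^[n] M.T) (Ioi 0) ↔
        ∀ k : ℕ, n ≤ k → ContinuousOn ((M.Bop L)^[k] M.T) (Ioi 0)) ∧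
     (ContinuousOn ((M.Bop L)^[n] M.T) (Ioi 0) ↔
        ContinuousOn ((M.Bop L)^[n] R) (Ioi 0)) ∧
     (ContinuousOn ((M.Bop L)^[n] M.T) (Ioi 0) ↔
        ∀ k : ℕ, n ≤ k → ContinuousOn ((M.Bop L)^[k] R) (Ioi 0))) ∧
    -- `P` = compactness on `(0,∞)`
    (((∀ t : ℝ, 0 < t → IsCompactOperator ⇑((M.Bop L)^[n] M.T t)) ↔
        ∀ k : ℕ, n ≤ k → ∀ t : ℝ, 0 < t → IsCompactOperator ⇑((M.Bop L)^[k] M.T t)) ∧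
     ((∀ t : ℝ, 0 < t → IsCompactOperator ⇑((M.Bop L)^[n] M.T t)) ↔
        ∀ t : ℝ, 0 < t → IsCompactOperator ⇑((M.Bop L)^[n] R t)) ∧
     ((∀ t : ℝ, 0 < t → IsCompactOperator ⇑((M.Bop L)^[n] M.T t)) ↔
        ∀ k : ℕ, n ≤ k → ∀ t : ℝ, 0 < t → IsCompactOperator ⇑((M.Bop L)^[k] R t))) ∧
    -- `P` = strongly continuous differentiability on `[0,∞)`, for `n ≥ 1`
    (1 ≤ n →
      ((StronglyC1On ((M.Bop L)^[n] M.T) (Ici 0) ↔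
          ∀ k : ℕ, n ≤ k → StronglyC1On ((M.Bop L)^[k] M.T) (Ici 0)) ∧
       (StronglyC1On ((M.Bop L)^[n] M.T) (Ici 0) ↔
          StronglyC1On ((M.Bop L)^[n] R) (Ici 0)) ∧
       (StronglyC1On ((M.Bop L)^[n] M.T) (Ici 0) ↔
          ∀ k : ℕ, n ≤ k → StronglyC1On ((M.Bop L)^[k] R) (Ici 0)))) := by
  have hT := M.T_cont
  have fix : ∀ k t, 0 ≤ t → (M.Bop L)^[k] R t = (M.Bop L)^[k] M.T t + (M.Bop L)^[k + 1] R t :=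
    M.fix_iter L hT hRsc fun t ht => hRfix t ht
  have fix' : ∀ k t, 0 ≤ t →
      (M.Bop L)^[k] R t = (M.Bop L)^[k] M.T t + M.Bop L ((M.Bop L)^[k] R) t := by
    intro k t ht
    rw [← Function.iterate_succ_apply' (M.Bop L) k R]
    exact fix k t ht
  have sS := M.iter_sc L hT
  have sR := M.iter_sc L hRsc
  have gS := M.good_iter L hT M.good_T
  have gR := M.good_iter L hRsc (M.good_R L hRsc fun t ht => hRfix t ht)
  refine ⟨?_, ?_, fun hn => ?_⟩
  · refine aux_logic (pS := fun n => ContinuousOn ((M.Bop L)^[n] M.T) (Ioi 0))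
      (pR := fun n => ContinuousOn ((M.Bop L)^[n] R) (Ioi 0)) (Nat.zero_le n) ?_ ?_ ?_ ?_
    · intro k _ h
      rw [Function.iterate_succ_apply']
      exact M.Bop_normcont L (sS k) h
    · intro k _ h
      rw [Function.iterate_succ_apply']
      exact M.Bop_normcont L (sR k) h
    · intro k _ h
      refine M.series_normcont L (sS k) (sR k) (fix' k) fun j => ?_
      rw [← Function.iterate_add_apply]
      exact h j
    · intro k _ h h'
      refine (h.sub h').congr fun t ht => ?_
      rw [Pi.sub_apply, fix k t (le_of_lt ht), add_sub_cancel_right]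
  · refine aux_logic
      (pS := fun n => ∀ t : ℝ, 0 < t → IsCompactOperator ⇑((M.Bop L)^[n] M.T t))
      (pR := fun n => ∀ t : ℝ, 0 < t → IsCompactOperator ⇑((M.Bop L)^[n] R t))
      (Nat.zero_le n) ?_ ?_ ?_ ?_
    · intro k _ h
      rw [Function.iterate_succ_apply']
      exact M.Bop_compact L (sS k) (M.good_compact_normcont (gS k) h) h
    · intro k _ h
      rw [Function.iterate_succ_apply']
      exact M.Bop_compact L (sR k) (M.good_compact_normcont (gR k) h) h
    · intro k _ h
      refine M.series_compact L (sS k) (sR k) (fix' k) fun j => ?_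
      rw [← Function.iterate_add_apply]
      exact h j
    · intro k _ h h' t ht
      have e : (M.Bop L)^[k] M.T t = (M.Bop L)^[k] R t - (M.Bop L)^[k + 1] R t := by
        rw [fix k t ht.le, add_sub_cancel_right]
      rw [e]
      exact (h t ht).sub (h' t ht)
  · refine aux_logic (pS := fun n => StronglyC1On ((M.Bop L)^[n] M.T) (Ici 0))
      (pR := fun n => StronglyC1On ((M.Bop L)^[n] R) (Ici 0)) hn ?_ ?_ ?_ ?_
    · intro k hk h
      rw [Function.iterate_succ_apply']
      exact M.C1_succ L (sS k) (M.zero_iter L hT hk) h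
    · intro k hk h
      rw [Function.iterate_succ_apply']
      exact M.C1_succ L (sR k) (M.zero_iter L hRsc hk) h
    · intro k hk h
      have hk0 := h 0
      rw [Nat.zero_add] at hk0
      exact M.C1_fix L (sR k) (M.zero_iter L hT hk) hk0 (fix' k)
    · intro k _ h h'
      exact MRSetting.C1_sub h h' (fix k)

end
end

section
/- (a) T₀ is norm continuous on (0,∞) if and only if R₀ is norm continuous on (0,∞). (b) T₀(t) is a compact operator for every t > 0 if and only if R₀(t) is a compact operator for every t > 0. -/
open Set Filter MeasureTheory
open scoped Topology

noncomputable section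

variable {X : Type*} [NormedAddCommGroup X] [NormedSpace ℂ X] [CompleteSpace X]
  {X₀ : Submodule ℂ X}

/-- Abstract version of the setting, with `X₀` replaced by an arbitrary Banach space. -/
structure MRG (X Y : Type*) [NormedAddCommGroup X] [NormedSpace ℂ X] [CompleteSpace X]
    [NormedAddCommGroup Y] [NormedSpace ℂ Y] [CompleteSpace Y] where
  T : ℝ → (Y →L[ℂ] Y)
  S : ℝ → (X →L[ℂ] Y)
  T_add : ∀ t s : ℝ, 0 ≤ t → 0 ≤ s → T (t + s) = (T t).comp (T s)
  T_cont : ∀ x : Y, ContinuousOn (fun t => T t x) (Ici 0)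
  S_cont : ∀ x : X, ContinuousOn (fun t => S t x) (Ici 0)
  TS : ∀ t s : ℝ, 0 ≤ t → 0 ≤ s → ∀ x : X, T t (S s x) = S (t + s) x - S t x
  δ : ℝ → ℝ
  δ_nonneg : ∀ t : ℝ, 0 ≤ t → 0 ≤ δ t
  δ_mono : MonotoneOn δ (Ici 0)
  δ_lim : Tendsto δ (𝓝[>] 0) (𝓝 0)
  SD : (ℝ → X) → ℝ → Y
  SD_deriv : ∀ f : ℝ → X, ContinuousOn f (Ici 0) → ∀ t ∈ Ici (0:ℝ),
    HasDerivWithinAt (fun τ : ℝ => ∫ s in (0:ℝ)..τ, S (τ - s) (f s)) (SD f t) (Ici 0) t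
  SD_cont : ∀ f : ℝ → X, ContinuousOn f (Ici 0) → ContinuousOn (SD f) (Ici 0)
  SD_bound : ∀ f : ℝ → X, ContinuousOn f (Ici 0) → ∀ t ∈ Ici (0:ℝ),
    ‖SD f t‖ ≤ δ t * ⨆ s : Icc (0:ℝ) t, ‖f (s : ℝ)‖
  SDop : (ℝ → (Y →L[ℂ] X)) → ℝ → (Y →L[ℂ] Y)
  SDop_apply : ∀ V : ℝ → (Y →L[ℂ] X), (∀ x : Y, ContinuousOn (fun s => V s x) (Ici 0)) →
    ∀ t : ℝ, ∀ x : Y, SDop V t x = SD (fun s => V s x) t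

section abstractSetting
variable {X Y : Type*} [NormedAddCommGroup X] [NormedSpace ℂ X] [CompleteSpace X]
    [NormedAddCommGroup Y] [NormedSpace ℂ Y] [CompleteSpace Y]

/-- Strong continuity on `[0,∞)`. -/
def SC {E F : Type*} [NormedAddCommGroup E] [NormedSpace ℂ E] [NormedAddCommGroup F]
    [NormedSpace ℂ F] (U : ℝ → (E →L[ℂ] F)) : Prop :=
  ∀ x : E, ContinuousOn (fun t => U t x) (Ici 0)

section generic
variable {E F : Type*} [NormedAddCommGroup E] [NormedSpace ℂ E] [NormedAddCommGroup F]
    [NormedSpace ℂ F]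

theorem SC.bdd [CompleteSpace E] {U : ℝ → (E →L[ℂ] F)} (hU : SC U) (b : ℝ) :
    ∃ C : ℝ, 0 ≤ C ∧ ∀ t ∈ Icc (0:ℝ) b, ‖U t‖ ≤ C := by
  obtain ⟨C, hC⟩ := banach_steinhaus (g := fun i : Icc (0:ℝ) b => U i) (by
    intro x
    obtain ⟨C, hC⟩ := isCompact_Icc.exists_bound_of_continuousOn
      ((hU x).mono (Icc_subset_Ici_self : Icc (0:ℝ) b ⊆ Ici 0))
    exact ⟨C, fun i => hC i i.2⟩)
  exact ⟨max C 0, le_max_right _ _, fun t ht => (hC ⟨t, ht⟩).trans (le_max_left _ _)⟩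

theorem SC.joint [CompleteSpace E] {U : ℝ → (E →L[ℂ] F)} (hU : SC U) :
    ContinuousOn (fun p : ℝ × E => U p.1 p.2) (Ici 0 ×ˢ univ) := by
  rintro ⟨t, x⟩ ⟨ht, -⟩
  simp only [mem_Ici] at ht
  obtain ⟨C, hC0, hC⟩ := hU.bdd (t + 1)
  have h1 : Tendsto (fun p : ℝ × E => C * ‖p.2 - x‖ + ‖U p.1 x - U t x‖)
      (𝓝[Ici 0 ×ˢ univ] (t, x)) (𝓝 (C * ‖x - x‖ + ‖U t x - U t x‖)) := by
    apply Tendsto.add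
    · apply Tendsto.const_mul
      apply Tendsto.norm
      apply Tendsto.sub_const
      exact (continuous_snd.tendsto (t, x)).mono_left nhdsWithin_le_nhds
    · apply Tendsto.norm
      apply Tendsto.sub_const
      have : Tendsto (fun p : ℝ × E => p.1) (𝓝[Ici 0 ×ˢ univ] (t, x)) (𝓝[Ici 0] t) := by
        apply tendsto_nhdsWithin_of_tendsto_nhds_of_eventually_within
        · exact (continuous_fst.tendsto (t, x)).mono_left nhdsWithin_le_nhds
        · filter_upwards [self_mem_nhdsWithin] with p hp using hp.1
      exact (hU x t ht).tendsto.comp this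
  simp only [sub_self, norm_zero, mul_zero, add_zero] at h1
  unfold ContinuousWithinAt
  rw [tendsto_iff_norm_sub_tendsto_zero]
  refine squeeze_zero' (Eventually.of_forall fun _ => norm_nonneg _) ?_ h1
  have h2 : ∀ᶠ p : ℝ × E in 𝓝[Ici 0 ×ˢ univ] (t, x), p.1 < t + 1 := by
    apply nhdsWithin_le_nhds
    exact (continuous_fst.tendsto (t, x)).eventually (gt_mem_nhds (by simp))
  filter_upwards [h2, self_mem_nhdsWithin] with p hp hp'
  have hp1 : 0 ≤ p.1 := hp'.1
  calc ‖U p.1 p.2 - U t x‖ = ‖U p.1 (p.2 - x) + (U p.1 x - U t x)‖ := by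
        rw [map_sub]; congr 1; abel
    _ ≤ ‖U p.1 (p.2 - x)‖ + ‖U p.1 x - U t x‖ := norm_add_le _ _
    _ ≤ _ := by
        gcongr
        exact (U p.1).le_of_opNorm_le (hC _ ⟨hp1, hp.le⟩) _

theorem SC.comp_apply [CompleteSpace E] {U : ℝ → (E →L[ℂ] F)} (hU : SC U) {f : ℝ → E}
    {g : ℝ → ℝ} {s : Set ℝ}
    (hf : ContinuousOn f s) (hg : ContinuousOn g s) (hgs : ∀ x ∈ s, 0 ≤ g x) :
    ContinuousOn (fun t => U (g t) (f t)) s :=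
  hU.joint.comp (hg.prodMk hf) (fun x hx => ⟨hgs x hx, trivial⟩)

theorem SC.comp_compact [CompleteSpace E] {G : Type*} [NormedAddCommGroup G] [NormedSpace ℂ G]
    {U : ℝ → (E →L[ℂ] F)} (hU : SC U) {K : G →L[ℂ] E} (hK : IsCompactOperator ⇑K) :
    ContinuousOn (fun t => (U t).comp K) (Ici 0) := by
  obtain ⟨k, hk, hKk⟩ := IsCompactOperator.image_closedBall_subset_compact
    (f := (K : G →ₗ[ℂ] E)) hK 1
  intro t ht
  rw [ContinuousWithinAt, Metric.tendsto_nhds]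
  intro ε hε
  obtain ⟨v, hv, hvk⟩ := hk.mem_uniformity_of_prod (f := fun t x => U t x) (s := Ici 0) (q := t)
    (hU.joint.mono (prod_mono subset_rfl (subset_univ _))) ht
    (Metric.dist_mem_uniformity (half_pos hε))
  filter_upwards [hv] with p hp
  rw [dist_eq_norm]
  refine lt_of_le_of_lt ?_ (half_lt_self hε)
  refine ContinuousLinearMap.opNorm_le_of_unit_norm (half_pos hε).le ?_
  intro x hx
  have := hvk p hp (K x) (hKk ⟨x, by simp [hx], rfl⟩)
  simp only [mem_ofPred_eq, dist_eq_norm] at this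
  simpa using this.le

theorem SC.of_norm {U : ℝ → (E →L[ℂ] F)} (hU : ContinuousOn U (Ici 0)) : SC U :=
  fun _ => hU.clm_apply continuousOn_const

theorem SC.shift {U : ℝ → (E →L[ℂ] F)} (hU : SC U) {a : ℝ} (ha : 0 ≤ a) :
    SC (fun t => U (a + t)) := fun x =>
  (hU x).comp (f := fun t => a + t) (by fun_prop) (fun t ht => add_nonneg ha ht)

theorem SC.add {U V : ℝ → (E →L[ℂ] F)} (hU : SC U) (hV : SC V) : SC (fun t => U t + V t) :=
  fun x => (hU x).add (hV x)

theorem SC.sub {U V : ℝ → (E →L[ℂ] F)} (hU : SC U) (hV : SC V) : SC (fun t => U t - V t) :=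
  fun x => (hU x).sub (hV x)

theorem SC.comp_left {G : Type*} [NormedAddCommGroup G] [NormedSpace ℂ G]
    {U : ℝ → (E →L[ℂ] F)} (hU : SC U) (L : F →L[ℂ] G) : SC (fun t => L.comp (U t)) :=
  fun x => L.continuous.comp_continuousOn (hU x)

theorem SC.comp_right {G : Type*} [NormedAddCommGroup G] [NormedSpace ℂ G]
    {U : ℝ → (E →L[ℂ] F)} (hU : SC U) (L : G →L[ℂ] E) : SC (fun t => (U t).comp L) :=
  fun x => hU (L x)

end generic

namespace MRG


theorem δ_zero (M : MRG X Y) : M.δ 0 = 0 := by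
  refine le_antisymm ?_ (M.δ_nonneg 0 le_rfl)
  refine ge_of_tendsto M.δ_lim ?_
  filter_upwards [self_mem_nhdsWithin] with t ht
  exact M.δ_mono (by simp) (le_of_lt ht : (0:ℝ) ≤ t) (le_of_lt ht)

theorem δ_small (M : MRG X Y) {ε : ℝ} (hε : 0 < ε) :
    ∃ τ : ℝ, 0 < τ ∧ ∀ t ∈ Icc 0 τ, M.δ t < ε := by
  have h := (M.δ_lim.eventually (gt_mem_nhds hε)).and self_mem_nhdsWithin
  obtain ⟨τ, h1, h2⟩ := h.exists
  exact ⟨τ, h2, fun t ht => (M.δ_mono ht.1 (le_of_lt h2 : (0:ℝ) ≤ τ) ht.2).trans_lt h1⟩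

theorem cont_conv (M : MRG X Y) {f : ℝ → X} (hf : ContinuousOn f (Ici 0)) (τ : ℝ) :
    ContinuousOn (fun s => M.S (τ - s) (f s)) (Icc 0 τ) :=
  SC.comp_apply (U := M.S) M.S_cont (hf.mono Icc_subset_Ici_self) (by fun_prop)
    (fun x hx => sub_nonneg.2 hx.2)

theorem int_conv (M : MRG X Y) {f : ℝ → X} (hf : ContinuousOn f (Ici 0)) {τ : ℝ}
    (hτ : 0 ≤ τ) : IntervalIntegrable (fun s => M.S (τ - s) (f s)) volume 0 τ :=
  (M.cont_conv hf τ).intervalIntegrable_of_Icc hτ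

theorem SD_unique (M : MRG X Y) {f : ℝ → X} (hf : ContinuousOn f (Ici 0)) {t : ℝ}
    (ht : 0 ≤ t) {G : ℝ → Y} {y : Y}
    (hG : HasDerivWithinAt G y (Ici 0) t)
    (h : ∀ τ, 0 ≤ τ → ∫ s in (0:ℝ)..τ, M.S (τ - s) (f s) = G τ) :
    M.SD f t = y := by
  have h1 := M.SD_deriv f hf t ht
  have h2 := hG.congr (f₁ := fun τ : ℝ => ∫ s in (0:ℝ)..τ, M.S (τ - s) (f s))
    (fun x hx => h x hx) (h t ht)
  exact UniqueDiffWithinAt.eq_deriv _ (uniqueDiffOn_Ici (0:ℝ) t ht) h1 h2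

theorem SD_add (M : MRG X Y) {f g : ℝ → X} (hf : ContinuousOn f (Ici 0))
    (hg : ContinuousOn g (Ici 0)) {t : ℝ} (ht : 0 ≤ t) :
    M.SD (fun s => f s + g s) t = M.SD f t + M.SD g t := by
  refine M.SD_unique (f := fun s => f s + g s) (hf.add hg) ht ((M.SD_deriv f hf t ht).add (M.SD_deriv g hg t ht)) ?_
  intro τ hτ
  simp only [map_add]
  exact intervalIntegral.integral_add (M.int_conv hf hτ) (M.int_conv hg hτ)

theorem SD_smul (M : MRG X Y) {f : ℝ → X} (hf : ContinuousOn f (Ici 0)) (c : ℂ)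
    {t : ℝ} (ht : 0 ≤ t) :
    M.SD (fun s => c • f s) t = c • M.SD f t := by
  refine M.SD_unique (f := fun s => c • f s) (hf.const_smul c) ht ((M.SD_deriv f hf t ht).const_smul c) ?_
  intro τ hτ
  simp only [map_smul]
  exact intervalIntegral.integral_smul _ _

theorem SD_sub (M : MRG X Y) {f g : ℝ → X} (hf : ContinuousOn f (Ici 0))
    (hg : ContinuousOn g (Ici 0)) {t : ℝ} (ht : 0 ≤ t) :
    M.SD (fun s => f s - g s) t = M.SD f t - M.SD g t := by
  have h1 := M.SD_add (g := fun s => (-1 : ℂ) • g s) hf (hg.const_smul (-1 : ℂ)) ht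
  rw [M.SD_smul hg (-1) ht] at h1
  simpa [sub_eq_add_neg] using h1

theorem SD_le (M : MRG X Y) {f : ℝ → X} (hf : ContinuousOn f (Ici 0))
    {t : ℝ} (ht : 0 ≤ t) {C : ℝ} (hC : ∀ s ∈ Icc 0 t, ‖f s‖ ≤ C) :
    ‖M.SD f t‖ ≤ M.δ t * C := by
  refine (M.SD_bound f hf t ht).trans ?_
  have : Nonempty (Icc (0:ℝ) t) := ⟨⟨0, le_rfl, ht⟩⟩
  exact mul_le_mul_of_nonneg_left (ciSup_le fun s => hC s s.2) (M.δ_nonneg t ht)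

theorem conv_shift (M : MRG X Y) {f : ℝ → X} (hf : ContinuousOn f (Ici 0))
    {h k : ℝ} (hh : 0 ≤ h) (hk : 0 ≤ k) :
    ∫ s in (0:ℝ)..(k + h), M.S (k + h - s) (f s) =
      M.T k (∫ s in (0:ℝ)..h, M.S (h - s) (f s)) + M.S k (∫ s in (0:ℝ)..h, f s)
        + ∫ s in (0:ℝ)..k, M.S (k - s) (f (h + s)) := by
  have hi := M.int_conv hf (add_nonneg hk hh)
  have hfi : IntervalIntegrable f volume 0 h :=
    (hf.mono Icc_subset_Ici_self).intervalIntegrable_of_Icc hh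
  have hI := M.cont_conv hf (k + h)
  rw [← intervalIntegral.integral_add_adjacent_intervals (b := h)
    ((hI.mono (Icc_subset_Icc_right (by linarith))).intervalIntegrable_of_Icc hh)
    ((hI.mono (Icc_subset_Icc_left hh)).intervalIntegrable_of_Icc (by linarith))]
  congr 1
  · rw [← ContinuousLinearMap.intervalIntegral_comp_comm _ (M.int_conv hf hh),
      ← ContinuousLinearMap.intervalIntegral_comp_comm _ hfi,
      ← intervalIntegral.integral_add]
    · apply intervalIntegral.integral_congr
      intro s hs
      rw [uIcc_of_le hh] at hs
      have := M.TS k (h - s) hk (sub_nonneg.2 hs.2) (f s)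
      simp only [this]
      rw [show k + (h - s) = k + h - s by ring]
      abel
    · exact ((M.T k).continuous.comp_continuousOn (M.cont_conv hf h)).intervalIntegrable_of_Icc hh
    · exact ((M.S k).continuous.comp_continuousOn
        (hf.mono Icc_subset_Ici_self)).intervalIntegrable_of_Icc hh
  · have := intervalIntegral.integral_comp_add_left (a := 0) (b := k)
      (fun s => M.S (k + h - s) (f s)) h
    rw [add_zero, add_comm h k] at this
    rw [← this]
    apply intervalIntegral.integral_congr
    intro s _
    simp only
    rw [show k + h - (h + s) = k - s by ring]

theorem shiftC {f : ℝ → X} (hf : ContinuousOn f (Ici 0)) {h : ℝ} (hh : 0 ≤ h) :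
    ContinuousOn (fun s => f (h + s)) (Ici 0) :=
  hf.comp (f := fun t => h + t) (by fun_prop) (fun t ht => add_nonneg hh ht)

theorem SD_zero_time (M : MRG X Y) {f : ℝ → X} (hf : ContinuousOn f (Ici 0)) :
    M.SD f 0 = 0 := by
  have := M.SD_bound f hf 0 (by simp)
  rw [M.δ_zero, zero_mul] at this
  exact norm_le_zero_iff.1 this

theorem SD_shift (M : MRG X Y) {f : ℝ → X} (hf : ContinuousOn f (Ici 0))
    {h t : ℝ} (hh : 0 ≤ h) (ht : 0 ≤ t) :
    M.SD f (t + h) = M.T t (M.SD f h) + M.SD (fun s => f (h + s)) t := by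
  have hfh := shiftC hf hh
  set F : ℝ → Y := fun τ => ∫ s in (0:ℝ)..τ, M.S (τ - s) (f s) with hF
  set G : ℝ → Y := fun τ => ∫ s in (0:ℝ)..τ, M.S (τ - s) (f (h + s)) with hG
  have dF : ∀ a, 0 ≤ a → HasDerivWithinAt (fun k : ℝ => F (a + k)) (M.SD f a) (Ici 0) 0 := by
    intro a ha
    have h1 : HasDerivWithinAt F (M.SD f a) (Ici 0) (a + 0) := by
      rw [add_zero]; exact M.SD_deriv f hf a ha
    have h2 := h1.scomp (0:ℝ) (h := fun k : ℝ => a + k) (s := Ici 0)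
      ((hasDerivWithinAt_id _ _).const_add a) (fun k hk => add_nonneg ha hk)
    simpa [Function.comp_def] using h2
  have dG : ∀ a, 0 ≤ a → HasDerivWithinAt (fun k : ℝ => G (a + k))
      (M.SD (fun s => f (h + s)) a) (Ici 0) 0 := by
    intro a ha
    have h1 : HasDerivWithinAt G (M.SD (fun s => f (h + s)) a) (Ici 0) (a + 0) := by
      rw [add_zero]; exact M.SD_deriv _ hfh a ha
    have h2 := h1.scomp (0:ℝ) (h := fun k : ℝ => a + k) (s := Ici 0)
      ((hasDerivWithinAt_id _ _).const_add a) (fun k hk => add_nonneg ha hk)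
    simpa [Function.comp_def] using h2
  have d1 := (dF (t + h) (by positivity)).sub (dG t ht)
  have d2 := (dF h hh).sub (dG 0 le_rfl)
  have d3 := (((M.T t).restrictScalars ℝ).hasFDerivAt.comp_hasDerivWithinAt (0:ℝ) d2).add_const
    (M.S t (∫ s in (0:ℝ)..h, f s))
  have key : ∀ k ∈ Ici (0:ℝ), F (t + h + k) - G (t + k) =
      M.T t (F (h + k) - G (0 + k)) + M.S t (∫ s in (0:ℝ)..h, f s) := by
    intro k hk
    have hk : 0 ≤ k := hk
    have e1 := M.conv_shift hf hh (add_nonneg ht hk)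
    have e2 := M.conv_shift hf hh hk
    have e3 := M.T_add t k ht hk
    have e4 := M.TS t k ht hk (∫ s in (0:ℝ)..h, f s)
    simp only [hF, hG]
    rw [show t + h + k = t + k + h by ring, show h + k = k + h by ring, e1, e2, e3, zero_add]
    simp only [add_sub_cancel_right, map_add, e4, ContinuousLinearMap.comp_apply]
    abel
  have d4 := d3.congr (f₁ := fun k => F (t + h + k) - G (t + k)) key (key 0 (by simp))
  have := UniqueDiffWithinAt.eq_deriv _ (uniqueDiffOn_Ici (0:ℝ) 0 (by simp)) d1 d4
  rw [M.SD_zero_time hfh, sub_zero] at this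
  exact sub_eq_iff_eq_add.1 this

end MRG

theorem bernstein_aux {E : Type*} [NormedAddCommGroup E] [NormedSpace ℝ E] {f : ℝ → E}
    (hf : ContinuousOn f (Icc 0 1)) (e : ℝ) (he : 0 < e) :
    ∃ n : ℕ, ∃ z : Fin (n + 1) → ℝ, (∀ k, z k ∈ Icc (0:ℝ) 1) ∧ ∀ x ∈ Icc (0:ℝ) 1,
      ‖f x - ∑ k : Fin (n + 1),
        ((n.choose k : ℝ) * x ^ (k : ℕ) * (1 - x) ^ (n - k)) • f (z k)‖ < e := by
  let F : C(unitInterval, E) := ⟨fun x => f x, hf.restrict⟩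
  have hb := Metric.tendsto_atTop.1 (bernsteinApproximation_uniform F) e he
  obtain ⟨n, hn⟩ := hb
  refine ⟨n, fun k => bernstein.z k, fun k => (bernstein.z k).2, fun x hx => ?_⟩
  have h1 := (ContinuousMap.dist_apply_le_dist (f := bernsteinApproximation n F) (g := F)
    ⟨x, hx⟩).trans_lt (hn n le_rfl)
  rw [dist_comm, dist_eq_norm, bernsteinApproximation.apply] at h1
  simp only [bernstein_apply] at h1
  exact h1

namespace MRG

theorem SDop_le (M : MRG X Y) {V : ℝ → (Y →L[ℂ] X)} (hV : SC V)
    {t : ℝ} (ht : 0 ≤ t) {C : ℝ} (hC : ∀ s ∈ Icc 0 t, ‖V s‖ ≤ C) :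
    ‖M.SDop V t‖ ≤ M.δ t * C := by
  have hC0 : 0 ≤ C := (norm_nonneg _).trans (hC 0 ⟨le_rfl, ht⟩)
  refine ContinuousLinearMap.opNorm_le_bound _ (mul_nonneg (M.δ_nonneg t ht) hC0) fun x => ?_
  rw [M.SDop_apply V hV, mul_assoc]
  exact M.SD_le (hV x) ht fun s hs => (V s).le_of_opNorm_le (hC s hs) x

theorem SDop_SC (M : MRG X Y) {V : ℝ → (Y →L[ℂ] X)} (hV : SC V) : SC (M.SDop V) := by
  intro x
  simp only [M.SDop_apply V hV]
  exact M.SD_cont _ (hV x)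

theorem SDop_add (M : MRG X Y) {V W : ℝ → (Y →L[ℂ] X)} (hV : SC V) (hW : SC W)
    {t : ℝ} (ht : 0 ≤ t) :
    M.SDop (fun s => V s + W s) t = M.SDop V t + M.SDop W t := by
  ext1 x
  rw [add_apply, M.SDop_apply _ (hV.add hW), M.SDop_apply V hV,
    M.SDop_apply W hW]
  exact M.SD_add (hV x) (hW x) ht

theorem SDop_sub (M : MRG X Y) {V W : ℝ → (Y →L[ℂ] X)} (hV : SC V) (hW : SC W)
    {t : ℝ} (ht : 0 ≤ t) :
    M.SDop (fun s => V s - W s) t = M.SDop V t - M.SDop W t := by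
  ext1 x
  rw [sub_apply, M.SDop_apply _ (hV.sub hW), M.SDop_apply V hV,
    M.SDop_apply W hW]
  exact M.SD_sub (hV x) (hW x) ht

theorem SDop_shift (M : MRG X Y) {V : ℝ → (Y →L[ℂ] X)} (hV : SC V)
    {h t : ℝ} (hh : 0 ≤ h) (ht : 0 ≤ t) :
    M.SDop V (t + h) = (M.T t).comp (M.SDop V h) + M.SDop (fun s => V (h + s)) t := by
  ext1 x
  rw [add_apply, ContinuousLinearMap.comp_apply, M.SDop_apply _ (hV.shift hh),
    M.SDop_apply V hV, M.SDop_apply V hV]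
  exact M.SD_shift (hV x) hh ht

theorem SDop_nc0 (M : MRG X Y) {V : ℝ → (Y →L[ℂ] X)} (hV : ContinuousOn V (Ici 0)) :
    ContinuousOn (M.SDop V) (Ici 0) := by
  have hS := SC.of_norm hV
  have main : ∀ b : ℝ, 0 ≤ b → ∀ ε > 0, ∃ η > 0, ∀ t ∈ Icc 0 b, ∀ t' ∈ Icc 0 b, t ≤ t' →
      t' - t < η → ‖M.SDop V t' - M.SDop V t‖ < ε := by
    intro b hb ε hε
    obtain ⟨C, hC0, hC⟩ := SC.bdd (U := M.T) M.T_cont b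
    obtain ⟨D, hD0, hD⟩ := hS.bdd b
    have hu := isCompact_Icc.uniformContinuousOn_of_continuous
      (hV.mono (Icc_subset_Ici_self : Icc (0:ℝ) b ⊆ Ici 0))
    rw [Metric.uniformContinuousOn_iff] at hu
    have hδb := M.δ_nonneg b hb
    obtain ⟨η₁, hη₁, h1⟩ := hu (ε / (2 * (M.δ b + 1))) (by positivity)
    obtain ⟨η₂, hη₂, h2⟩ := M.δ_small (ε := ε / (2 * (C * D + 1))) (by positivity)
    refine ⟨min η₁ η₂, lt_min hη₁ hη₂, ?_⟩
    intro t ht t' ht' htt hlt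
    have e1 := M.SDop_shift hS (h := t' - t) (sub_nonneg.2 htt) ht.1
    rw [add_sub_cancel] at e1
    have hSh := hS.shift (sub_nonneg.2 htt)
    have e2 := M.SDop_sub hSh hS ht.1
    have e3 : M.SDop V t' - M.SDop V t = (M.T t).comp (M.SDop V (t' - t)) +
        M.SDop (fun s => V (t' - t + s) - V s) t := by rw [e1, e2]; abel
    have b1 : ‖M.SDop V (t' - t)‖ ≤ ε / (2 * (C * D + 1)) * D := by
      refine (M.SDop_le hS (sub_nonneg.2 htt) (C := D) fun s hs => hD s
        ⟨hs.1, by linarith [hs.2, ht.1, ht'.2]⟩).trans ?_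
      gcongr
      exact (h2 _ ⟨sub_nonneg.2 htt, (hlt.trans_le (min_le_right _ _)).le⟩).le
    have b2 : ‖M.SDop (fun s => V (t' - t + s) - V s) t‖ ≤ M.δ t * (ε / (2 * (M.δ b + 1))) := by
      refine M.SDop_le (hSh.sub hS) ht.1 fun s hs => ?_
      have := h1 (t' - t + s) ⟨by linarith [hs.1], by linarith [hs.2, ht'.2]⟩ s
        ⟨hs.1, hs.2.trans ht.2⟩ (by
          rw [Real.dist_eq, add_sub_cancel_right, abs_of_nonneg (sub_nonneg.2 htt)]
          exact hlt.trans_le (min_le_left _ _))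
      rw [dist_eq_norm] at this
      exact this.le
    have b3 : M.δ t ≤ M.δ b := M.δ_mono ht.1 hb ht.2
    have b4 : M.δ t * (ε / (2 * (M.δ b + 1))) < ε / 2 := by
      calc M.δ t * (ε / (2 * (M.δ b + 1))) ≤ M.δ b * (ε / (2 * (M.δ b + 1))) := by gcongr
        _ < ε / 2 := by
          rw [mul_div_assoc', div_lt_div_iff₀ (by positivity) (by positivity)]
          nlinarith
    have b5 : ‖(M.T t).comp (M.SDop V (t' - t))‖ ≤ C * (ε / (2 * (C * D + 1)) * D) :=
      (ContinuousLinearMap.opNorm_comp_le _ _).trans (by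
        gcongr
        exact hC t ht)
    have b6 : C * (ε / (2 * (C * D + 1)) * D) ≤ ε / 2 := by
      have : 0 ≤ C * D := by positivity
      rw [show C * (ε / (2 * (C * D + 1)) * D) = (C * D * ε) / (2 * (C * D + 1)) by ring,
        div_le_div_iff₀ (by positivity) (by positivity)]
      nlinarith
    rw [e3]
    refine (norm_add_le _ _).trans_lt ?_
    linarith
  intro t ht
  rw [ContinuousWithinAt, Metric.tendsto_nhds]
  intro ε hε
  have ht : 0 ≤ t := ht
  obtain ⟨η, hη, h⟩ := main (t + 1) (by positivity) ε hε
  have : Ioo (t - min η 1) (t + min η 1) ∈ 𝓝[Ici 0] t :=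
    nhdsWithin_le_nhds (Ioo_mem_nhds (by simp [hη]) (by simp [hη]))
  filter_upwards [this, self_mem_nhdsWithin] with s hs hs0
  have hs0 : 0 ≤ s := hs0
  have m1 := min_le_left η 1
  have m2 := min_le_right η 1
  rw [dist_eq_norm]
  rcases le_total t s with hts | hts
  · exact h t ⟨ht, by linarith⟩ s ⟨hs0, by linarith [hs.2]⟩ hts (by linarith [hs.2])
  · rw [norm_sub_rev]
    exact h s ⟨hs0, by linarith [hs.2]⟩ t ⟨ht, by linarith⟩ hts (by linarith [hs.1])

theorem SDop_approx (M : MRG X Y) {V : ℝ → (Y →L[ℂ] X)} (hV : SC V) (b : ℝ)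
    {r e : ℝ} (hr : 0 < r) (he : 0 < e) :
    ∃ ε, 0 < ε ∧ ε < r ∧ ∀ t ∈ Icc ε b,
      ‖M.SDop V t - M.SDop (fun s => V (ε + s)) (t - ε)‖ < e := by
  obtain ⟨C, hC0, hC⟩ := SC.bdd (U := M.T) M.T_cont b
  obtain ⟨D, hD0, hD⟩ := hV.bdd b
  obtain ⟨η, hη, h2⟩ := M.δ_small (ε := e / (C * D + 1)) (by positivity)
  have hm : 0 < min η (r / 2) := lt_min hη (by positivity)
  refine ⟨min η (r / 2), hm, (min_le_right _ _).trans_lt (half_lt_self hr), ?_⟩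
  intro t ht
  have hlt := h2 _ ⟨hm.le, min_le_left _ _⟩
  generalize min η (r / 2) = ε at *
  have e1 := M.SDop_shift hV hm.le (t := t - ε) (sub_nonneg.2 ht.1)
  rw [sub_add_cancel] at e1
  rw [e1, add_sub_cancel_right]
  have b1 : ‖M.SDop V ε‖ ≤ e / (C * D + 1) * D := by
    refine (M.SDop_le hV hm.le (C := D) fun s hs => hD s ⟨hs.1, hs.2.trans
      (ht.1.trans ht.2)⟩).trans ?_
    gcongr
  have b5 : ‖(M.T (t - ε)).comp (M.SDop V ε)‖ ≤ C * (e / (C * D + 1) * D) :=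
    (ContinuousLinearMap.opNorm_comp_le _ _).trans (by
      gcongr
      exact hC _ ⟨sub_nonneg.2 ht.1, by linarith [ht.2]⟩)
  refine b5.trans_lt ?_
  have : 0 ≤ C * D := by positivity
  rw [show C * (e / (C * D + 1) * D) = (C * D * e) / (C * D + 1) by ring,
    div_lt_iff₀ (by positivity)]
  nlinarith

theorem shift_nc {V : ℝ → (Y →L[ℂ] X)} (hV : ContinuousOn V (Ioi 0)) {ε : ℝ} (hε : 0 < ε) :
    ContinuousOn (fun s => V (ε + s)) (Ici 0) :=
  hV.comp (f := fun t => ε + t) (by fun_prop) (fun _ ht => add_pos_of_pos_of_nonneg hε ht)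

theorem SDop_nc (M : MRG X Y) {V : ℝ → (Y →L[ℂ] X)} (hS : SC V)
    (hV : ContinuousOn V (Ioi 0)) : ContinuousOn (M.SDop V) (Ioi 0) := by
  refine continuousOn_of_locally_uniform_approx_of_continuousWithinAt ?_
  intro t ht u hu
  have ht : 0 < t := ht
  obtain ⟨e, he, heu⟩ := Metric.mem_uniformity_dist.1 hu
  obtain ⟨ε, hε, hεt, h⟩ := M.SDop_approx hS (t + 1) ht he
  refine ⟨Icc ε (t + 1), nhdsWithin_le_nhds (Icc_mem_nhds hεt (by simp)),
    fun t => M.SDop (fun s => V (ε + s)) (t - ε), ?_, fun y hy => heu ?_⟩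
  · have h1 := (M.SDop_nc0 (shift_nc hV hε)).continuousAt (x := t - ε)
      (Ici_mem_nhds (sub_pos.2 hεt))
    exact (ContinuousAt.comp (f := fun t => t - ε) h1 (by fun_prop)).continuousWithinAt
  · rw [dist_eq_norm]
    exact h y hy

theorem SDop_zero (M : MRG X Y) {t : ℝ} (ht : 0 ≤ t) :
    M.SDop (fun _ => 0) t = 0 := by
  have := M.SDop_le (V := fun _ => 0) (fun x => continuousOn_const) ht (C := 0) (by simp)
  rw [mul_zero] at this
  exact norm_le_zero_iff.1 this

theorem SDop_single_compact (M : MRG X Y) {φ : ℝ → ℝ} (hφ : Continuous φ)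
    {K : Y →L[ℂ] X} (hK : IsCompactOperator ⇑K) {t : ℝ} (ht : 0 ≤ t) :
    IsCompactOperator ⇑(M.SDop (fun s => φ s • K) t) := by
  have hc : ∀ y : X, ContinuousOn (fun s => φ s • y) (Ici 0) := fun y => by fun_prop
  obtain ⟨C, hC⟩ := isCompact_Icc.exists_bound_of_continuousOn (hφ.continuousOn (s := Icc 0 t))
  let G : X →L[ℂ] Y := LinearMap.mkContinuous
    { toFun := fun y => M.SD (fun s => φ s • y) t
      map_add' := fun y z => by
        rw [← M.SD_add (hc y) (hc z) ht]
        simp only [smul_add]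
      map_smul' := fun c y => by
        rw [RingHom.id_apply, ← M.SD_smul (hc y) c ht]
        simp only [smul_comm c] } (M.δ t * C) (by
      intro y
      rw [mul_assoc]
      refine M.SD_le (hc y) ht fun s hs => ?_
      rw [norm_smul]
      gcongr
      exact hC s hs)
  have : M.SDop (fun s => φ s • K) t = G.comp K := by
    ext1 x
    rw [M.SDop_apply _ (fun x => hc (K x))]
    rfl
  rw [this]
  exact hK.clm_comp G

theorem SDop_sum_compact (M : MRG X Y) {ι : Type*} (A : Finset ι) {φ : ι → ℝ → ℝ}
    (hφ : ∀ i, Continuous (φ i)) {K : ι → (Y →L[ℂ] X)} (hK : ∀ i, IsCompactOperator ⇑(K i))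
    {t : ℝ} (ht : 0 ≤ t) :
    IsCompactOperator ⇑(M.SDop (fun s => ∑ i ∈ A, φ i s • K i) t) := by
  classical
  have hc : ∀ i, ContinuousOn (fun s => φ i s • K i) (Ici 0) := fun i =>
    ((hφ i).smul continuous_const).continuousOn
  induction A using Finset.induction_on with
  | empty =>
    simp only [Finset.sum_empty]
    rw [M.SDop_zero ht]
    exact isCompactOperator_zero
  | insert i A hi ih =>
    simp only [Finset.sum_insert hi]
    rw [M.SDop_add (SC.of_norm (hc i)) (SC.of_norm (continuousOn_finsetSum _ fun j _ => hc j)) ht]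
    exact (M.SDop_single_compact (hφ i) (hK i) ht).add ih

theorem SDop_compact0 (M : MRG X Y) {V : ℝ → (Y →L[ℂ] X)} (hV : ContinuousOn V (Ici 0))
    (hK : ∀ t, 0 ≤ t → IsCompactOperator ⇑(V t)) {t : ℝ} (ht : 0 < t) :
    IsCompactOperator ⇑(M.SDop V t) := by
  have hS := SC.of_norm hV
  have hcl : IsClosed {A : Y →L[ℂ] Y | IsCompactOperator ⇑A} :=
    isClosed_setOfPred_isCompactOperator
  change M.SDop V t ∈ {A : Y →L[ℂ] Y | IsCompactOperator ⇑A}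
  rw [← hcl.closure_eq, Metric.mem_closure_iff]
  intro e he
  have hδ := M.δ_nonneg t ht.le
  obtain ⟨n, z, hz, hn⟩ := bernstein_aux (f := fun x => V (t * x))
    (hV.comp (by fun_prop) (fun x hx => mul_nonneg ht.le hx.1)) (e / (M.δ t + 1)) (by positivity)
  let W : ℝ → (Y →L[ℂ] X) := fun s => ∑ k : Fin (n + 1),
    ((n.choose k : ℝ) * (s / t) ^ (k : ℕ) * (1 - s / t) ^ (n - k)) • V (t * z k)
  have hWc : ContinuousOn W (Ici 0) := by
    refine continuousOn_finsetSum _ fun k _ => ?_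
    exact (Continuous.smul (f := fun s : ℝ =>
      (n.choose k : ℝ) * (s / t) ^ (k : ℕ) * (1 - s / t) ^ (n - k)) (by fun_prop)
      continuous_const).continuousOn
  refine ⟨M.SDop W t, ?_, ?_⟩
  · refine M.SDop_sum_compact _ (fun k => by fun_prop) (fun k => ?_) ht.le
    exact hK _ (mul_nonneg ht.le (hz k).1)
  · rw [dist_eq_norm, ← M.SDop_sub hS (SC.of_norm hWc) ht.le]
    refine (M.SDop_le (C := e / (M.δ t + 1)) (hS.sub (SC.of_norm hWc)) ht.le
      fun s hs => ?_).trans_lt ?_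
    · have := hn (s / t) ⟨div_nonneg hs.1 ht.le, div_le_one_of_le₀ hs.2 ht.le⟩
      rw [mul_div_cancel₀ _ ht.ne'] at this
      exact this.le
    · rw [mul_div_assoc', div_lt_iff₀ (by positivity)]
      nlinarith

theorem SDop_compact (M : MRG X Y) {V : ℝ → (Y →L[ℂ] X)} (hS : SC V)
    (hV : ContinuousOn V (Ioi 0))
    (hK : ∀ t, 0 < t → IsCompactOperator ⇑(V t)) {t : ℝ} (ht : 0 < t) :
    IsCompactOperator ⇑(M.SDop V t) := by
  have hcl : IsClosed {A : Y →L[ℂ] Y | IsCompactOperator ⇑A} :=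
    isClosed_setOfPred_isCompactOperator
  change M.SDop V t ∈ {A : Y →L[ℂ] Y | IsCompactOperator ⇑A}
  rw [← hcl.closure_eq, Metric.mem_closure_iff]
  intro e he
  obtain ⟨ε, hε, hεt, h⟩ := M.SDop_approx hS t ht he
  refine ⟨M.SDop (fun s => V (ε + s)) (t - ε), ?_, ?_⟩
  · exact M.SDop_compact0 (shift_nc hV hε) (fun s hs => hK _ (add_pos_of_pos_of_nonneg hε hs))
      (sub_pos.2 hεt)
  · rw [dist_eq_norm]
    exact h t ⟨hεt.le, le_rfl⟩

end MRG

namespace MRG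

/-- The perturbation operator. -/
def B (M : MRG X Y) (L : Y →L[ℂ] X) (U : ℝ → (Y →L[ℂ] Y)) : ℝ → (Y →L[ℂ] Y) :=
  M.SDop (fun s => L.comp (U s))

theorem B_SC (M : MRG X Y) (L : Y →L[ℂ] X) {U : ℝ → (Y →L[ℂ] Y)} (hU : SC U) : SC (M.B L U) :=
  M.SDop_SC (hU.comp_left L)

theorem B_nc (M : MRG X Y) (L : Y →L[ℂ] X) {U : ℝ → (Y →L[ℂ] Y)} (hU : SC U)
    (h : ContinuousOn U (Ioi 0)) : ContinuousOn (M.B L U) (Ioi 0) :=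
  M.SDop_nc (hU.comp_left L) (continuousOn_const.clm_comp h)

theorem B_compact (M : MRG X Y) (L : Y →L[ℂ] X) {U : ℝ → (Y →L[ℂ] Y)} (hU : SC U)
    (h : ContinuousOn U (Ioi 0)) (hK : ∀ t, 0 < t → IsCompactOperator ⇑(U t)) {t : ℝ}
    (ht : 0 < t) : IsCompactOperator ⇑(M.B L U t) :=
  M.SDop_compact (hU.comp_left L) (continuousOn_const.clm_comp h)
    (fun s hs => (hK s hs).clm_comp L) ht

theorem B_le (M : MRG X Y) (L : Y →L[ℂ] X) {U : ℝ → (Y →L[ℂ] Y)} (hU : SC U)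
    {t : ℝ} (ht : 0 ≤ t) {C : ℝ} (hC : ∀ s ∈ Icc 0 t, ‖U s‖ ≤ C) :
    ‖M.B L U t‖ ≤ M.δ t * (‖L‖ * C) := by
  refine M.SDop_le (hU.comp_left L) ht fun s hs => ?_
  refine (ContinuousLinearMap.opNorm_comp_le _ _).trans ?_
  gcongr
  exact hC s hs

theorem B_sub (M : MRG X Y) (L : Y →L[ℂ] X) {U W : ℝ → (Y →L[ℂ] Y)} (hU : SC U) (hW : SC W)
    {t : ℝ} (ht : 0 ≤ t) : M.B L (fun s => U s - W s) t = M.B L U t - M.B L W t := by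
  unfold B
  rw [← M.SDop_sub (hU.comp_left L) (hW.comp_left L) ht]
  simp only [ContinuousLinearMap.comp_sub]

theorem fix_shift (M : MRG X Y) (L : Y →L[ℂ] X) {R : ℝ → (Y →L[ℂ] Y)} (hR : SC R)
    (hfix : ∀ t ∈ Ici (0:ℝ), R t = M.T t + M.B L R t) {a t : ℝ} (ha : 0 ≤ a) (ht : 0 ≤ t) :
    R (a + t) = (M.T t).comp (R a) + M.B L (fun s => R (a + s)) t := by
  rw [add_comm a t, hfix _ (add_nonneg ht ha), hfix a ha, M.T_add t a ht ha]
  unfold B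
  rw [M.SDop_shift (hR.comp_left L) ha ht, ContinuousLinearMap.comp_add, add_assoc]

theorem iter (M : MRG X Y) (L : Y →L[ℂ] X) : ∃ τ : ℝ, 0 < τ ∧ ∀ P V : ℝ → (Y →L[ℂ] Y),
    SC P → SC V → (∀ t, 0 ≤ t → P t = V t + M.B L P t) →
    ContinuousOn V (Ioi 0) →
    ContinuousOn P (Ioo 0 τ) ∧
    ((∀ t, 0 < t → IsCompactOperator ⇑(V t)) →
      ∀ t, 0 < t → t < τ → IsCompactOperator ⇑(P t)) := by
  obtain ⟨τ, hτ, hδ⟩ := M.δ_small (ε := 1 / (2 * (‖L‖ + 1))) (by positivity)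
  refine ⟨τ, hτ, ?_⟩
  intro P V hP hV hfix hVc
  let U : ℕ → ℝ → (Y →L[ℂ] Y) := fun n => Nat.rec V (fun _ W => fun t => V t + M.B L W t) n
  have hU0 : U 0 = V := rfl
  have hUs : ∀ n, U (n + 1) = fun t => V t + M.B L (U n) t := fun n => rfl
  have hUSC : ∀ n, SC (U n) := by
    intro n
    induction n with
    | zero => exact hV
    | succ n ih => rw [hUs]; exact hV.add (M.B_SC L ih)
  have hUc : ∀ n, ContinuousOn (U n) (Ioi 0) := by
    intro n
    induction n with
    | zero => exact hVc
    | succ n ih => rw [hUs]; exact hVc.add (M.B_nc L (hUSC n) ih)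
  obtain ⟨C, hC0, hC⟩ := (hP.sub hV).bdd τ
  have hlim : ∀ n, ∀ t ∈ Icc 0 τ, ‖P t - U n t‖ ≤ C * (1 / 2) ^ n := by
    intro n
    induction n with
    | zero => simpa [hU0] using hC
    | succ n ih =>
      intro t ht
      have e : P t - U (n + 1) t = M.B L (fun s => P s - U n s) t := by
        rw [M.B_sub L hP (hUSC n) ht.1, hUs]
        simp only
        rw [hfix t ht.1]
        abel
      rw [e]
      refine (M.B_le L (hP.sub (hUSC n)) ht.1 (fun s hs => ih s ⟨hs.1, hs.2.trans ht.2⟩)).trans ?_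
      have h1 := (hδ t ht).le
      have h2 : M.δ t * ‖L‖ ≤ 1 / 2 := by
        have h0 := M.δ_nonneg t ht.1
        rw [le_div_iff₀ (by positivity)] at h1
        nlinarith [norm_nonneg L]
      have h3 : 0 ≤ C * (1 / 2 : ℝ) ^ n := by positivity
      calc M.δ t * (‖L‖ * (C * (1 / 2) ^ n)) = (M.δ t * ‖L‖) * (C * (1 / 2) ^ n) := by ring
        _ ≤ 1 / 2 * (C * (1 / 2) ^ n) := by gcongr
        _ = C * (1 / 2) ^ (n + 1) := by ring
  have hz : Tendsto (fun n : ℕ => C * (1 / 2 : ℝ) ^ n) atTop (𝓝 0) := by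
    simpa using (tendsto_pow_atTop_nhds_zero_of_lt_one (r := (1 / 2 : ℝ)) (by norm_num)
      (by norm_num)).const_mul C
  constructor
  · refine continuousOn_of_uniform_approx_of_continuousOn fun u hu => ?_
    obtain ⟨e, he, heu⟩ := Metric.mem_uniformity_dist.1 hu
    obtain ⟨n, hn⟩ := (hz.eventually (gt_mem_nhds he)).exists
    refine ⟨U n, (hUc n).mono Ioo_subset_Ioi_self, fun y hy => heu ?_⟩
    rw [dist_eq_norm]
    exact (hlim n y ⟨hy.1.le, hy.2.le⟩).trans_lt hn
  · intro hK t ht htτ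
    have hUK : ∀ n, ∀ t, 0 < t → IsCompactOperator ⇑(U n t) := by
      intro n
      induction n with
      | zero => exact hK
      | succ n ih =>
        intro t ht
        rw [hUs]
        exact (hK t ht).add (M.B_compact L (hUSC n) (hUc n) ih ht)
    refine isCompactOperator_of_tendsto (l := atTop) (F := fun n => U n t) ?_
      (Eventually.of_forall fun n => hUK n t ht)
    rw [tendsto_iff_norm_sub_tendsto_zero]
    refine squeeze_zero (fun _ => norm_nonneg _) (fun n => ?_) hz
    rw [norm_sub_rev]
    exact hlim n t ⟨ht.le, htτ.le⟩

theorem nc_of_compact (M : MRG X Y) (L : Y →L[ℂ] X) {R : ℝ → (Y →L[ℂ] Y)} (hR : SC R)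
    (hfix : ∀ t ∈ Ici (0:ℝ), R t = M.T t + M.B L R t)
    (hK : ∀ t, 0 < t → IsCompactOperator ⇑(R t)) : ContinuousOn R (Ioi 0) := by
  refine continuousOn_of_locally_uniform_approx_of_continuousWithinAt ?_
  intro t ht u hu
  have ht : 0 < t := ht
  obtain ⟨e, he, heu⟩ := Metric.mem_uniformity_dist.1 hu
  obtain ⟨C, hC0, hC⟩ := hR.bdd (t + t)
  obtain ⟨η₁, hη₁, hδ⟩ := M.δ_small (ε := e / (‖L‖ * C + 1)) (by positivity)
  obtain ⟨η, hη, h1, h2⟩ : ∃ η, 0 < η ∧ η < t ∧ 2 * η ≤ η₁ :=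
    ⟨min (t / 2) (η₁ / 2), lt_min (by positivity) (by positivity),
      (min_le_left _ _).trans_lt (by linarith), by linarith [min_le_right (t / 2) (η₁ / 2)]⟩
  have ha : 0 < t - η := by linarith
  refine ⟨Icc (t - η) (t + η), nhdsWithin_le_nhds (Icc_mem_nhds (by linarith) (by linarith)),
    fun s => (M.T (s - (t - η))).comp (R (t - η)), ?_, fun y hy => heu ?_⟩
  · have h3 := (SC.comp_compact (U := M.T) M.T_cont (hK _ ha)).continuousAt (x := t - (t - η))
      (Ici_mem_nhds (by linarith))
    exact (ContinuousAt.comp (f := fun s => s - (t - η)) h3 (by fun_prop)).continuousWithinAt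
  · have hy0 : 0 ≤ y - (t - η) := by linarith [hy.1]
    have e1 := M.fix_shift L hR hfix ha.le hy0
    rw [add_sub_cancel] at e1
    rw [dist_eq_norm, e1, add_sub_cancel_left]
    refine (M.B_le L (hR.shift ha.le) hy0 (C := C) fun s hs => hC _
      ⟨by linarith [hs.1], by linarith [hs.2, hy.2]⟩).trans_lt ?_
    have h4 := hδ (y - (t - η)) ⟨hy0, by linarith [hy.2]⟩
    have h5 : 0 ≤ ‖L‖ * C := by positivity
    have h6 := M.δ_nonneg _ hy0
    rw [lt_div_iff₀ (by positivity)] at h4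
    rcases h6.eq_or_lt with h7 | h7
    · rw [← h7]; simpa using he
    · nlinarith

theorem main (M : MRG X Y) (L : Y →L[ℂ] X) (R : ℝ → (Y →L[ℂ] Y)) (hR : SC R)
    (hfix : ∀ t ∈ Ici (0:ℝ), R t = M.T t + M.B L R t) :
    (ContinuousOn M.T (Ioi 0) ↔ ContinuousOn R (Ioi 0)) ∧
    ((∀ t : ℝ, 0 < t → IsCompactOperator ⇑(M.T t)) ↔
      (∀ t : ℝ, 0 < t → IsCompactOperator ⇑(R t))) := by
  have hTR : ∀ t, 0 ≤ t → M.T t = R t - M.B L R t := fun t ht => by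
    rw [hfix t ht, add_sub_cancel_right]
  obtain ⟨τ, hτ, hit⟩ := M.iter L
  have hT : SC M.T := M.T_cont
  have hch : ∀ t : ℝ, 0 < t → ∃ a, 0 ≤ a ∧ 0 < t - a ∧ t - a < τ := fun t ht =>
    ⟨max 0 (t - τ / 2), le_max_left _ _, by
      rw [sub_pos]; exact max_lt ht (by linarith), by
      have := le_max_right 0 (t - τ / 2)
      linarith⟩
  have hV : ∀ a, ContinuousOn M.T (Ioi 0) →
      ContinuousOn (fun t => (M.T t).comp (R a)) (Ioi 0) := fun a h =>
    h.clm_comp continuousOn_const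
  have fwd : ContinuousOn M.T (Ioi 0) → ContinuousOn R (Ioi 0) := by
    intro h t ht
    obtain ⟨a, ha, h1, h2⟩ := hch t ht
    have h3 := (hit _ _ (hR.shift ha) (hT.comp_right (R a))
      (fun t ht => M.fix_shift L hR hfix ha ht) (hV a h)).1.continuousAt (x := t - a)
      (Ioo_mem_nhds h1 h2)
    have h4 := ContinuousAt.comp (f := fun s => s - a) h3 (by fun_prop)
    have h5 : ((fun s => R (a + s)) ∘ fun s => s - a) = R := by
      funext s
      simp
    rw [h5] at h4
    exact h4.continuousWithinAt
  refine ⟨⟨fwd, fun h => ?_⟩, ⟨fun h => ?_, fun h => ?_⟩⟩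
  · exact (h.sub (M.B_nc L hR h)).congr fun t ht => hTR t (le_of_lt ht)
  · intro t ht
    have hc : ContinuousOn M.T (Ioi 0) := by
      refine M.nc_of_compact 0 hT (fun t ht => ?_) h
      have : M.B 0 M.T t = 0 := by
        unfold B
        simp only [ContinuousLinearMap.zero_comp]
        exact M.SDop_zero ht
      rw [this, add_zero]
    obtain ⟨a, ha, h1, h2⟩ := hch t ht
    have h3 := (hit _ _ (hR.shift ha) (hT.comp_right (R a))
      (fun t ht => M.fix_shift L hR hfix ha ht) (hV a hc)).2
      (fun t ht => (h t ht).comp_clm (R a)) (t - a) h1 h2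
    rwa [add_sub_cancel] at h3
  · intro t ht
    have hc := M.nc_of_compact L hR hfix h
    rw [hTR t ht.le]
    exact (h t ht).sub (M.B_compact L hR hc h ht)

end MRG
end abstractSetting

/-- Passage to the abstract setting. -/
def MRSetting.toMRG (M : MRSetting X X₀) [CompleteSpace X₀] : MRG X X₀ where
  T := M.T
  S := M.S
  T_add := M.T_add
  T_cont := M.T_cont
  S_cont := M.S_cont
  TS := M.TS
  δ := M.δ
  δ_nonneg := M.δ_nonneg
  δ_mono := M.δ_mono
  δ_lim := M.δ_lim
  SD := M.SD
  SD_deriv := M.SD_deriv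
  SD_cont := M.SD_cont
  SD_bound := M.SD_bound
  SDop := M.SDop
  SDop_apply := M.SDop_apply

/-- immediate norm continuity and immediate compactness are preserved under
bounded perturbation. -/
theorem immediate_regularity_perturbation (M : MRSetting X X₀) (L : X₀ →L[ℂ] X)
    (R : ℝ → (X₀ →L[ℂ] X₀))
    (hRsc : ∀ x : X₀, ContinuousOn (fun t => R t x) (Ici 0))
    (hRfix : ∀ t ∈ Ici (0:ℝ), R t = M.T t + M.Bop L R t) :
    (ContinuousOn M.T (Ioi 0) ↔ ContinuousOn R (Ioi 0)) ∧
    ((∀ t : ℝ, 0 < t → IsCompactOperator ⇑(M.T t)) ↔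
      (∀ t : ℝ, 0 < t → IsCompactOperator ⇑(R t))) := by
  have : CompleteSpace X₀ := M.closed.completeSpace_coe
  exact M.toMRG.main L R hRsc hRfix

end
end
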